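/- Let N ≥ 2, q > 1, and let O ⊂ ℝ^{N+1} be a bounded open set. If the equation ∂_t u − Δu + u^q = 0 admits a large solution in O, then for every q₁ with 1 < q₁ < q the equation ∂_t u − Δu + u^{q₁} = 0 also admits a large solution in O. -/

import Mathlib

open MeasureTheory Metric Set
open scoped ENNReal NNReal

noncomputable section

/-- Points of `ℝ^{N+1}` are written `(x, t)` with `x ∈ ℝ^N` and `t ∈ ℝ`. -/
abbrev PSpace (N : ℕ) := EuclideanSpace ℝ (Fin N) × ℝ

/-- The parabolic cylinder `Q_δ(x,t) = B_δ(x) × (t - δ², t]`. -/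
def pQ (N : ℕ) (δ : ℝ) (z : PSpace N) : Set (PSpace N) :=
  ball z.1 δ ×ˢ Ioc (z.2 - δ ^ 2) z.2

/-- The parabolic cylinder `Q̃_r(x,t) = B_r(x) × (t - r², t + r²)`. -/
def pQt (N : ℕ) (r : ℝ) (z : PSpace N) : Set (PSpace N) :=
  ball z.1 r ×ˢ Ioo (z.2 - r ^ 2) (z.2 + r ^ 2)

/-- The parabolic boundary of an open set `O ⊆ ℝ^{N+1}`: points of the topological
boundary such that every downward cylinder `Q_δ` meets the complement of `O`. -/
def pBoundary (N : ℕ) (O : Set (PSpace N)) : Set (PSpace N) :=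
  {z ∈ frontier O | ∀ δ > 0, (pQ N δ z ∩ Oᶜ).Nonempty}

/-- Partial derivative in time. -/
def tDeriv {N : ℕ} (u : PSpace N → ℝ) (z : PSpace N) : ℝ :=
  deriv (fun s => u (z.1, s)) z.2

/-- Partial derivative in the `i`-th spatial direction. -/
def xDeriv {N : ℕ} (i : Fin N) (u : PSpace N → ℝ) (z : PSpace N) : ℝ :=
  lineDeriv ℝ (fun y => u (y, z.2)) z.1 (EuclideanSpace.single i 1)

/-- Second spatial partial derivative. -/
def xxDeriv {N : ℕ} (i j : Fin N) (u : PSpace N → ℝ) (z : PSpace N) : ℝ :=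
  xDeriv i (xDeriv j u) z

/-- Spatial Laplacian. -/
def lapl {N : ℕ} (u : PSpace N → ℝ) (z : PSpace N) : ℝ :=
  ∑ i : Fin N, xxDeriv i i u z

/-- Euclidean norm of the spatial gradient. -/
def gradNorm {N : ℕ} (u : PSpace N → ℝ) (z : PSpace N) : ℝ :=
  Real.sqrt (∑ i : Fin N, (xDeriv i u z) ^ 2)

/-- `u ∈ C^{2,1}(O)` : `u`, its first and second spatial derivatives and its time
derivative exist and are continuous in `O`. -/
structure IsC21 {N : ℕ} (O : Set (PSpace N)) (u : PSpace N → ℝ) : Prop where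
  cont : ContinuousOn u O
  diff_t : ∀ z ∈ O, DifferentiableAt ℝ (fun s => u (z.1, s)) z.2
  cont_t : ContinuousOn (tDeriv u) O
  diff_x : ∀ (i : Fin N), ∀ z ∈ O,
    LineDifferentiableAt ℝ (fun y => u (y, z.2)) z.1 (EuclideanSpace.single i 1)
  cont_x : ∀ i : Fin N, ContinuousOn (xDeriv i u) O
  diff_xx : ∀ (i j : Fin N), ∀ z ∈ O,
    LineDifferentiableAt ℝ (fun y => xDeriv j u (y, z.2)) z.1 (EuclideanSpace.single i 1)
  cont_xx : ∀ i j : Fin N, ContinuousOn (xxDeriv i j u) O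

/-- The blow-up condition `lim_{δ→0} inf_{O ∩ Q_δ(z)} u = ∞` at every point of the
parabolic boundary. -/
def BlowsUp {N : ℕ} (O : Set (PSpace N)) (u : PSpace N → ℝ) : Prop :=
  ∀ z ∈ pBoundary N O, ∀ M : ℝ, ∃ δ > (0 : ℝ), ∀ w ∈ O ∩ pQ N δ z, M ≤ u w

/-- A large solution of `∂_t u - Δu + f(u) = 0` in `O`. -/
def IsLargeSolution {N : ℕ} (O : Set (PSpace N)) (f : ℝ → ℝ) (u : PSpace N → ℝ) : Prop :=
  IsC21 O u ∧ (∀ z ∈ O, tDeriv u z - lapl u z + f (u z) = 0) ∧ BlowsUp O u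

/-- The parabolic Sobolev norm `‖φ‖_{W^{2,1}_p(ℝ^{N+1})}`. -/
def W21Norm (N : ℕ) (p : ℝ) (φ : PSpace N → ℝ) : ℝ :=
  (eLpNorm φ (ENNReal.ofReal p) volume).toReal
    + (eLpNorm (tDeriv φ) (ENNReal.ofReal p) volume).toReal
    + (eLpNorm (gradNorm φ) (ENNReal.ofReal p) volume).toReal
    + ∑ i : Fin N, ∑ j : Fin N, (eLpNorm (xxDeriv i j φ) (ENNReal.ofReal p) volume).toReal

/-- The capacity `Cap_{2,1,p}` of a compact set `K ⊆ ℝ^{N+1}`. -/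
def cap21c (N : ℕ) (p : ℝ) (K : Set (PSpace N)) : ℝ :=
  sInf { c | ∃ φ : SchwartzMap (PSpace N) ℝ,
    (∃ U, IsOpen U ∧ K ⊆ U ∧ ∀ z ∈ U, 1 ≤ φ z) ∧ c = W21Norm N p (fun z => φ z) ^ p }

/-- The capacity `Cap_{2,1,p}` of an arbitrary (Suslin) set. -/
def cap21 (N : ℕ) (p : ℝ) (E : Set (PSpace N)) : ℝ :=
  sSup { c | ∃ D, D ⊆ E ∧ IsCompact D ∧ c = cap21c N p D }

/-- The parabolic Hausdorff capacity `PH_ρ^N(E)`. -/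
def PHcap (N : ℕ) (ρ : ℝ) (E : Set (PSpace N)) : ℝ≥0∞ :=
  ⨅ (c : ℕ → PSpace N × ℝ)
    (_ : (∀ j, 0 ≤ (c j).2 ∧ (c j).2 ≤ ρ) ∧ E ⊆ ⋃ j, pQt N (c j).2 (c j).1),
    ∑' j, ENNReal.ofReal ((c j).2 ^ N)

/-- The truncated Riesz parabolic potential `I_2^R[μ]`. -/
def riesz (N : ℕ) (R : ℝ) (μ : Measure (PSpace N)) (z : PSpace N) : ℝ≥0∞ :=
  ∫⁻ ρ in Ioo (0 : ℝ) R, μ (pQt N ρ z) / ENNReal.ofReal (ρ ^ (N + 1))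

/-- The truncated fractional maximal parabolic potential `M_2^R[μ]`. -/
def maxPot (N : ℕ) (R : ℝ) (μ : Measure (PSpace N)) (z : PSpace N) : ℝ≥0∞ :=
  ⨆ (ρ : ℝ) (_ : ρ ∈ Ioo (0 : ℝ) R), μ (pQt N ρ z) / ENNReal.ofReal (ρ ^ N)

/-- The Gaussian heat kernel on `ℝ^{N+1}`. -/
def heatK (N : ℕ) (z : PSpace N) : ℝ :=
  if 0 < z.2 then (4 * Real.pi * z.2) ^ (-(N : ℝ) / 2) * Real.exp (-‖z.1‖ ^ 2 / (4 * z.2))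
  else 0

/-- The heat potential `(ℍ * μ)(x,t)` of a nonnegative measure. -/
def heatPot (N : ℕ) (μ : Measure (PSpace N)) (z : PSpace N) : ℝ≥0∞ :=
  ∫⁻ w, ENNReal.ofReal (heatK N (z.1 - w.1, z.2 - w.2)) ∂μ

/-- Exponential on `ℝ≥0∞`. -/
def expE (x : ℝ≥0∞) : ℝ≥0∞ := if x = ⊤ then ⊤ else ENNReal.ofReal (Real.exp x.toReal)

/-- Parabolic distance from a point to a set (taken over points at earlier times). -/
def pDist (N : ℕ) (z : PSpace N) (S : Set (PSpace N)) : ℝ :=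
  sInf { r | ∃ w ∈ S, w.2 ≤ z.2 ∧ r = max (dist z.1 w.1) (Real.sqrt (z.2 - w.2)) }

end

section LargeSolutions

open Filter Topology
open scoped ContDiff Convolution

set_option linter.unusedSectionVars false

section TestFunctions

variable {X : Type*} [NormedAddCommGroup X] [NormedSpace ℝ X] [FiniteDimensional ℝ X]

/-- The derivative of `g` in the direction `v`. -/
noncomputable def dirDeriv (v : X) (g : X → ℝ) (z : X) : ℝ := fderiv ℝ g z v

/-- Smooth test functions with compact support in `O`. -/
structure IsTest (O : Set X) (φ : X → ℝ) : Prop where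
  smooth : ContDiff ℝ ∞ φ
  compact : HasCompactSupport φ
  sub : tsupport φ ⊆ O

theorem contDiff_dirDeriv {g : X → ℝ} (hg : ContDiff ℝ ∞ g) (v : X) :
    ContDiff ℝ ∞ (dirDeriv v g) :=
  (hg.fderiv_right (m := ∞) (by simp)).clm_apply contDiff_const

theorem tsupport_dirDeriv_subset (g : X → ℝ) (v : X) : tsupport (dirDeriv v g) ⊆ tsupport g := by
  refine closure_minimal (fun z hz => ?_) (isClosed_tsupport g)
  refine tsupport_fderiv_subset ℝ (f := g) (subset_tsupport _ ?_)
  intro h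
  exact hz (by simp [dirDeriv, h])

theorem IsTest.dirDeriv {O : Set X} {φ : X → ℝ} (h : IsTest O φ) (v : X) :
    IsTest O (dirDeriv v φ) where
  smooth := contDiff_dirDeriv h.smooth v
  compact := h.compact.of_isClosed_subset (isClosed_tsupport _) (tsupport_dirDeriv_subset φ v)
  sub := (tsupport_dirDeriv_subset φ v).trans h.sub

theorem IsTest.mono {O O' : Set X} {φ : X → ℝ} (h : IsTest O φ) (hO : O ⊆ O') : IsTest O' φ :=
  ⟨h.smooth, h.compact, h.sub.trans hO⟩

theorem IsTest.bounded {O : Set X} {φ : X → ℝ} (h : IsTest O φ) : ∃ C, ∀ z, |φ z| ≤ C :=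
  h.compact.exists_bound_of_continuous h.smooth.continuous

theorem IsTest.smul_left {O : Set X} {φ χ : X → ℝ} (h : IsTest O φ) (hχ : ContDiff ℝ ∞ χ) :
    IsTest O (fun z => χ z * φ z) where
  smooth := hχ.mul h.smooth
  compact := h.compact.mul_left
  sub := (closure_mono (Function.support_mul_subset_right _ _)).trans h.sub

theorem IsTest.comp_add {φ : X → ℝ} (h : IsTest univ φ) (w : X) :
    IsTest univ (fun y => φ (w + y)) where
  smooth := h.smooth.comp (contDiff_const.add contDiff_id)
  compact := h.compact.comp_homeomorph (Homeomorph.addLeft w)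
  sub := subset_univ _

theorem dirDeriv_comp_add (φ : X → ℝ) (v w : X) :
    dirDeriv v (fun y => φ (w + y)) = fun y => dirDeriv v φ (w + y) := by
  funext y
  simp only [dirDeriv]
  rw [fderiv_comp_add_left]

theorem exists_isTest_one {K O : Set X} (hK : IsCompact K) (hO : IsOpen O) (hKO : K ⊆ O) :
    ∃ χ : X → ℝ, IsTest O χ ∧ (∀ z, 0 ≤ χ z ∧ χ z ≤ 1) ∧
      ∃ U, IsOpen U ∧ K ⊆ U ∧ ∀ z ∈ U, χ z = 1 := by
  obtain ⟨K', hK', hKK', hK'O⟩ := exists_compact_between hK hO hKO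
  obtain ⟨O', hO', hKO₂, hclO', hcO'⟩ : ∃ O', IsOpen O' ∧ K' ⊆ O' ∧ closure O' ⊆ O ∧
      IsCompact (closure O') := exists_open_between_and_isCompact_closure hK' hO hK'O
  obtain ⟨f, hf1, hfs, hf01⟩ := exists_contMDiff_support_eq_eq_one_iff
    (I := modelWithCornersSelf ℝ X) (n := ⊤) hO' hK'.isClosed hKO₂
  refine ⟨f, ⟨hf1.contDiff, ?_, ?_⟩, ?_, interior K', isOpen_interior, hKK', ?_⟩
  · rw [HasCompactSupport, tsupport, hf01.1]; exact hcO'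
  · rw [tsupport, hf01.1]; exact hclO'
  · intro z; exact hfs (mem_range_self z)
  · intro z hz; exact (hf01.2 z).1 (interior_subset hz)

variable [MeasureSpace X] [BorelSpace X] [(volume : Measure X).IsAddHaarMeasure]

theorem IsTest.integrable {O : Set X} {φ : X → ℝ} (h : IsTest O φ) : Integrable φ :=
  h.smooth.continuous.integrable_of_hasCompactSupport h.compact

theorem IsTest.integrable_mul {O : Set X} {φ u : X → ℝ} (h : IsTest O φ) (hO : IsOpen O)
    (hu : ContinuousOn u O) : Integrable (fun z => u z * φ z) := by
  refine Continuous.integrable_of_hasCompactSupport ?_ h.compact.mul_left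
  refine continuous_of_tsupport fun z hz => ?_
  have hz' : z ∈ O := h.sub (closure_mono (Function.support_mul_subset_right _ _) hz)
  exact (hu.continuousAt (hO.mem_nhds hz')).mul h.smooth.continuous.continuousAt

/-- `h` is the weak derivative of `u` in the direction `v` on `O`. -/
def WeakDeriv (O : Set X) (v : X) (u h : X → ℝ) : Prop :=
  ∀ φ, IsTest O φ → ∫ z, u z * dirDeriv v φ z = - ∫ z, h z * φ z

theorem weakDeriv_of_hasLineDerivAt {O : Set X} (hO : IsOpen O) {v : X} {u h : X → ℝ}
    (hu : ContinuousOn u O) (hh : ContinuousOn h O)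
    (hd : ∀ z ∈ O, HasLineDerivAt ℝ u (h z) z v) : WeakDeriv O v u h := by
  intro φ hφ
  refine integral_bilinear_hasLineDerivAt_right_eq_neg_left_of_integrable
    (B := ContinuousLinearMap.mul ℝ ℝ) (v := v) ?_ ?_ ?_ ?_ ?_
  · exact hφ.integrable_mul hO hh
  · exact (hφ.dirDeriv v).integrable_mul hO hu
  · exact hφ.integrable_mul hO hu
  · exact fun z hz => hd z (hφ.sub hz)
  · intro z _
    exact ((hφ.smooth.differentiable (by simp)) z).hasFDerivAt.hasLineDerivAt v

theorem eqOn_zero_of_integral_eq_zero {O : Set X} (hO : IsOpen O) {u : X → ℝ}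
    (hu : ContinuousOn u O) (h : ∀ φ, IsTest O φ → ∫ z, u z * φ z = 0) : ∀ z ∈ O, u z = 0 := by
  have h1 := hO.ae_eq_zero_of_integral_contDiff_smul_eq_zero (μ := (volume : Measure X)) (f := u)
    (hu.locallyIntegrableOn hO.measurableSet) (fun g hg hc hs => by
      rw [← h g ⟨hg, hc, hs⟩]; congr 1; ext z; simp [mul_comm])
  have h2 : EqOn u 0 O := by
    refine MeasureTheory.Measure.eqOn_of_ae_eq (μ := (volume : Measure X)) ?_ hu continuousOn_const ?_
    · exact (ae_restrict_iff' hO.measurableSet).2 h1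
    · rw [hO.interior_eq]; exact subset_closure
  exact h2

end TestFunctions

section Convolution

variable {X : Type*} [NormedAddCommGroup X] [NormedSpace ℝ X] [FiniteDimensional ℝ X]
  [MeasureSpace X] [BorelSpace X] [(volume : Measure X).IsAddHaarMeasure]

/-- The convolution of two real functions. -/
noncomputable def conv (K f : X → ℝ) (z : X) : ℝ := ∫ y, K y * f (z - y)

/-- The correlation of two real functions, adjoint to the convolution. -/
noncomputable def corr (K f : X → ℝ) (z : X) : ℝ := ∫ y, K y * f (z + y)

theorem conv_eq_convolution (K f : X → ℝ) :
    conv K f = K ⋆[ContinuousLinearMap.mul ℝ ℝ, volume] f := rfl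

theorem corr_eq_conv (K f : X → ℝ) : corr K f = conv (fun y => K (-y)) f := by
  funext z
  simp only [corr, conv]
  rw [← integral_neg_eq_self]
  simp [sub_eq_add_neg]

theorem conv_eq_integral_sub (K f : X → ℝ) (z : X) : conv K f z = ∫ y, K (z - y) * f y := by
  rw [conv_eq_convolution, convolution_mul_swap]

theorem contDiff_conv_right {K ρ : X → ℝ} (hK : LocallyIntegrable K) (hρ : IsTest univ ρ) :
    ContDiff ℝ ∞ (conv K ρ) :=
  hρ.compact.contDiff_convolution_right (ContinuousLinearMap.mul ℝ ℝ) hK (n := ⊤) hρ.smooth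

theorem dirDeriv_conv_right {K ρ : X → ℝ} (hK : LocallyIntegrable K) (hρ : IsTest univ ρ) (v : X) :
    dirDeriv v (conv K ρ) = conv K (dirDeriv v ρ) := by
  funext z
  have h := hρ.compact.hasFDerivAt_convolution_right (ContinuousLinearMap.mul ℝ ℝ) hK
    (hρ.smooth.of_le (by exact_mod_cast le_top)) z
  rw [dirDeriv, conv_eq_convolution, h.fderiv,
    convolution_precompR_apply _ hK (hρ.compact.fderiv ℝ)
      (hρ.smooth.continuous_fderiv (by simp))]
  rfl

theorem locallyIntegrable_comp_neg {K : X → ℝ} (hK : Integrable K) :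
    LocallyIntegrable (fun y => K (-y)) := hK.comp_neg.locallyIntegrable

theorem contDiff_corr {K ρ : X → ℝ} (hK : Integrable K) (hρ : IsTest univ ρ) :
    ContDiff ℝ ∞ (corr K ρ) := by
  rw [corr_eq_conv]; exact contDiff_conv_right (locallyIntegrable_comp_neg hK) hρ

theorem dirDeriv_corr {K ρ : X → ℝ} (hK : Integrable K) (hρ : IsTest univ ρ) (v : X) :
    dirDeriv v (corr K ρ) = corr K (dirDeriv v ρ) := by
  rw [corr_eq_conv, corr_eq_conv, dirDeriv_conv_right (locallyIntegrable_comp_neg hK) hρ]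

theorem conv_comm (K f : X → ℝ) : conv K f = conv f K := by
  funext z
  rw [conv_eq_integral_sub, conv]
  simp only [mul_comm]

theorem contDiff_conv_left {θ f : X → ℝ} (hθ : IsTest univ θ) (hf : LocallyIntegrable f) :
    ContDiff ℝ ∞ (conv θ f) := by
  rw [conv_comm]; exact contDiff_conv_right hf hθ

theorem dirDeriv_conv_left {θ f : X → ℝ} (hθ : IsTest univ θ) (hf : LocallyIntegrable f) (v : X) :
    dirDeriv v (conv θ f) = conv (dirDeriv v θ) f := by
  rw [conv_comm, conv_comm _ f, dirDeriv_conv_right hf hθ]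

theorem tsupport_corr_subset {K ρ : X → ℝ} {r s : ℝ} {z₀ : X}
    (hK : ∀ y, K y ≠ 0 → ‖y‖ ≤ r) (hρ : tsupport ρ ⊆ closedBall z₀ s) :
    tsupport (corr K ρ) ⊆ closedBall z₀ (r + s) := by
  refine closure_minimal (fun z hz => ?_) isClosed_closedBall
  by_contra hz'
  refine hz ?_
  rw [corr]
  refine integral_eq_zero_of_ae (Eventually.of_forall fun y => ?_)
  by_contra hy
  obtain ⟨h1, h2⟩ := mul_ne_zero_iff.1 hy
  have h3 := hρ (subset_tsupport _ h2)
  have h4 := hK y h1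
  rw [mem_closedBall, dist_eq_norm] at h3 hz'
  apply hz'
  calc ‖z - z₀‖ = ‖(z + y - z₀) - y‖ := by congr 1; abel
    _ ≤ ‖z + y - z₀‖ + ‖y‖ := norm_sub_le _ _
    _ ≤ r + s := by linarith

theorem integrable_mul_bounded {μ : Measure X} {K f : X → ℝ} {C : ℝ} (hK : Integrable K μ)
    (hf : AEStronglyMeasurable f μ) (hC : ∀ y, |f y| ≤ C) : Integrable (fun y => K y * f y) μ := by
  refine Integrable.mul_bdd (c := C) hK hf ?_
  exact Eventually.of_forall hC

theorem integrable_conv_integrand {K f : X → ℝ} {C : ℝ} (hK : Integrable K) (hf : Measurable f)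
    (hC : ∀ y, |f y| ≤ C) (z : X) : Integrable (fun y => K y * f (z - y)) :=
  integrable_mul_bounded hK (hf.comp (measurable_const.sub measurable_id)).aestronglyMeasurable
    fun _ => hC _

theorem integral_conv_mul {K f ρ : X → ℝ} {C : ℝ} (hK : Integrable K) (hf : Measurable f)
    (hC : ∀ y, |f y| ≤ C) (hρ : Integrable ρ) :
    ∫ z, conv K f z * ρ z = ∫ w, f w * corr K ρ w := by
  have h1 : Integrable (fun p : X × X => K p.1 * ρ p.2 * f (p.2 - p.1))
      ((volume : Measure X).prod volume) := by
    refine Integrable.mul_bdd (c := C) (hK.mul_prod hρ) ?_ (Eventually.of_forall fun p => hC _)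
    exact (hf.comp (measurable_snd.sub measurable_fst)).aestronglyMeasurable
  have h2 : Integrable (fun p : X × X => K p.1 * ρ (p.1 + p.2) * f p.2)
      ((volume : Measure X).prod volume) := by
    have := (measurePreserving_prod_add (volume : Measure X) (volume : Measure X)).integrable_comp_of_integrable h1
    simpa [Function.comp_def] using this
  calc ∫ z, conv K f z * ρ z = ∫ z, ∫ y, K y * ρ z * f (z - y) := by
        congr 1; ext z; rw [conv, ← integral_mul_const]; congr 1; ext y; ring
    _ = ∫ y, ∫ z, K y * ρ z * f (z - y) := (integral_integral_swap h1).symm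
    _ = ∫ y, ∫ w, K y * ρ (y + w) * f w := by
        congr 1; ext y
        rw [← integral_add_left_eq_self _ y]
        simp
    _ = ∫ w, ∫ y, K y * ρ (y + w) * f w := integral_integral_swap h2
    _ = ∫ w, f w * corr K ρ w := by
        congr 1; ext w; rw [corr, ← integral_const_mul]; congr 1; ext y; rw [add_comm]; ring

/-- The modulus of continuity of translations in `L¹`. -/
noncomputable def transModulus (K : X → ℝ) (h : X) : ℝ := ∫ y, |K (y + h) - K y|

theorem tendsto_transModulus_of_compact {g : X → ℝ} (hg : Continuous g) (hc : HasCompactSupport g) :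
    Tendsto (transModulus g) (𝓝 0) (𝓝 0) := by
  obtain ⟨C, hC⟩ := hc.exists_bound_of_continuous hg
  have hcomp : IsCompact (cthickening 1 (tsupport g)) := hc.isCompact.cthickening
  have key : Tendsto (fun h => ∫ y, |g (y + h) - g y|) (𝓝 (0 : X)) (𝓝 (∫ y : X, (0 : ℝ))) := by
    refine tendsto_integral_filter_of_dominated_convergence
      (indicator (cthickening 1 (tsupport g)) (fun _ => 2 * C)) ?_ ?_ ?_ ?_
    · exact Eventually.of_forall fun h => Continuous.aestronglyMeasurable (by fun_prop)
    · filter_upwards [closedBall_mem_nhds (0 : X) one_pos] with h hh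
      refine Eventually.of_forall fun y => ?_
      by_cases hy : y ∈ cthickening 1 (tsupport g)
      · rw [indicator_of_mem hy]
        have h1 := hC (y + h)
        have h2 := hC y
        simp only [Real.norm_eq_abs, abs_abs] at h1 h2 ⊢
        linarith [abs_sub (g (y + h)) (g y)]
      · rw [indicator_of_notMem hy]
        have h1 : g y = 0 := by
          by_contra h0
          exact hy (self_subset_cthickening _ (subset_tsupport _ h0))
        have h2 : g (y + h) = 0 := by
          by_contra h0
          refine hy (mem_cthickening_of_dist_le y (y + h) 1 _ (subset_tsupport _ h0) ?_)
          simpa using hh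
        simp [h1, h2]
    · exact (integrable_indicator_iff hcomp.measurableSet).2
        (integrableOn_const hcomp.measure_lt_top.ne)
    · refine Eventually.of_forall fun y => ?_
      have : Continuous fun h => |g (y + h) - g y| := by fun_prop
      simpa using this.tendsto 0
  rw [integral_zero] at key
  exact key

theorem tendsto_transModulus {K : X → ℝ} (hK : Integrable K) :
    Tendsto (transModulus K) (𝓝 0) (𝓝 0) := by
  rw [Metric.tendsto_nhds]
  intro ε hε
  obtain ⟨g, hgc, hg1, hg2, hg3⟩ := hK.exists_hasCompactSupport_integral_sub_le
    (ε := ε / 4) (by positivity)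
  filter_upwards [(Metric.tendsto_nhds.1 (tendsto_transModulus_of_compact hg2 hgc)) (ε / 4)
    (by positivity)] with h hh
  have h0 : 0 ≤ transModulus K h := integral_nonneg fun _ => abs_nonneg _
  rw [Real.dist_eq, sub_zero] at hh ⊢
  rw [abs_of_nonneg h0]
  have hi : Integrable (fun y => |K y - g y|) := (hK.sub hg3).abs
  have hi' : Integrable (fun y => |K (y + h) - g (y + h)|) := hi.comp_add_right h
  have hi2 : Integrable (fun y => |g (y + h) - g y|) := ((hg3.comp_add_right h).sub hg3).abs
  calc transModulus K h ≤ ∫ y, (|K (y + h) - g (y + h)| + |g (y + h) - g y|) + |K y - g y| := by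
        refine integral_mono ((hK.comp_add_right h).sub hK).abs ((hi'.add hi2).add hi) fun y => ?_
        have := abs_add_three (K (y + h) - g (y + h)) (g (y + h) - g y) (g y - K y)
        rw [abs_sub_comm (g y)] at this
        refine le_trans (le_of_eq ?_) this
        simp only
        congr 1
        ring
    _ = (∫ y, |K y - g y|) + transModulus g h + ∫ y, |K y - g y| := by
        have h1 := integral_add (hi'.add hi2) hi
        have h2 := integral_add hi' hi2
        have h3 := integral_add_right_eq_self (μ := (volume : Measure X)) (fun y => |K y - g y|) h
        simp only [Pi.add_apply] at h1 h2 h3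
        rw [h1, h2, h3]
        rfl
    _ < ε := by
        have := (abs_lt.1 hh).2
        simp only [Real.norm_eq_abs] at hg1
        linarith

theorem abs_conv_sub_le {K f : X → ℝ} {C : ℝ} (hK : Integrable K) (hf : Measurable f)
    (hC : ∀ y, |f y| ≤ C) (z z' : X) :
    |conv K f z - conv K f z'| ≤ C * transModulus K (z - z') := by
  have hInt : ∀ z, Integrable (fun y => K (z - y) * f y) := fun z => by
    have := (integrable_conv_integrand hK hf hC z).comp_sub_left z
    simpa using this
  have hKz : ∀ z, Integrable (fun y => K (z - y)) := fun z => hK.comp_sub_left z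
  have hC0 : 0 ≤ C := (abs_nonneg _).trans (hC 0)
  rw [conv_eq_integral_sub, conv_eq_integral_sub, ← integral_sub (hInt z) (hInt z')]
  calc |∫ y, (K (z - y) * f y - K (z' - y) * f y)|
      ≤ ∫ y, |K (z - y) * f y - K (z' - y) * f y| := abs_integral_le_integral_abs
    _ ≤ ∫ y, C * |K (z - y) - K (z' - y)| := by
        refine integral_mono ((hInt z).sub (hInt z')).abs
          (((hKz z).sub (hKz z')).abs.const_mul C) fun y => ?_
        simp only
        rw [← sub_mul, abs_mul, mul_comm]
        exact mul_le_mul_of_nonneg_right (hC y) (abs_nonneg _)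
    _ = C * transModulus K (z - z') := by
        rw [integral_const_mul, transModulus,
          ← integral_sub_left_eq_self (fun y => |K (y + (z - z')) - K y|) volume z']
        congr 2; ext y; congr 3; abel

theorem continuous_conv {K f : X → ℝ} {C : ℝ} (hK : Integrable K) (hf : Measurable f)
    (hC : ∀ y, |f y| ≤ C) : Continuous (conv K f) := by
  rw [continuous_iff_continuousAt]
  intro z
  rw [ContinuousAt, tendsto_iff_dist_tendsto_zero]
  have h1 : Tendsto (fun w => C * transModulus K (w - z)) (𝓝 z) (𝓝 0) := by
    have : Tendsto (fun w : X => w - z) (𝓝 z) (𝓝 0) := by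
      have : Continuous fun w : X => w - z := by fun_prop
      simpa using this.tendsto z
    simpa using ((tendsto_transModulus hK).comp this).const_mul C
  exact squeeze_zero (fun _ => dist_nonneg) (fun w => abs_conv_sub_le hK hf hC w z) h1

theorem weakDeriv_conv {K K' f : X → ℝ} {C : ℝ} {v : X} (hK : Integrable K) (hK' : Integrable K')
    (hw : WeakDeriv univ v K K') (hf : Measurable f) (hC : ∀ y, |f y| ≤ C) :
    WeakDeriv univ v (conv K f) (conv K' f) := by
  intro φ hφ
  rw [integral_conv_mul hK hf hC (hφ.dirDeriv v).integrable,
    integral_conv_mul hK' hf hC hφ.integrable, ← integral_neg]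
  congr 1; ext w
  rw [← mul_neg]
  congr 1
  have := hw _ (hφ.comp_add w)
  rw [dirDeriv_comp_add] at this
  exact this

end Convolution

section DuBoisReymond

variable {X : Type*} [NormedAddCommGroup X] [NormedSpace ℝ X] [FiniteDimensional ℝ X]

theorem IsTest.comp_sub {φ : X → ℝ} {r : ℝ} (h : IsTest univ φ) (hr : tsupport φ ⊆ closedBall 0 r)
    (p : X) : IsTest (closedBall p r) (fun y => φ (p - y)) where
  smooth := h.smooth.comp (contDiff_const.sub contDiff_id)
  compact := h.compact.comp_homeomorph (Homeomorph.subLeft p)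
  sub := by
    refine closure_minimal (fun y hy => ?_) isClosed_closedBall
    have := hr (subset_tsupport _ hy)
    rwa [mem_closedBall, dist_zero_right, ← dist_eq_norm, dist_comm] at this

theorem dirDeriv_comp_sub {φ : X → ℝ} (h : Differentiable ℝ φ) (v w : X) :
    dirDeriv v (fun y => φ (w - y)) = fun y => - dirDeriv v φ (w - y) := by
  funext y
  simp only [dirDeriv]
  have h1 := (h (w - y)).hasFDerivAt.comp y ((hasFDerivAt_id (𝕜 := ℝ) y).const_sub w)
  have h2 : fderiv ℝ (fun y => φ (w - y)) y = _ := h1.fderiv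
  rw [h2]
  simp

variable [MeasureSpace X] [BorelSpace X] [(volume : Measure X).IsAddHaarMeasure]

theorem WeakDeriv.congr {O : Set X} {v : X} {u h u' h' : X → ℝ} (H : WeakDeriv O v u h)
    (hu : EqOn u u' O) (hh : EqOn h h' O) : WeakDeriv O v u' h' := by
  have aux : ∀ f f' φ : X → ℝ, EqOn f f' O → tsupport φ ⊆ O →
      ∫ z, f' z * φ z = ∫ z, f z * φ z := by
    intro f f' φ hf hφ
    congr 1; ext z
    by_cases hz : z ∈ O
    · rw [hf hz]
    · rw [image_eq_zero_of_notMem_tsupport (fun h => hz (hφ h)), mul_zero, mul_zero]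
  intro φ hφ
  rw [aux _ _ _ hu (hφ.dirDeriv v).sub, aux _ _ _ hh hφ.sub]
  exact H φ hφ

theorem WeakDeriv.mono {O O' : Set X} {v : X} {u h : X → ℝ} (H : WeakDeriv O v u h)
    (hO : O' ⊆ O) : WeakDeriv O' v u h :=
  fun φ hφ => H φ (hφ.mono hO)

theorem WeakDeriv.conv_dirDeriv {O : Set X} {v p : X} {u h θ : X → ℝ} {r : ℝ}
    (H : WeakDeriv O v u h) (hθ : IsTest univ θ) (hr : tsupport θ ⊆ closedBall 0 r)
    (hp : closedBall p r ⊆ O) : conv (dirDeriv v θ) u p = conv θ h p := by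
  have h1 := H _ ((hθ.comp_sub hr p).mono hp)
  rw [dirDeriv_comp_sub (hθ.smooth.differentiable (by simp))] at h1
  simp only [mul_neg, integral_neg, neg_inj] at h1
  rw [conv_eq_integral_sub, conv_eq_integral_sub]
  simpa only [mul_comm] using h1

theorem hasLineDerivAt_of_weakDeriv {O : Set X} (hO : IsOpen O) {v : X} {u h : X → ℝ}
    (hu : ContinuousOn u O) (hh : ContinuousOn h O) (H : WeakDeriv O v u h) {z : X} (hz : z ∈ O) :
    HasLineDerivAt ℝ u (h z) z v := by
  obtain ⟨R, hR, hRO⟩ := Metric.nhds_basis_closedBall.mem_iff.1 (hO.mem_nhds hz)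
  obtain ⟨r, hr, hrR⟩ : ∃ r > 0, 2 * r = R := ⟨R / 2, by positivity, by ring⟩
  set B := closedBall z R with hB
  have hBc : IsCompact B := isCompact_closedBall z R
  have hind : ∀ f : X → ℝ, ContinuousOn f O → Integrable (indicator B f) := fun f hf =>
    (integrable_indicator_iff hBc.measurableSet).2 ((hf.mono hRO).integrableOn_compact hBc)
  let φ : ℕ → ContDiffBump (0 : X) := fun n =>
    { rIn := r / (n + 1) / 2
      rOut := r / (n + 1)
      rIn_pos := by positivity
      rIn_lt_rOut := half_lt_self (by positivity) }
  have hφr : ∀ n, (φ n).rOut ≤ r := fun n =>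
    div_le_self hr.le (by linarith [n.cast_nonneg (α := ℝ)])
  have hφ0 : Tendsto (fun n => (φ n).rOut) atTop (𝓝 0) :=
    by simpa [φ, div_eq_mul_inv] using
      (tendsto_one_div_add_atTop_nhds_zero_nat (𝕜 := ℝ)).const_mul r
  let ρ : ℕ → X → ℝ := fun n => (φ n).normed volume
  have hρ : ∀ n, IsTest univ (ρ n) := fun n =>
    ⟨(φ n).contDiff_normed (n := ⊤), (φ n).hasCompactSupport_normed, subset_univ _⟩
  have hρs : ∀ n, tsupport (ρ n) ⊆ closedBall 0 r := fun n => by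
    rw [(φ n).tsupport_normed_eq]; exact closedBall_subset_closedBall (hφr n)
  have hball : ∀ p ∈ ball z r, closedBall p r ⊆ B := fun p hp =>
    closedBall_subset_closedBall' (by rw [mem_ball] at hp; linarith)
  have hunif : ∀ f : X → ℝ, ContinuousOn f O →
      TendstoUniformlyOn (fun n => conv (ρ n) (indicator B f)) f atTop (ball z r) := by
    intro f hf
    rw [Metric.tendstoUniformlyOn_iff]
    intro ε hε
    obtain ⟨δ, hδ, hfδ⟩ := Metric.uniformContinuousOn_iff.1
      (hBc.uniformContinuousOn_of_continuous (hf.mono hRO)) (ε / 2) (by positivity)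
    filter_upwards [hφ0.eventually (gt_mem_nhds hδ)] with n hn p hp
    have hpB := hball p hp
    have h1 := (φ n).dist_normed_convolution_le (x₀ := p) (ε := ε / 2)
      (hind f hf).aestronglyMeasurable (fun x hx => by
        have hx' : x ∈ B := hpB (closedBall_subset_closedBall (hφr n) (ball_subset_closedBall hx))
        have hp' : p ∈ B := hpB (mem_closedBall_self hr.le)
        rw [indicator_of_mem hx', indicator_of_mem hp']
        exact (hfδ x hx' p hp' (lt_trans hx hn)).le)
    rw [indicator_of_mem (hpB (mem_closedBall_self hr.le)), dist_comm] at h1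
    exact h1.trans_lt (by linarith)
  have hweak : WeakDeriv (ball z R) v (indicator B u) (indicator B h) :=
    (H.mono (ball_subset_closedBall.trans hRO)).congr
      (fun x hx => (indicator_of_mem (ball_subset_closedBall hx) u).symm)
      (fun x hx => (indicator_of_mem (ball_subset_closedBall hx) h).symm)
  have hline : Continuous fun s : ℝ => z + s • v := by fun_prop
  set S : Set ℝ := (fun s : ℝ => z + s • v) ⁻¹' ball z r with hS
  have h0S : (0 : ℝ) ∈ S := by simp [hS, hr]
  have key := hasDerivAt_of_tendstoUniformlyOn (l := atTop) (s := S) (x := 0)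
    (f := fun n s => conv (ρ n) (indicator B u) (z + s • v))
    (f' := fun n s => conv (ρ n) (indicator B h) (z + s • v))
    (g := fun s => u (z + s • v)) (g' := fun s => h (z + s • v))
    (isOpen_ball.preimage hline) ((hunif h hh).comp _) ?_ ?_ h0S
  · simpa [HasLineDerivAt] using key
  · refine Eventually.of_forall fun n s hs => ?_
    have h1 := ((contDiff_conv_left (hρ n) (hind u hu).locallyIntegrable).differentiable
      (by simp) (z + s • v)).hasFDerivAt.comp_hasDerivAt s
        (((hasDerivAt_id s).smul_const v).const_add z)
    have h2 : conv (dirDeriv v (ρ n)) (indicator B u) (z + s • v) =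
        conv (ρ n) (indicator B h) (z + s • v) := by
      refine hweak.conv_dirDeriv (r := (φ n).rOut) (hρ n) ((φ n).tsupport_normed_eq).subset ?_
      have hs' : dist (z + s • v) z < r := hs
      exact closedBall_subset_ball' (by linarith [hφr n])
    rw [← h2, ← dirDeriv_conv_left (hρ n) (hind u hu).locallyIntegrable]
    simpa [dirDeriv, Function.comp_def] using h1
  · intro s hs
    exact (hunif u hu).tendsto_at hs

end DuBoisReymond

section HeatKernel

variable {N : ℕ}

instance isAddHaarMeasure_volume_pSpace (N : ℕ) :
    (volume : Measure (PSpace N)).IsAddHaarMeasure :=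
  inferInstanceAs ((volume.prod volume : Measure (EuclideanSpace ℝ (Fin N) × ℝ)).IsAddHaarMeasure)

theorem heatK_of_pos {t : ℝ} (ht : 0 < t) (x : EuclideanSpace ℝ (Fin N)) :
    heatK N (x, t) = (4 * Real.pi * t) ^ (-(N : ℝ) / 2) * Real.exp (-‖x‖ ^ 2 / (4 * t)) :=
  if_pos ht

theorem heatK_of_nonpos {t : ℝ} (ht : t ≤ 0) (x : EuclideanSpace ℝ (Fin N)) :
    heatK N (x, t) = 0 := if_neg ht.not_gt

theorem heatK_nonneg (z : PSpace N) : 0 ≤ heatK N z := by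
  unfold heatK
  split_ifs <;> positivity

theorem measurable_heatK : Measurable (heatK N) := by
  unfold heatK
  refine Measurable.ite (measurableSet_lt measurable_const measurable_snd) ?_ measurable_const
  refine Measurable.mul ?_ ?_
  · exact (measurable_const.mul measurable_snd).pow_const _
  · exact ((measurable_fst.norm.pow_const 2).neg.div (measurable_const.mul measurable_snd)).exp

theorem integral_heatK {t : ℝ} (ht : 0 < t) : ∫ x, heatK N (x, t) = 1 := by
  simp only [heatK_of_pos ht]
  rw [integral_const_mul]
  have h := GaussianFourier.integral_rexp_neg_mul_sq_norm (V := EuclideanSpace ℝ (Fin N))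
    (b := 1 / (4 * t)) (by positivity)
  have e : ∀ x : EuclideanSpace ℝ (Fin N), -‖x‖ ^ 2 / (4 * t) = -(1 / (4 * t)) * ‖x‖ ^ 2 :=
    fun x => by ring
  simp only [e, h]
  rw [show Real.pi / (1 / (4 * t)) = 4 * Real.pi * t by field_simp, finrank_euclideanSpace_fin,
    ← Real.rpow_add (by positivity)]
  ring_nf
  simp

theorem integrable_heatK {t : ℝ} (ht : 0 < t) : Integrable (fun x => heatK N (x, t)) :=
  Integrable.of_integral_ne_zero (by rw [integral_heatK ht]; exact one_ne_zero)

theorem norm_mul_heatK_le {t : ℝ} (ht : 0 < t) (x : EuclideanSpace ℝ (Fin N)) :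
    ‖x‖ / t * heatK N (x, t) ≤ 2 * 2 ^ ((N : ℝ) / 2) * t ^ (-(1 / 2) : ℝ) * heatK N (x, 2 * t) := by
  rw [heatK_of_pos ht, heatK_of_pos (by positivity)]
  obtain ⟨s, hs, rfl⟩ : ∃ s > 0, t = s ^ 2 :=
    ⟨√t, Real.sqrt_pos.2 ht, (Real.sq_sqrt ht.le).symm⟩
  have h1 : (s ^ 2) ^ (-(1 / 2) : ℝ) = s⁻¹ := by
    rw [← Real.rpow_natCast, ← Real.rpow_mul hs.le]
    norm_num
    exact Real.rpow_neg_one s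
  have h2 : (2 : ℝ) ^ ((N : ℝ) / 2) * (4 * Real.pi * (2 * s ^ 2)) ^ (-(N : ℝ) / 2) =
      (4 * Real.pi * s ^ 2) ^ (-(N : ℝ) / 2) := by
    rw [show 4 * Real.pi * (2 * s ^ 2) = 2 * (4 * Real.pi * s ^ 2) by ring,
      Real.mul_rpow (by positivity) (by positivity), ← mul_assoc,
      ← Real.rpow_add (by positivity)]
    ring_nf
    simp
  have h3 : Real.exp (-‖x‖ ^ 2 / (4 * s ^ 2)) =
      Real.exp (-‖x‖ ^ 2 / (4 * (2 * s ^ 2))) * Real.exp (-(‖x‖ ^ 2 / (8 * s ^ 2))) := by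
    rw [← Real.exp_add]; congr 1; field_simp; ring
  have h4 : ‖x‖ / s * Real.exp (-(‖x‖ ^ 2 / (8 * s ^ 2))) ≤ 2 := by
    rw [Real.exp_neg, ← div_eq_mul_inv, div_le_iff₀ (Real.exp_pos _)]
    have h5 := Real.add_one_le_exp (‖x‖ ^ 2 / (8 * s ^ 2))
    have h6 : ‖x‖ ^ 2 / (8 * s ^ 2) = (‖x‖ / s) ^ 2 / 8 := by field_simp
    rw [h6] at h5 ⊢
    nlinarith [sq_nonneg (‖x‖ / s - 2)]
  calc ‖x‖ / s ^ 2 * ((4 * Real.pi * s ^ 2) ^ (-(N : ℝ) / 2) * Real.exp (-‖x‖ ^ 2 / (4 * s ^ 2)))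
      = s⁻¹ * (4 * Real.pi * s ^ 2) ^ (-(N : ℝ) / 2) * Real.exp (-‖x‖ ^ 2 / (4 * (2 * s ^ 2))) *
        (‖x‖ / s * Real.exp (-(‖x‖ ^ 2 / (8 * s ^ 2)))) := by
        rw [h3]; field_simp
    _ ≤ s⁻¹ * (4 * Real.pi * s ^ 2) ^ (-(N : ℝ) / 2) * Real.exp (-‖x‖ ^ 2 / (4 * (2 * s ^ 2))) *
        2 := by gcongr
    _ = _ := by rw [h1, ← h2]; ring

theorem integrable_norm_mul_heatK {t : ℝ} (ht : 0 < t) :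
    Integrable (fun x => ‖x‖ * heatK N (x, t)) := by
  refine ((integrable_heatK (N := N) (t := 2 * t) (by positivity)).const_mul
    (t * (2 * 2 ^ ((N : ℝ) / 2) * t ^ (-(1 / 2) : ℝ)))).mono' ?_ (Eventually.of_forall fun x => ?_)
  · exact (measurable_norm.mul (measurable_heatK.comp
      (measurable_id.prodMk measurable_const))).aestronglyMeasurable
  · have h := norm_mul_heatK_le ht x
    rw [Real.norm_of_nonneg (mul_nonneg (norm_nonneg _) (heatK_nonneg _)), mul_assoc]
    calc ‖x‖ * heatK N (x, t) = t * (‖x‖ / t * heatK N (x, t)) := by field_simp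
      _ ≤ _ := by gcongr

theorem integrable_mul_heatK {g : ℝ → ℝ} {c : ℝ} (hc : 0 < c) (hg : Measurable g)
    (hi : IntegrableOn g (Ioi 0)) :
    Integrable (fun z : PSpace N => g z.2 * heatK N (z.1, c * z.2)) := by
  have hm : Measurable (fun z : PSpace N => g z.2 * heatK N (z.1, c * z.2)) :=
    (hg.comp measurable_snd).mul (measurable_heatK.comp
      (measurable_fst.prodMk (measurable_const.mul measurable_snd)))
  refine (integrable_prod_iff' hm.aestronglyMeasurable).2 ⟨Eventually.of_forall fun t => ?_, ?_⟩
  · rcases lt_or_ge 0 t with ht | ht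
    · exact (integrable_heatK (t := c * t) (by positivity)).const_mul (g t)
    · have : c * t ≤ 0 := mul_nonpos_of_nonneg_of_nonpos hc.le ht
      simp [heatK_of_nonpos this]
  · refine ((integrable_indicator_iff measurableSet_Ioi).2 hi.norm).congr
      (Eventually.of_forall fun t => ?_)
    rcases lt_or_ge 0 t with ht | ht
    · simp only [indicator_of_mem (mem_Ioi.2 ht), norm_mul, integral_const_mul]
      simp only [Real.norm_of_nonneg (heatK_nonneg _),
        integral_heatK (show 0 < c * t by positivity), mul_one]
    · have : c * t ≤ 0 := mul_nonpos_of_nonneg_of_nonpos hc.le ht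
      simp [heatK_of_nonpos this, ht.not_gt]

/-- The fundamental solution of `∂_t - Δ + l`. -/
noncomputable def dampedHeatK (N : ℕ) (l : ℝ) (z : PSpace N) : ℝ :=
  Real.exp (-l * z.2) * heatK N z

theorem dampedHeatK_nonneg (l : ℝ) (z : PSpace N) : 0 ≤ dampedHeatK N l z :=
  mul_nonneg (Real.exp_pos _).le (heatK_nonneg z)

theorem integrable_dampedHeatK {l : ℝ} (hl : 0 < l) : Integrable (dampedHeatK N l) := by
  have := integrable_mul_heatK (N := N) one_pos (g := fun t => Real.exp (-l * t))
    (by fun_prop) (integrableOn_exp_mul_Ioi (by linarith) 0)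
  simp only [one_mul] at this
  exact this

theorem integral_dampedHeatK {l : ℝ} (hl : 0 < l) : ∫ z, dampedHeatK N l z = 1 / l := by
  have h : ∫ z, dampedHeatK N l z = ∫ t, ∫ x, dampedHeatK N l (x, t) :=
    integral_prod_symm _ (integrable_dampedHeatK hl)
  rw [h]
  have h2 : (fun t => ∫ x, dampedHeatK N l (x, t)) =
      indicator (Ioi 0) (fun t => Real.exp (-l * t)) := by
    funext t
    simp only [dampedHeatK, integral_const_mul]
    rcases lt_or_ge 0 t with ht | ht
    · rw [indicator_of_mem (mem_Ioi.2 ht), integral_heatK ht, mul_one]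
    · rw [indicator_of_notMem (by simpa using ht)]
      simp [heatK_of_nonpos ht]
  rw [h2, integral_indicator measurableSet_Ioi, integral_exp_mul_Ioi (by linarith)]
  simp

theorem hasFDerivAt_heatK_slice {t : ℝ} (ht : 0 < t) (x : EuclideanSpace ℝ (Fin N)) :
    HasFDerivAt (fun x => heatK N (x, t))
      ((-(1 / (2 * t)) * heatK N (x, t)) • innerSL ℝ x) x := by
  simp only [heatK_of_pos ht]
  have h1 : HasFDerivAt (fun x : EuclideanSpace ℝ (Fin N) => -‖x‖ ^ 2 / (4 * t))
      ((-(1 / (2 * t))) • innerSL ℝ x) x := by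
    have := ((hasStrictFDerivAt_norm_sq x).hasFDerivAt.const_mul (-(1 / (4 * t))))
    refine (this.congr_fderiv ?_).congr_of_eventuallyEq (Eventually.of_forall fun y => ?_)
    · rw [← Nat.cast_smul_eq_nsmul ℝ, smul_smul]; congr 1; push_cast; field_simp; norm_num
    · simp; ring
  refine (h1.exp.const_mul _).congr_fderiv ?_
  rw [smul_smul, smul_smul]; congr 1; ring

/-- Gaussian integration by parts on a time slice. -/
theorem integral_heatK_mul_dirDeriv {t : ℝ} (ht : 0 < t) (v : EuclideanSpace ℝ (Fin N))
    {g : EuclideanSpace ℝ (Fin N) → ℝ} (hg : ContDiff ℝ ∞ g) {C : ℝ} (hC : ∀ x, |g x| ≤ C)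
    (hC' : ∀ x, |dirDeriv v g x| ≤ C) :
    ∫ x, heatK N (x, t) * dirDeriv v g x =
      ∫ x, inner ℝ x v / (2 * t) * heatK N (x, t) * g x := by
  have hm : Measurable (fun x => heatK N (x, t)) :=
    measurable_heatK.comp (measurable_id.prodMk measurable_const)
  have hf : ∀ x, fderiv ℝ (fun x => heatK N (x, t)) x v =
      -(inner ℝ x v / (2 * t) * heatK N (x, t)) := fun x => by
    rw [(hasFDerivAt_heatK_slice ht x).fderiv]; simp; ring
  have hi : Integrable (fun x => inner ℝ x v / (2 * t) * heatK N (x, t)) := by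
    refine ((integrable_norm_mul_heatK ht).const_mul (‖v‖ / (2 * t))).mono' ?_
      (Eventually.of_forall fun x => ?_)
    · exact Measurable.aestronglyMeasurable (by fun_prop)
    · rw [norm_mul, Real.norm_of_nonneg (heatK_nonneg _), norm_div,
        Real.norm_of_nonneg (show 0 ≤ 2 * t by positivity)]
      calc ‖inner ℝ x v‖ / (2 * t) * heatK N (x, t)
          ≤ ‖x‖ * ‖v‖ / (2 * t) * heatK N (x, t) := by
            have := heatK_nonneg (x, t)
            gcongr; exact norm_inner_le_norm x v
        _ = _ := by ring
  have := integral_mul_fderiv_eq_neg_fderiv_mul_of_integrable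
    (μ := (volume : Measure (EuclideanSpace ℝ (Fin N)))) (v := v)
    (f := fun x => heatK N (x, t)) (g := g) ?_ ?_ ?_ ?_ ?_
  · simp only [hf] at this
    simp only [dirDeriv]
    rw [this, ← integral_neg]
    congr 1; ext x; ring
  · simp only [hf]
    exact integrable_mul_bounded hi.neg hg.continuous.aestronglyMeasurable hC
  · exact integrable_mul_bounded (integrable_heatK ht)
      (contDiff_dirDeriv hg v).continuous.aestronglyMeasurable hC'
  · exact integrable_mul_bounded (integrable_heatK ht) hg.continuous.aestronglyMeasurable hC
  · exact fun x _ => (hasFDerivAt_heatK_slice ht x).differentiableAt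
  · exact fun x _ => hg.differentiable (by simp) x

theorem heatK_smul_sqrt {t : ℝ} (ht : 0 < t) (y : EuclideanSpace ℝ (Fin N)) :
    heatK N (√t • y, t) = ((√t) ^ N)⁻¹ * heatK N (y, 1) := by
  rw [heatK_of_pos ht, heatK_of_pos one_pos, norm_smul, mul_pow, Real.norm_of_nonneg (Real.sqrt_nonneg t),
    Real.sq_sqrt ht.le, Real.mul_rpow (by positivity) ht.le, mul_one, mul_one]
  have : t ^ (-(N : ℝ) / 2) = ((√t) ^ N)⁻¹ := by
    rw [Real.sqrt_eq_rpow, ← Real.rpow_natCast, ← Real.rpow_mul ht.le, ← Real.rpow_neg ht.le]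
    congr 1; ring
  rw [this]
  have h2 : -(t * ‖y‖ ^ 2) / (4 * t) = -‖y‖ ^ 2 / 4 := by field_simp
  rw [h2]; ring

theorem integral_heatK_mul_eq {t : ℝ} (ht : 0 < t) (g : EuclideanSpace ℝ (Fin N) → ℝ) :
    ∫ x, heatK N (x, t) * g x = ∫ y, heatK N (y, 1) * g (√t • y) := by
  have h := Measure.integral_comp_smul_of_nonneg volume (fun x => heatK N (x, t) * g x) (√t)
    (hR := Real.sqrt_nonneg t)
  have hs : 0 < √t := Real.sqrt_pos.2 ht
  simp only [heatK_smul_sqrt ht, finrank_euclideanSpace_fin, mul_assoc, integral_const_mul,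
    smul_eq_mul] at h
  exact (mul_left_cancel₀ (by positivity) h).symm

end HeatKernel

section FundamentalSolution

variable {N : ℕ}

/-- The `i`-th spatial unit vector of space-time. -/
noncomputable def eX (i : Fin N) : PSpace N := (EuclideanSpace.single i 1, 0)

/-- The unit time vector of space-time. -/
def eT : PSpace N := (0, 1)

/-- The formal adjoint `-∂_t - Δ` of the heat operator. -/
noncomputable def heatAdj (φ : PSpace N → ℝ) (z : PSpace N) : ℝ :=
  - dirDeriv eT φ z - ∑ i, dirDeriv (eX i) (dirDeriv (eX i) φ) z

theorem tsupport_heatAdj_subset (φ : PSpace N → ℝ) : tsupport (heatAdj φ) ⊆ tsupport φ := by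
  refine closure_minimal (fun z hz => ?_) (isClosed_tsupport _)
  by_contra hz'
  refine hz ?_
  have h1 : ∀ v, dirDeriv v φ z = 0 := fun v =>
    image_eq_zero_of_notMem_tsupport fun h => hz' (tsupport_dirDeriv_subset φ v h)
  have h2 : ∀ v, dirDeriv v (dirDeriv v φ) z = 0 := fun v =>
    image_eq_zero_of_notMem_tsupport fun h => hz' (tsupport_dirDeriv_subset φ v
      (tsupport_dirDeriv_subset _ v h))
  simp [heatAdj, h1, h2]

theorem IsTest.heatAdj {O : Set (PSpace N)} {φ : PSpace N → ℝ} (h : IsTest O φ) :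
    IsTest O (heatAdj φ) where
  smooth := (contDiff_dirDeriv h.smooth _).neg.sub
    (ContDiff.sum fun _ _ => contDiff_dirDeriv (contDiff_dirDeriv h.smooth _) _)
  compact := h.compact.of_isClosed_subset (isClosed_tsupport _) (tsupport_heatAdj_subset φ)
  sub := (tsupport_heatAdj_subset φ).trans h.sub

theorem pair_eq_sum_eX (y : EuclideanSpace ℝ (Fin N)) :
    ((y, 0) : PSpace N) = ∑ i, y i • eX i := by
  have h : y = ∑ i, y i • EuclideanSpace.single i (1 : ℝ) := by
    ext j
    simp [Finset.sum_apply, Pi.single_apply]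
  refine Prod.ext ?_ ?_
  · rw [Prod.fst_sum]; exact h
  · rw [Prod.snd_sum]; simp [eX]

theorem hasDerivAt_test_scaling {ψ : PSpace N → ℝ} (hψ : ContDiff ℝ ∞ ψ)
    (y : EuclideanSpace ℝ (Fin N)) {t : ℝ} (ht : 0 < t) :
    HasDerivAt (fun t => ψ (√t • y, t))
      ((∑ i, y i * dirDeriv (eX i) ψ (√t • y, t)) / (2 * √t) + dirDeriv eT ψ (√t • y, t)) t := by
  have h1 : HasDerivAt (fun t : ℝ => ((√t • y, t) : PSpace N)) ((1 / (2 * √t)) • y, 1) t :=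
    ((Real.hasDerivAt_sqrt ht.ne').smul_const y).prodMk (hasDerivAt_id t)
  have h2 := HasFDerivAt.comp_hasDerivAt (f := fun t : ℝ => ((√t • y, t) : PSpace N)) t
    (hψ.differentiable (by simp) (√t • y, t)).hasFDerivAt h1
  refine h2.congr_deriv ?_
  have h3 : (((1 / (2 * √t)) • y, 1) : PSpace N) = (1 / (2 * √t)) • ((y, 0) : PSpace N) + eT := by
    simp [eT]
  rw [h3, map_add, map_smul, pair_eq_sum_eX, map_sum]
  simp only [map_smul, smul_eq_mul, dirDeriv]
  ring

theorem contDiff_slice {ψ : PSpace N → ℝ} (hψ : ContDiff ℝ ∞ ψ) (a t : ℝ) :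
    ContDiff ℝ ∞ (fun y : EuclideanSpace ℝ (Fin N) => ψ (a • y, t)) :=
  hψ.comp (g := ψ) (f := fun y : EuclideanSpace ℝ (Fin N) => ((a • y, t) : PSpace N))
    ((contDiff_id.const_smul a).prodMk contDiff_const)

theorem dirDeriv_slice {ψ : PSpace N → ℝ} (hψ : ContDiff ℝ ∞ ψ) (a t : ℝ) (i : Fin N)
    (y : EuclideanSpace ℝ (Fin N)) :
    dirDeriv (EuclideanSpace.single i 1) (fun y => ψ (a • y, t)) y =
      a * dirDeriv (eX i) ψ (a • y, t) := by
  have h1 : HasFDerivAt (fun y : EuclideanSpace ℝ (Fin N) => ((a • y, t) : PSpace N))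
      ((a • ContinuousLinearMap.id ℝ (EuclideanSpace ℝ (Fin N))).prod 0) y :=
    ((hasFDerivAt_id y).const_smul a).prodMk (hasFDerivAt_const t y)
  have h2 := (hψ.differentiable (by simp) (a • y, t)).hasFDerivAt.comp y h1
  have h3 : fderiv ℝ (fun y => ψ (a • y, t)) y = _ := h2.fderiv
  rw [dirDeriv, h3, dirDeriv, ← smul_eq_mul, ← map_smul]
  simp [eX]

/-- Evolution of the Gaussian mean of a test function. -/
theorem hasDerivAt_gaussian_mean {ψ : PSpace N → ℝ} (hψ : IsTest univ ψ) {t : ℝ} (ht : 0 < t) :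
    HasDerivAt (fun t => ∫ y, heatK N (y, 1) * ψ (√t • y, t))
      (-∫ y, heatK N (y, 1) * heatAdj ψ (√t • y, t)) t := by
  have hm : Measurable (fun x => heatK N (x, 1)) :=
    measurable_heatK.comp (measurable_id.prodMk measurable_const)
  have hK := integrable_heatK (N := N) one_pos
  have hKn := integrable_norm_mul_heatK (N := N) one_pos
  have hslice : ∀ (φ : PSpace N → ℝ) (s : ℝ), IsTest univ φ →
      AEStronglyMeasurable (fun y : EuclideanSpace ℝ (Fin N) => φ (√s • y, s)) volume := by
    intro φ s hφ
    have : Continuous (fun y : EuclideanSpace ℝ (Fin N) => φ (√s • y, s)) :=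
      (contDiff_slice hφ.smooth _ _).continuous
    exact this.aestronglyMeasurable
  have hInt : ∀ (φ : PSpace N → ℝ) (s : ℝ), IsTest univ φ →
      Integrable (fun y => heatK N (y, 1) * φ (√s • y, s)) := by
    intro φ s hφ
    obtain ⟨C, hC⟩ := hφ.bounded
    exact integrable_mul_bounded hK (hslice φ s hφ) fun y => hC _
  have hInt' : ∀ (φ : PSpace N → ℝ) (s : ℝ) (i : Fin N), IsTest univ φ →
      Integrable (fun y => heatK N (y, 1) * (y i * φ (√s • y, s))) := by
    intro φ s i hφ
    obtain ⟨C, hC⟩ := hφ.bounded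
    refine (hKn.mul_const C).mono' ?_ (Eventually.of_forall fun y => ?_)
    · refine hm.aestronglyMeasurable.mul (AEStronglyMeasurable.mul ?_ (hslice φ s hφ))
      exact Continuous.aestronglyMeasurable (by fun_prop)
    · rw [norm_mul, norm_mul, Real.norm_of_nonneg (heatK_nonneg _)]
      have h1 : ‖y i‖ ≤ ‖y‖ := PiLp.norm_apply_le y i
      have h2 : ‖φ (√s • y, s)‖ ≤ C := hC _
      have h3 := heatK_nonneg (y, (1 : ℝ))
      calc heatK N (y, 1) * (‖y i‖ * ‖φ (√s • y, s)‖) ≤ heatK N (y, 1) * (‖y‖ * C) := by gcongr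
        _ = _ := by ring
  choose C hC using fun v : PSpace N => (hψ.dirDeriv v).bounded
  set D : ℝ → EuclideanSpace ℝ (Fin N) → ℝ := fun s y =>
    (∑ i, y i * dirDeriv (eX i) ψ (√s • y, s)) / (2 * √s) + dirDeriv eT ψ (√s • y, s) with hD
  have key := (hasDerivAt_integral_of_dominated_loc_of_deriv_le (μ := volume) (x₀ := t)
    (F := fun s y => heatK N (y, 1) * ψ (√s • y, s)) (F' := fun s y => heatK N (y, 1) * D s y)
    (s := Ioi (t / 2))
    (bound := fun y => ‖y‖ * heatK N (y, 1) * ((∑ i, C (eX i)) / (2 * √(t / 2))) +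
      heatK N (y, 1) * C eT)
    (Ioi_mem_nhds (by linarith)) (Eventually.of_forall fun s => (hInt ψ s hψ).aestronglyMeasurable)
    (hInt ψ t hψ) ?_ ?_ ?_ ?_).2
  · refine key.congr_deriv ?_
    have e1 : ∀ y, heatK N (y, 1) * D t y =
        (∑ i, heatK N (y, 1) * (y i * dirDeriv (eX i) ψ (√t • y, t))) / (2 * √t) +
          heatK N (y, 1) * dirDeriv eT ψ (√t • y, t) := by
      intro y; rw [hD, ← Finset.mul_sum]; ring
    have e2 : ∀ y, heatK N (y, 1) * heatAdj ψ (√t • y, t) =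
        -(heatK N (y, 1) * dirDeriv eT ψ (√t • y, t)) -
          ∑ i, heatK N (y, 1) * dirDeriv (eX i) (dirDeriv (eX i) ψ) (√t • y, t) := by
      intro y; rw [heatAdj, ← Finset.mul_sum]; ring
    have hs : 0 < √t := Real.sqrt_pos.2 ht
    have e3 : ∀ i, ∫ y, heatK N (y, 1) * (y i * dirDeriv (eX i) ψ (√t • y, t)) =
        (2 * √t) * ∫ y, heatK N (y, 1) * dirDeriv (eX i) (dirDeriv (eX i) ψ) (√t • y, t) := by
      intro i
      obtain ⟨C₁, hC₁⟩ := (hψ.dirDeriv (eX i)).bounded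
      obtain ⟨C₂, hC₂⟩ := ((hψ.dirDeriv (eX i)).dirDeriv (eX i)).bounded
      have h1 := integral_heatK_mul_dirDeriv one_pos (EuclideanSpace.single i 1)
        (contDiff_slice (hψ.dirDeriv (eX i)).smooth (√t) t) (C := max C₁ (√t * C₂))
        (fun y => (hC₁ _).trans (le_max_left _ _)) (fun y => by
          rw [dirDeriv_slice (hψ.dirDeriv (eX i)).smooth, abs_mul, abs_of_pos hs]
          exact (mul_le_mul_of_nonneg_left (hC₂ _) hs.le).trans (le_max_right _ _))
      simp only [dirDeriv_slice (hψ.dirDeriv (eX i)).smooth] at h1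
      have h2 : ∀ y, heatK N (y, 1) * (√t * dirDeriv (eX i) (dirDeriv (eX i) ψ) (√t • y, t)) =
        √t * (heatK N (y, 1) * dirDeriv (eX i) (dirDeriv (eX i) ψ) (√t • y, t)) := fun y => by ring
      simp only [h2, integral_const_mul] at h1
      rw [mul_assoc, h1, ← integral_const_mul]
      congr 1; ext y
      rw [EuclideanSpace.inner_single_right]
      simp; ring
    simp only [e1, e2]
    rw [integral_add, integral_sub, integral_div, integral_finsetSum, integral_finsetSum,
      integral_neg]
    · simp only [e3]
      rw [← Finset.mul_sum]
      field_simp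
      ring
    · exact fun i _ => hInt _ _ ((hψ.dirDeriv (eX i)).dirDeriv (eX i))
    · exact fun i _ => hInt' _ _ _ (hψ.dirDeriv (eX i))
    · exact (hInt _ _ (hψ.dirDeriv eT)).neg
    · exact integrable_finsetSum _ fun i _ => hInt _ _ ((hψ.dirDeriv (eX i)).dirDeriv (eX i))
    · exact (integrable_finsetSum _ fun i _ => hInt' _ _ _ (hψ.dirDeriv (eX i))).div_const _
    · exact hInt _ _ (hψ.dirDeriv eT)
  · refine hm.aestronglyMeasurable.mul (AEStronglyMeasurable.add ?_ (hslice _ _ (hψ.dirDeriv _)))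
    have : Continuous fun y : EuclideanSpace ℝ (Fin N) =>
        (∑ i, y i * dirDeriv (eX i) ψ (√t • y, t)) / (2 * √t) := by
      refine Continuous.div_const (continuous_finsetSum _ fun i _ => Continuous.mul (by fun_prop)
        (contDiff_slice (hψ.dirDeriv (eX i)).smooth _ _).continuous) _
    exact this.aestronglyMeasurable
  · refine Eventually.of_forall fun y s hs => ?_
    have h0 := heatK_nonneg (y, (1 : ℝ))
    have hs' : √(t / 2) ≤ √s := Real.sqrt_le_sqrt (le_of_lt hs)
    have hs0 : 0 < √(t / 2) := Real.sqrt_pos.2 (by positivity)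
    have hC0 : ∀ v, 0 ≤ C v := fun v => (abs_nonneg _).trans (hC v 0)
    have h1 : |∑ i, y i * dirDeriv (eX i) ψ (√s • y, s)| ≤ ‖y‖ * ∑ i, C (eX i) := by
      rw [Finset.mul_sum]
      refine (Finset.abs_sum_le_sum_abs _ _).trans (Finset.sum_le_sum fun i _ => ?_)
      rw [abs_mul]
      exact mul_le_mul (PiLp.norm_apply_le y i) (hC _ _) (abs_nonneg _) (norm_nonneg _)
    have hS : 0 ≤ ∑ i, C (eX i) := Finset.sum_nonneg fun i _ => hC0 _
    rw [norm_mul, Real.norm_of_nonneg h0]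
    calc heatK N (y, 1) * ‖D s y‖
        ≤ heatK N (y, 1) * (‖y‖ * (∑ i, C (eX i)) / (2 * √(t / 2)) + C eT) := by
          gcongr
          refine (norm_add_le _ _).trans (add_le_add ?_ (hC _ _))
          rw [norm_div, Real.norm_of_nonneg (show 0 ≤ 2 * √s by positivity), Real.norm_eq_abs]
          gcongr
      _ = _ := by ring
  · exact (hKn.mul_const _).add (hK.mul_const _)
  · refine Eventually.of_forall fun y s hs => ?_
    have hs0 : 0 < s := lt_trans (by positivity) hs
    exact (hasDerivAt_test_scaling hψ.smooth y hs0).const_mul _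

end FundamentalSolution

section FundamentalSolution

variable {N : ℕ}

theorem measurable_dampedHeatK (l : ℝ) : Measurable (dampedHeatK N l) :=
  Measurable.mul (by fun_prop) measurable_heatK

theorem integral_dampedHeatK_mul_eq {l : ℝ} (hl : 0 < l) {g : PSpace N → ℝ} (hg : Continuous g)
    {C : ℝ} (hC : ∀ z, |g z| ≤ C) :
    IntegrableOn (fun t => Real.exp (-l * t) * ∫ y, heatK N (y, 1) * g (√t • y, t)) (Ioi 0) ∧
      ∫ z, dampedHeatK N l z * g z =
        ∫ t in Ioi (0 : ℝ), Real.exp (-l * t) * ∫ y, heatK N (y, 1) * g (√t • y, t) := by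
  have hi : Integrable (fun z => dampedHeatK N l z * g z) ((volume : Measure
      (EuclideanSpace ℝ (Fin N))).prod (volume : Measure ℝ)) :=
    integrable_mul_bounded (integrable_dampedHeatK hl) hg.aestronglyMeasurable hC
  have h1 : (fun t => ∫ x, dampedHeatK N l (x, t) * g (x, t)) = indicator (Ioi 0)
      (fun t => Real.exp (-l * t) * ∫ y, heatK N (y, 1) * g (√t • y, t)) := by
    funext t
    simp only [dampedHeatK, mul_assoc, integral_const_mul]
    rcases lt_or_ge 0 t with ht | ht
    · rw [indicator_of_mem (mem_Ioi.2 ht), integral_heatK_mul_eq ht (fun x => g (x, t))]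
    · rw [indicator_of_notMem (by simpa using ht)]
      simp [heatK_of_nonpos ht]
  have h2 := hi.integral_prod_right
  simp only [h1] at h2
  refine ⟨(integrable_indicator_iff measurableSet_Ioi).1 h2, ?_⟩
  have h3 : ∫ z, dampedHeatK N l z * g z = ∫ t, ∫ x, dampedHeatK N l (x, t) * g (x, t) :=
    integral_prod_symm _ hi
  rw [h3, h1, integral_indicator measurableSet_Ioi]

theorem integral_dampedHeatK_mul_heatAdj {l : ℝ} (hl : 0 < l) {ψ : PSpace N → ℝ}
    (hψ : IsTest univ ψ) : ∫ z, dampedHeatK N l z * (heatAdj ψ z + l * ψ z) = ψ 0 := by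
  obtain ⟨C, hC⟩ := hψ.bounded
  obtain ⟨C', hC'⟩ := hψ.heatAdj.bounded
  have hK := integrable_heatK (N := N) one_pos
  have hm : Measurable (fun x => heatK N (x, 1)) :=
    measurable_heatK.comp (measurable_id.prodMk measurable_const)
  have hcont : Continuous (fun z => heatAdj ψ z + l * ψ z) :=
    hψ.heatAdj.smooth.continuous.add (continuous_const.mul hψ.smooth.continuous)
  obtain ⟨hInt, heq⟩ := integral_dampedHeatK_mul_eq hl hcont (C := C' + l * C) (fun z => by
    refine (abs_add_le _ _).trans (add_le_add (hC' z) ?_)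
    rw [abs_mul, abs_of_pos hl]; exact mul_le_mul_of_nonneg_left (hC z) hl.le)
  rw [heq]
  set b : ℝ → ℝ := fun t => ∫ y, heatK N (y, 1) * ψ (√t • y, t) with hb
  have hslice : ∀ (φ : PSpace N → ℝ) (t : ℝ), IsTest univ φ →
      Integrable (fun y => heatK N (y, 1) * φ (√t • y, t)) := by
    intro φ t hφ
    obtain ⟨C₁, hC₁⟩ := hφ.bounded
    exact integrable_mul_bounded hK
      (contDiff_slice hφ.smooth _ _).continuous.aestronglyMeasurable fun y => hC₁ _
  have hbc : Continuous b := by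
    refine continuous_of_dominated (bound := fun y => heatK N (y, 1) * C)
      (fun t => (hslice ψ t hψ).aestronglyMeasurable) (fun t => Eventually.of_forall fun y => ?_)
      (hK.mul_const C) (Eventually.of_forall fun y => ?_)
    · rw [norm_mul, Real.norm_of_nonneg (heatK_nonneg _)]
      exact mul_le_mul_of_nonneg_left (hC _) (heatK_nonneg _)
    · refine continuous_const.mul (hψ.smooth.continuous.comp ?_)
      exact (Real.continuous_sqrt.smul continuous_const).prodMk continuous_id
  have hb0 : b 0 = ψ 0 := by
    simp only [hb, Real.sqrt_zero, zero_smul, integral_mul_const, integral_heatK one_pos, one_mul]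
    rfl
  have hderiv : ∀ t ∈ Ioi (0 : ℝ), HasDerivAt (fun t => Real.exp (-l * t) * b t)
      (-(Real.exp (-l * t) * ∫ y, heatK N (y, 1) * (heatAdj ψ (√t • y, t) + l * ψ (√t • y, t))))
      t := by
    intro t ht
    have h1 : HasDerivAt (fun t => Real.exp (-l * t)) (Real.exp (-l * t) * (-l)) t := by
      simpa using ((hasDerivAt_id t).const_mul (-l)).exp
    refine (h1.mul (hasDerivAt_gaussian_mean hψ ht)).congr_deriv ?_
    have h2 : ∀ y, heatK N (y, 1) * (heatAdj ψ (√t • y, t) + l * ψ (√t • y, t)) =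
        heatK N (y, 1) * heatAdj ψ (√t • y, t) + l * (heatK N (y, 1) * ψ (√t • y, t)) :=
      fun y => by ring
    simp only [h2]
    rw [integral_add (hslice _ t hψ.heatAdj) ((hslice _ t hψ).const_mul l), integral_const_mul]
    ring
  have hlim : Tendsto (fun t => Real.exp (-l * t) * b t) atTop (𝓝 0) := by
    refine tendsto_const_nhds.congr' ?_
    obtain ⟨T, hT⟩ := hψ.compact.isCompact.isBounded.subset_closedBall 0
    filter_upwards [eventually_gt_atTop T, eventually_gt_atTop 0] with t ht ht0
    have h1 : ∀ y, ψ (√t • y, t) = 0 := fun y => by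
      refine image_eq_zero_of_notMem_tsupport fun h => ?_
      have h2 := hT h
      rw [mem_closedBall, dist_zero_right] at h2
      have h3 := (norm_snd_le (√t • y, t)).trans h2
      simp only [Real.norm_eq_abs, abs_of_pos ht0] at h3
      linarith
    simp [hb, h1]
  have key := integral_Ioi_of_hasDerivAt_of_tendsto (a := 0) (m := 0)
    (f := fun t => Real.exp (-l * t) * b t)
    ((by fun_prop : Continuous fun t => Real.exp (-l * t) * b t).continuousWithinAt) hderiv
    hInt.neg hlim
  rw [integral_neg] at key
  simp only [hb0, mul_zero, Real.exp_zero, one_mul, zero_sub, neg_inj] at key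
  exact key

/-- The `i`-th spatial derivative of `dampedHeatK`. -/
noncomputable def dampedHeatKx (N : ℕ) (l : ℝ) (i : Fin N) (z : PSpace N) : ℝ :=
  -(z.1 i / (2 * z.2) * dampedHeatK N l z)

theorem integrable_dampedHeatKx {l : ℝ} (hl : 0 < l) (i : Fin N) :
    Integrable (dampedHeatKx N l i) := by
  have hg : IntegrableOn (fun t : ℝ => t ^ (-(1 / 2) : ℝ) * Real.exp (-l * t)) (Ioi 0) := by
    have := integrableOn_rpow_mul_exp_neg_mul_rpow (p := 1) (s := -(1 / 2)) (b := l) (by norm_num)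
      one_pos hl
    simpa using this
  have hi := (integrable_mul_heatK (N := N) two_pos (by fun_prop) hg).const_mul (2 * 2 ^ ((N : ℝ) / 2))
  refine hi.mono' ?_ (Eventually.of_forall fun z => ?_)
  · refine (Measurable.neg (Measurable.mul ?_ (measurable_dampedHeatK l))).aestronglyMeasurable
    exact Measurable.div (by fun_prop) (by fun_prop)
  · obtain ⟨x, t⟩ := z
    have h0 := heatK_nonneg (x, t)
    rcases lt_or_ge 0 t with ht | ht
    · rw [dampedHeatKx, norm_neg, norm_mul, Real.norm_of_nonneg (dampedHeatK_nonneg _ _),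
        norm_div, Real.norm_of_nonneg (show 0 ≤ 2 * t by positivity)]
      have h1 : ‖x i‖ ≤ ‖x‖ := PiLp.norm_apply_le x i
      have h2 := norm_mul_heatK_le ht x
      have h3 := Real.exp_pos (-l * t)
      simp only [dampedHeatK]
      calc ‖x i‖ / (2 * t) * (Real.exp (-l * t) * heatK N (x, t))
          ≤ ‖x‖ / t * (Real.exp (-l * t) * heatK N (x, t)) := by
            gcongr; linarith
        _ = Real.exp (-l * t) * (‖x‖ / t * heatK N (x, t)) := by ring
        _ ≤ Real.exp (-l * t) *
          (2 * 2 ^ ((N : ℝ) / 2) * t ^ (-(1 / 2) : ℝ) * heatK N (x, 2 * t)) := by gcongr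
        _ = _ := by ring
    · have ht' : 2 * t ≤ 0 := by linarith
      simp [dampedHeatKx, dampedHeatK, heatK_of_nonpos ht, heatK_of_nonpos ht']

theorem weakDeriv_dampedHeatK {l : ℝ} (hl : 0 < l) (i : Fin N) :
    WeakDeriv univ (eX i) (dampedHeatK N l) (dampedHeatKx N l i) := by
  intro ψ hψ
  obtain ⟨C, hC⟩ := hψ.bounded
  obtain ⟨C', hC'⟩ := (hψ.dirDeriv (eX i)).bounded
  have hi : Integrable (fun z => dampedHeatK N l z * dirDeriv (eX i) ψ z) ((volume : Measure
      (EuclideanSpace ℝ (Fin N))).prod (volume : Measure ℝ)) :=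
    integrable_mul_bounded (integrable_dampedHeatK hl)
      (hψ.dirDeriv (eX i)).smooth.continuous.aestronglyMeasurable hC'
  have hi' : Integrable (fun z => dampedHeatKx N l i z * ψ z) ((volume : Measure
      (EuclideanSpace ℝ (Fin N))).prod (volume : Measure ℝ)) :=
    integrable_mul_bounded (integrable_dampedHeatKx hl i)
      hψ.smooth.continuous.aestronglyMeasurable hC
  have h1 : ∫ z, dampedHeatK N l z * dirDeriv (eX i) ψ z = _ := integral_prod_symm _ hi
  have h2 : ∫ z, dampedHeatKx N l i z * ψ z = _ := integral_prod_symm _ hi'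
  rw [h1, h2, ← integral_neg]
  congr 1; ext t
  rcases lt_or_ge 0 t with ht | ht
  · have h3 := integral_heatK_mul_dirDeriv ht (EuclideanSpace.single i 1)
      (contDiff_slice hψ.smooth 1 t) (C := max C C')
      (fun y => (hC _).trans (le_max_left _ _)) (fun y => by
        rw [dirDeriv_slice hψ.smooth, one_mul]
        exact (hC' _).trans (le_max_right _ _))
    simp only [dirDeriv_slice hψ.smooth] at h3
    simp only [one_smul, one_mul] at h3
    simp only [dampedHeatK, mul_assoc, integral_const_mul, dampedHeatKx]
    rw [h3, ← integral_const_mul, ← integral_neg]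
    congr 1; ext x
    rw [EuclideanSpace.inner_single_right]
    simp; ring
  · simp [dampedHeatKx, dampedHeatK, heatK_of_nonpos ht]

end FundamentalSolution

section FlatFunction

/-- The function `s ↦ s ^ (-p) * exp (-1 / s)` on `(0, ∞)`, extended by zero. -/
noncomputable def flatExp (p s : ℝ) : ℝ := if 0 < s then s ^ (-p) * Real.exp (-s⁻¹) else 0

theorem tendsto_flatExp_zero (p : ℝ) : Tendsto (flatExp p) (𝓝 0) (𝓝 0) := by
  suffices h : Tendsto (flatExp p) (𝓝[≤] 0 ⊔ 𝓝[>] 0) (𝓝 0) by rwa [nhdsLE_sup_nhdsGT] at h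
  refine tendsto_sup.2 ⟨?_, ?_⟩
  · refine tendsto_const_nhds.congr' ?_
    filter_upwards [self_mem_nhdsWithin] with s hs
    exact (if_neg (not_lt.2 hs)).symm
  · have h := (tendsto_rpow_mul_exp_neg_mul_atTop_nhds_zero p 1 one_pos).comp
      tendsto_inv_nhdsGT_zero
    refine h.congr' ?_
    filter_upwards [self_mem_nhdsWithin] with s hs
    have hs' : 0 < s := hs
    simp [flatExp, hs', Real.inv_rpow hs'.le, Real.rpow_neg hs'.le]

theorem hasDerivAt_flatExp (p s : ℝ) :
    HasDerivAt (flatExp p) (-p * flatExp (p + 1) s + flatExp (p + 2) s) s := by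
  rcases lt_trichotomy s 0 with hs | rfl | hs
  · have h1 : ∀ q, flatExp q s = 0 := fun q => if_neg hs.not_gt
    simp only [h1, mul_zero, add_zero]
    refine (hasDerivAt_const s (0 : ℝ)).congr_of_eventuallyEq ?_
    filter_upwards [gt_mem_nhds hs] with t ht
    exact if_neg (not_lt.2 ht.le)
  · have h1 : ∀ q, flatExp q 0 = 0 := fun q => if_neg (lt_irrefl _)
    simp only [h1, mul_zero, add_zero]
    rw [hasDerivAt_iff_tendsto_slope]
    refine ((tendsto_flatExp_zero (p + 1)).mono_left nhdsWithin_le_nhds).congr' ?_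
    filter_upwards [self_mem_nhdsWithin] with t ht
    simp only [slope, h1, vsub_eq_sub, sub_zero, smul_eq_mul]
    by_cases h0 : 0 < t
    · simp only [flatExp, if_pos h0]
      rw [neg_add, Real.rpow_add h0, Real.rpow_neg_one]
      ring
    · simp [flatExp, h0]
  · simp only [flatExp, if_pos hs]
    have h1 : HasDerivAt (fun s : ℝ => s ^ (-p) * Real.exp (-s⁻¹)) _ s :=
      (Real.hasDerivAt_rpow_const (p := -p) (Or.inl hs.ne')).mul
        ((hasDerivAt_inv hs.ne').neg.exp)
    refine (h1.congr_of_eventuallyEq ?_).congr_deriv ?_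
    · filter_upwards [lt_mem_nhds hs] with t ht
      exact if_pos ht
    · rw [show -p - 1 = -(p + 1) by ring, show -(p + 2) = -p + -(2 : ℕ) by push_cast; ring,
        Real.rpow_add hs, Real.rpow_neg hs.le ((2 : ℕ) : ℝ), Real.rpow_natCast]
      simp only [Pi.neg_apply]
      ring

theorem contDiff_flatExp (p : ℝ) : ContDiff ℝ ∞ (flatExp p) := by
  refine contDiff_infty.2 fun n => ?_
  induction n generalizing p with
  | zero =>
    exact contDiff_zero.2 (continuous_iff_continuousAt.2 fun s =>
      (hasDerivAt_flatExp p s).continuousAt)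
  | succ n ih =>
    rw [show ((n + 1 : ℕ) : WithTop ℕ∞) = (n : WithTop ℕ∞) + 1 by push_cast; rfl,
      contDiff_succ_iff_deriv]
    refine ⟨fun s => (hasDerivAt_flatExp p s).differentiableAt, by simp, ?_⟩
    have : deriv (flatExp p) = fun s => -p * flatExp (p + 1) s + flatExp (p + 2) s :=
      funext fun s => (hasDerivAt_flatExp p s).deriv
    rw [this]
    exact (contDiff_const.mul (ih _)).add (ih _)

end FlatFunction

section Parametrix

variable {N : ℕ}

theorem contDiffAt_heatK {z : PSpace N} (hz : z ≠ 0) : ContDiffAt ℝ ∞ (heatK N) z := by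
  by_cases hx : z.1 = 0
  · have ht : z.2 ≠ 0 := fun h => hz (Prod.ext hx h)
    rcases ht.lt_or_gt with ht | ht
    · refine (contDiffAt_const (c := (0 : ℝ))).congr_of_eventuallyEq ?_
      filter_upwards [(isOpen_Iio.preimage continuous_snd).mem_nhds ht] with w hw
      exact heatK_of_nonpos (le_of_lt hw) w.1
    · have h1 : ContDiffAt ℝ ∞ (fun w : PSpace N => (4 * Real.pi * w.2) ^ (-(N : ℝ) / 2) *
          Real.exp (-‖w.1‖ ^ 2 / (4 * w.2))) z := by
        refine ContDiffAt.mul ?_ ?_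
        · exact (contDiffAt_const.mul contDiffAt_snd).rpow_const_of_ne (by positivity)
        · exact ((contDiffAt_fst.norm_sq ℝ).neg.div (contDiffAt_const.mul contDiffAt_snd)
            (by positivity)).exp
      refine h1.congr_of_eventuallyEq ?_
      filter_upwards [(isOpen_Ioi.preimage continuous_snd).mem_nhds ht] with w hw
      exact heatK_of_pos hw w.1
  · have hx0 : 0 < ‖z.1‖ ^ 2 := by positivity
    have h1 : ContDiffAt ℝ ∞ (fun w : PSpace N => (Real.pi * ‖w.1‖ ^ 2) ^ (-(N : ℝ) / 2) *
        flatExp (N / 2) (4 * w.2 / ‖w.1‖ ^ 2)) z := by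
      refine ContDiffAt.mul ?_ ?_
      · exact (contDiffAt_const.mul (contDiffAt_fst.norm_sq ℝ)).rpow_const_of_ne (by positivity)
      · exact (contDiff_flatExp _).contDiffAt.comp z
          ((contDiffAt_const.mul contDiffAt_snd).div (contDiffAt_fst.norm_sq ℝ) hx0.ne')
    refine h1.congr_of_eventuallyEq ?_
    filter_upwards [(isOpen_ne.preimage continuous_fst).mem_nhds hx] with w hw
    have hw1 : 0 < ‖w.1‖ := norm_pos_iff.2 hw
    have hw0 : 0 < ‖w.1‖ ^ 2 := by positivity
    rcases lt_or_ge 0 w.2 with ht | ht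
    · have hs : 0 < 4 * w.2 / ‖w.1‖ ^ 2 := by positivity
      rw [show w = (w.1, w.2) from rfl, heatK_of_pos ht]
      simp only [flatExp, if_pos hs]
      rw [← mul_assoc, ← neg_div, ← Real.mul_rpow (by positivity) hs.le]
      congr 2
      · field_simp
      · field_simp
    · have hs : ¬ 0 < 4 * w.2 / ‖w.1‖ ^ 2 :=
        not_lt.2 (div_nonpos_of_nonpos_of_nonneg (by linarith) hw0.le)
      rw [show w = (w.1, w.2) from rfl, heatK_of_nonpos ht]
      simp [flatExp, hs]

theorem contDiffAt_dampedHeatK (l : ℝ) {z : PSpace N} (hz : z ≠ 0) :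
    ContDiffAt ℝ ∞ (dampedHeatK N l) z :=
  (contDiffAt_const.mul contDiffAt_snd).exp.mul (contDiffAt_heatK hz)

theorem dirDeriv_mul {f g : PSpace N → ℝ} (hf : ContDiff ℝ ∞ f) (hg : ContDiff ℝ ∞ g)
    (v : PSpace N) : dirDeriv v (fun z => f z * g z) =
      fun z => f z * dirDeriv v g z + dirDeriv v f z * g z := by
  funext z
  have h : HasFDerivAt (fun z => f z * g z) _ z :=
    (hf.differentiable (by simp) z).hasFDerivAt.mul (hg.differentiable (by simp) z).hasFDerivAt
  simp only [dirDeriv, h.fderiv]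
  simp [mul_comm]

theorem weakDeriv_of_contDiff {f : PSpace N → ℝ} (hf : ContDiff ℝ ∞ f) (v : PSpace N) :
    WeakDeriv univ v f (dirDeriv v f) :=
  weakDeriv_of_hasLineDerivAt isOpen_univ hf.continuous.continuousOn
    (contDiff_dirDeriv hf v).continuous.continuousOn fun z _ =>
      ((hf.differentiable (by simp) z).hasFDerivAt.hasLineDerivAt v)

theorem integral_mul_heatAdj {f ψ : PSpace N → ℝ} (hf : ContDiff ℝ ∞ f) (hψ : IsTest univ ψ) :
    ∫ z, f z * heatAdj ψ z =
      ∫ z, (dirDeriv eT f z - ∑ i, dirDeriv (eX i) (dirDeriv (eX i) f) z) * ψ z := by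
  have hInt : ∀ (g φ : PSpace N → ℝ), ContDiff ℝ ∞ g → IsTest univ φ →
      Integrable (fun z => g z * φ z) := fun g φ hg hφ => (hφ.smul_left hg).integrable
  have h1 : ∀ i, ∫ z, f z * dirDeriv (eX i) (dirDeriv (eX i) ψ) z =
      ∫ z, dirDeriv (eX i) (dirDeriv (eX i) f) z * ψ z := fun i => by
    rw [weakDeriv_of_contDiff hf _ _ (hψ.dirDeriv _),
      weakDeriv_of_contDiff (contDiff_dirDeriv hf _) _ _ hψ, neg_neg]
  have h2 : ∀ z, f z * heatAdj ψ z = -(f z * dirDeriv eT ψ z) -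
      ∑ i, f z * dirDeriv (eX i) (dirDeriv (eX i) ψ) z := fun z => by
    rw [heatAdj, ← Finset.mul_sum]; ring
  have h3 : ∀ z, (dirDeriv eT f z - ∑ i, dirDeriv (eX i) (dirDeriv (eX i) f) z) * ψ z =
      dirDeriv eT f z * ψ z - ∑ i, dirDeriv (eX i) (dirDeriv (eX i) f) z * ψ z := fun z => by
    rw [sub_mul, Finset.sum_mul]
  have h4 : ∀ i, Integrable fun z => f z * dirDeriv (eX i) (dirDeriv (eX i) ψ) z := fun i =>
    hInt _ _ hf ((hψ.dirDeriv _).dirDeriv _)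
  have h5 : ∀ i, Integrable fun z => dirDeriv (eX i) (dirDeriv (eX i) f) z * ψ z := fun i =>
    hInt _ _ (contDiff_dirDeriv (contDiff_dirDeriv hf _) _) hψ
  simp only [h2, h3]
  have h6 : Integrable fun z => -(f z * dirDeriv eT ψ z) := (hInt _ _ hf (hψ.dirDeriv _)).neg
  rw [integral_sub h6 (integrable_finsetSum _ fun i _ => h4 i),
    integral_sub (hInt _ _ (contDiff_dirDeriv hf _) hψ) (integrable_finsetSum _ fun i _ => h5 i),
    integral_neg, weakDeriv_of_contDiff hf _ _ hψ, neg_neg,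
    integral_finsetSum _ fun i _ => h4 i, integral_finsetSum _ fun i _ => h5 i]
  simp only [h1]

/-- A compactly supported parametrix `K` of `∂_t - Δ + 1` with error `θ` and weak spatial
derivatives `K'`. -/
structure IsParametrix (r : ℝ) (K : PSpace N → ℝ) (K' : Fin N → PSpace N → ℝ)
    (θ : PSpace N → ℝ) : Prop where
  int : Integrable K
  supp : ∀ y, K y ≠ 0 → ‖y‖ ≤ r
  int' : ∀ i, Integrable (K' i)
  weak : ∀ i, WeakDeriv univ (eX i) K (K' i)
  test : IsTest univ θ
  tsupp : tsupport θ ⊆ closedBall 0 r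
  eq : ∀ ψ, IsTest univ ψ → ∫ z, K z * (heatAdj ψ z + ψ z) = ψ 0 + ∫ z, θ z * ψ z

theorem exists_isParametrix (N : ℕ) {r : ℝ} (hr : 0 < r) :
    ∃ (K : PSpace N → ℝ) (K' : Fin N → PSpace N → ℝ) (θ : PSpace N → ℝ),
      IsParametrix r K K' θ := by
  obtain ⟨χ, hχ, -, U, hU, h0U, hχU⟩ := exists_isTest_one (K := {(0 : PSpace N)})
    (O := ball 0 r) isCompact_singleton isOpen_ball (by simpa using hr)
  obtain ⟨C, hC⟩ := hχ.bounded
  set H := dampedHeatK N 1 with hH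
  have hHi : Integrable H := integrable_dampedHeatK one_pos
  have hχH : Integrable (fun z => χ z * H z) := by
    simpa only [mul_comm] using
      integrable_mul_bounded hHi hχ.smooth.continuous.aestronglyMeasurable hC
  set κ : PSpace N → ℝ := fun z => (1 - χ z) * H z with hκ
  have hκs : ContDiff ℝ ∞ κ := by
    refine contDiff_iff_contDiffAt.2 fun z => ?_
    by_cases hz : z = 0
    · refine (contDiffAt_const (c := (0 : ℝ))).congr_of_eventuallyEq ?_
      filter_upwards [hU.mem_nhds (h0U hz)] with w hw
      simp [hκ, hχU w hw]
    · exact (contDiffAt_const.sub hχ.smooth.contDiffAt).mul (contDiffAt_dampedHeatK 1 hz)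
  set θ : PSpace N → ℝ := fun z =>
    -((dirDeriv eT κ z - ∑ i, dirDeriv (eX i) (dirDeriv (eX i) κ) z) + κ z) with hθ
  have hθs : ContDiff ℝ ∞ θ := ContDiff.neg (((contDiff_dirDeriv hκs _).sub
    (ContDiff.sum fun _ _ => contDiff_dirDeriv (contDiff_dirDeriv hκs _) _)).add hκs)
  have hsupp : ∀ y, χ y * H y ≠ 0 → ‖y‖ ≤ r := fun y hy => by
    have h1 : y ∈ tsupport χ := subset_tsupport _ (left_ne_zero_of_mul hy)
    simpa using (ball_subset_closedBall (hχ.sub h1))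
  have heq : ∀ ψ, IsTest univ ψ →
      ∫ z, χ z * H z * (heatAdj ψ z + ψ z) = ψ 0 + ∫ z, θ z * ψ z := by
    intro ψ hψ
    have h1 := integral_dampedHeatK_mul_heatAdj (N := N) one_pos hψ
    simp only [one_mul] at h1
    have h2 : ∀ z, θ z * ψ z =
        -((dirDeriv eT κ z - ∑ i, dirDeriv (eX i) (dirDeriv (eX i) κ) z) * ψ z) - κ z * ψ z :=
      fun z => by rw [hθ]; ring
    have h3 : Integrable fun z => κ z * ψ z := (hψ.smul_left hκs).integrable
    have h4 : Integrable fun z => κ z * heatAdj ψ z := (hψ.heatAdj.smul_left hκs).integrable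
    have h5 : Integrable fun z =>
        (dirDeriv eT κ z - ∑ i, dirDeriv (eX i) (dirDeriv (eX i) κ) z) * ψ z :=
      (hψ.smul_left ((contDiff_dirDeriv hκs _).sub
        (ContDiff.sum fun _ _ => contDiff_dirDeriv (contDiff_dirDeriv hκs _) _))).integrable
    simp only [h2]
    have h5' : Integrable fun z =>
        -((dirDeriv eT κ z - ∑ i, dirDeriv (eX i) (dirDeriv (eX i) κ) z) * ψ z) := h5.neg
    rw [integral_sub h5' h3, integral_neg, ← integral_mul_heatAdj hκs hψ, ← h1]
    obtain ⟨C₁, hC₁⟩ := hψ.heatAdj.bounded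
    obtain ⟨C₂, hC₂⟩ := hψ.bounded
    have h6 : Integrable fun z => H z * (heatAdj ψ z + ψ z) :=
      integrable_mul_bounded hHi (hψ.heatAdj.smooth.add hψ.smooth).continuous.aestronglyMeasurable
        (C := C₁ + C₂) fun z => (abs_add_le _ _).trans (add_le_add (hC₁ z) (hC₂ z))
    have h4' : Integrable fun z => -(κ z * heatAdj ψ z) := h4.neg
    have h43 : Integrable fun z => -(κ z * heatAdj ψ z) - κ z * ψ z := h4'.sub h3
    rw [← integral_neg, ← integral_sub h4' h3, ← integral_add h6 h43]
    congr 1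
    ext z
    simp only [hκ]
    ring
  have hθ0 : ∀ z ∈ (closedBall (0 : PSpace N) r)ᶜ, θ z = 0 := by
    refine eqOn_zero_of_integral_eq_zero isClosed_closedBall.isOpen_compl
      hθs.continuous.continuousOn fun ψ hψ => ?_
    have h1 := heq ψ (hψ.mono (subset_univ _))
    have h2 : ψ 0 = 0 := image_eq_zero_of_notMem_tsupport fun h =>
      hψ.sub h (mem_closedBall_self hr.le)
    have h3 : ∀ z, χ z * H z * (heatAdj ψ z + ψ z) = 0 := fun z => by
      by_cases hz : χ z * H z = 0
      · rw [hz, zero_mul]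
      · have hz' : z ∉ tsupport ψ := fun h => hψ.sub h (by simpa using hsupp z hz)
        rw [image_eq_zero_of_notMem_tsupport hz', image_eq_zero_of_notMem_tsupport
          fun h => hz' (tsupport_heatAdj_subset ψ h)]
        simp
    simp only [h3, integral_zero, h2, zero_add] at h1
    exact h1.symm
  have hθt : tsupport θ ⊆ closedBall 0 r := by
    refine closure_minimal (fun z hz => ?_) isClosed_closedBall
    by_contra hz'
    exact hz (hθ0 z hz')
  have hχ'H : ∀ i, Integrable (fun z => dirDeriv (eX i) χ z * H z) := fun i => by
    obtain ⟨C', hC'⟩ := (hχ.dirDeriv (eX i)).bounded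
    simpa only [mul_comm] using integrable_mul_bounded hHi
      (hχ.dirDeriv (eX i)).smooth.continuous.aestronglyMeasurable hC'
  have hχHx : ∀ i, Integrable (fun z => χ z * dampedHeatKx N 1 i z) := fun i => by
    simpa only [mul_comm] using integrable_mul_bounded (integrable_dampedHeatKx one_pos i)
      hχ.smooth.continuous.aestronglyMeasurable hC
  refine ⟨fun z => χ z * H z, fun i z => dirDeriv (eX i) χ z * H z + χ z * dampedHeatKx N 1 i z,
    θ, hχH, hsupp, fun i => (hχ'H i).add (hχHx i), fun i ψ hψ => ?_,
    ⟨hθs, (isCompact_closedBall 0 r).of_isClosed_subset (isClosed_tsupport _) hθt,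
      subset_univ _⟩, hθt, heq⟩
  have h1 := weakDeriv_dampedHeatK (N := N) one_pos i _ (hψ.smul_left hχ.smooth)
  obtain ⟨C', hC'⟩ := hψ.bounded
  obtain ⟨C'', hC''⟩ := (hψ.dirDeriv (eX i)).bounded
  have i1 : Integrable fun z => χ z * H z * dirDeriv (eX i) ψ z :=
    integrable_mul_bounded hχH (hψ.dirDeriv (eX i)).smooth.continuous.aestronglyMeasurable hC''
  have i2 : Integrable fun z => dirDeriv (eX i) χ z * H z * ψ z :=
    integrable_mul_bounded (hχ'H i) hψ.smooth.continuous.aestronglyMeasurable hC'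
  have i3 : Integrable fun z => χ z * dampedHeatKx N 1 i z * ψ z :=
    integrable_mul_bounded (hχHx i) hψ.smooth.continuous.aestronglyMeasurable hC'
  rw [dirDeriv_mul hχ.smooth hψ.smooth] at h1
  have e1 : ∀ z, dampedHeatK N 1 z * (χ z * dirDeriv (eX i) ψ z + dirDeriv (eX i) χ z * ψ z) =
      χ z * H z * dirDeriv (eX i) ψ z + dirDeriv (eX i) χ z * H z * ψ z := fun z => by
    rw [hH]; ring
  have e2 : ∀ z, dampedHeatKx N 1 i z * (χ z * ψ z) = χ z * dampedHeatKx N 1 i z * ψ z :=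
    fun z => by ring
  simp only [e1, e2] at h1
  rw [integral_add i1 i2] at h1
  simp only [add_mul]
  rw [integral_add i2 i3]
  linarith

end Parametrix

section WeakHeat

variable {N : ℕ} {O : Set (PSpace N)} {V f : PSpace N → ℝ}

/-- `V` is a distributional solution of `∂_t V - ΔV = f` in `O`. -/
def WeakHeat (O : Set (PSpace N)) (V f : PSpace N → ℝ) : Prop :=
  ∀ φ, IsTest O φ → ∫ z, V z * heatAdj φ z = ∫ z, f z * φ z

theorem heatAdj_corr {K ρ : PSpace N → ℝ} (hK : Integrable K) (hρ : IsTest univ ρ) :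
    heatAdj (corr K ρ) = corr K (heatAdj ρ) := by
  funext z
  have hInt : ∀ φ : PSpace N → ℝ, IsTest univ φ → Integrable fun y => K y * φ (z + y) :=
    fun φ hφ => by
      obtain ⟨C, hC⟩ := hφ.bounded
      exact integrable_mul_bounded hK (hφ.comp_add z).smooth.continuous.aestronglyMeasurable
        fun y => hC (z + y)
  have e : ∀ y, K y * heatAdj ρ (z + y) = -(K y * dirDeriv eT ρ (z + y)) -
      ∑ i, K y * dirDeriv (eX i) (dirDeriv (eX i) ρ) (z + y) := fun y => by
    rw [heatAdj, ← Finset.mul_sum]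
    ring
  rw [heatAdj]
  simp only [dirDeriv_corr hK hρ, dirDeriv_corr hK (hρ.dirDeriv _)]
  simp only [corr, e]
  have h1 : Integrable fun y => -(K y * dirDeriv eT ρ (z + y)) := (hInt _ (hρ.dirDeriv _)).neg
  have h2 : ∀ i, Integrable fun y => K y * dirDeriv (eX i) (dirDeriv (eX i) ρ) (z + y) :=
    fun i => hInt _ ((hρ.dirDeriv _).dirDeriv _)
  rw [integral_sub h1 (integrable_finsetSum _ fun i _ => h2 i), integral_neg,
    integral_finsetSum _ fun i _ => h2 i]

theorem heatAdj_comp_add (ρ : PSpace N → ℝ) (w : PSpace N) :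
    heatAdj (fun y => ρ (w + y)) = fun y => heatAdj ρ (w + y) := by
  funext y
  simp only [heatAdj, dirDeriv_comp_add]

theorem IsParametrix.heatAdj_corr_add {r : ℝ} {K θ : PSpace N → ℝ} {K' : Fin N → PSpace N → ℝ}
    (hP : IsParametrix r K K' θ) {ρ : PSpace N → ℝ} (hρ : IsTest univ ρ) (w : PSpace N) :
    heatAdj (corr K ρ) w + corr K ρ w = ρ w + corr θ ρ w := by
  have h := hP.eq _ (hρ.comp_add w)
  rw [heatAdj_comp_add, add_zero] at h
  rw [heatAdj_corr hP.int hρ]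
  have hInt : ∀ φ : PSpace N → ℝ, IsTest univ φ → Integrable fun y => K y * φ (w + y) :=
    fun φ hφ => by
      obtain ⟨C, hC⟩ := hφ.bounded
      exact integrable_mul_bounded hP.int (hφ.comp_add w).smooth.continuous.aestronglyMeasurable
        fun y => hC (w + y)
  simp only [corr]
  rw [← integral_add (hInt _ hρ.heatAdj) (hInt _ hρ), ← h]
  simp only [mul_add]

theorem measurable_indicator_of_continuousOn {B : Set (PSpace N)} (hB : IsCompact B)
    {g : PSpace N → ℝ} (hg : ContinuousOn g B) : Measurable (B.indicator g) := by
  classical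
  rw [← piecewise_eq_indicator]
  exact hg.measurable_piecewise continuousOn_const hB.measurableSet

theorem exists_abs_indicator_le {B : Set (PSpace N)} (hB : IsCompact B)
    {g : PSpace N → ℝ} (hg : ContinuousOn g B) : ∃ C, ∀ y, |B.indicator g y| ≤ C := by
  obtain ⟨C, hC⟩ := hB.exists_bound_of_continuousOn hg
  refine ⟨max C 0, fun y => ?_⟩
  by_cases hy : y ∈ B
  · rw [indicator_of_mem hy]
    exact (hC y hy).trans (le_max_left _ _)
  · rw [indicator_of_notMem hy, abs_zero]
    exact le_max_right _ _

theorem WeakHeat.eq_conv (h : WeakHeat O V f) (hO : IsOpen O) (hV : ContinuousOn V O)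
    (hf : ContinuousOn f O) {r : ℝ} {K θ : PSpace N → ℝ} {K' : Fin N → PSpace N → ℝ}
    (hP : IsParametrix r K K' θ) {z₀ : PSpace N} (hr : 0 < r)
    (hsub : closedBall z₀ (3 * r) ⊆ O) {z : PSpace N} (hz : z ∈ ball z₀ (2 * r)) :
    V z = conv K ((closedBall z₀ (3 * r)).indicator fun w => f w + V w) z -
      conv θ ((closedBall z₀ (3 * r)).indicator V) z := by
  set B := closedBall z₀ (3 * r) with hB
  have hBc : IsCompact B := isCompact_closedBall _ _
  have hVB := hV.mono hsub
  have hfV : ContinuousOn (fun w => f w + V w) B := (hf.mono hsub).add hVB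
  obtain ⟨C₁, hC₁⟩ := exists_abs_indicator_le hBc hfV
  obtain ⟨C₂, hC₂⟩ := exists_abs_indicator_le hBc hVB
  have m1 := measurable_indicator_of_continuousOn hBc hfV
  have m2 := measurable_indicator_of_continuousOn hBc hVB
  have hθ := hP.test.integrable
  have c1 := continuous_conv hP.int m1 hC₁
  have c2 := continuous_conv hθ m2 hC₂
  have hbO : ball z₀ (2 * r) ⊆ O := (ball_subset_closedBall.trans
    (closedBall_subset_closedBall (by linarith))).trans hsub
  suffices H : ∀ z ∈ ball z₀ (2 * r), V z - conv K (B.indicator fun w => f w + V w) z +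
      conv θ (B.indicator V) z = 0 by linarith [H z hz]
  refine eqOn_zero_of_integral_eq_zero isOpen_ball
    (((hV.mono hbO).sub c1.continuousOn).add c2.continuousOn) fun ρ hρ => ?_
  have hρu := hρ.mono (subset_univ _)
  have hsupp : ∀ L : PSpace N → ℝ, (∀ y, L y ≠ 0 → ‖y‖ ≤ r) → tsupport (corr L ρ) ⊆ B :=
    fun L hL => (tsupport_corr_subset hL (hρ.sub.trans ball_subset_closedBall)).trans
      (by rw [hB]; exact closedBall_subset_closedBall (by linarith))
  have hθs : ∀ y, θ y ≠ 0 → ‖y‖ ≤ r := fun y hy => by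
    simpa using hP.tsupp (subset_tsupport _ hy)
  have htest : ∀ L : PSpace N → ℝ, Integrable L → (∀ y, L y ≠ 0 → ‖y‖ ≤ r) →
      IsTest O (corr L ρ) := fun L hL hs =>
    ⟨contDiff_corr hL hρu, hBc.of_isClosed_subset (isClosed_tsupport _) (hsupp L hs),
      (hsupp L hs).trans hsub⟩
  have hind : ∀ (g L : PSpace N → ℝ), (∀ y, L y ≠ 0 → ‖y‖ ≤ r) →
      ∀ w, B.indicator g w * corr L ρ w = g w * corr L ρ w := fun g L hL w => by
    by_cases hw : w ∈ B
    · rw [indicator_of_mem hw]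
    · rw [image_eq_zero_of_notMem_tsupport fun h' => hw (hsupp L hL h'), mul_zero, mul_zero]
  have tK := htest K hP.int hP.supp
  have tθ := htest θ hθ hθs
  have i1 : Integrable fun z => V z * ρ z := (hρ.mono hbO).integrable_mul hO hV
  have i2 : Integrable fun z => conv K (B.indicator fun w => f w + V w) z * ρ z :=
    hρu.integrable_mul isOpen_univ c1.continuousOn
  have i3 : Integrable fun z => conv θ (B.indicator V) z * ρ z :=
    hρu.integrable_mul isOpen_univ c2.continuousOn
  have i12 : Integrable fun z => V z * ρ z -
    conv K (B.indicator fun w => f w + V w) z * ρ z := i1.sub i2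
  simp only [add_mul, sub_mul]
  rw [integral_add i12 i3, integral_sub i1 i2, integral_conv_mul hP.int m1 hC₁ hρu.integrable,
    integral_conv_mul hθ m2 hC₂ hρu.integrable]
  simp only [hind _ K hP.supp, hind _ θ hθs, add_mul]
  have i4 : Integrable fun z => f z * corr K ρ z := tK.integrable_mul hO hf
  have i5 : Integrable fun z => V z * corr K ρ z := tK.integrable_mul hO hV
  have i6 : Integrable fun z => V z * heatAdj (corr K ρ) z := tK.heatAdj.integrable_mul hO hV
  have i7 : Integrable fun z => V z * corr θ ρ z := tθ.integrable_mul hO hV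
  rw [integral_add i4 i5, ← h _ tK, ← integral_add i6 i5]
  have e : ∀ w, V w * heatAdj (corr K ρ) w + V w * corr K ρ w = V w * ρ w + V w * corr θ ρ w :=
    fun w => by rw [← mul_add, hP.heatAdj_corr_add hρu, mul_add]
  simp only [e]
  rw [integral_add i1 i7]
  ring

/-- First order regularity: a continuous distributional solution with continuous right-hand side
has continuous spatial derivatives. -/
theorem WeakHeat.hasLineDerivAt (h : WeakHeat O V f) (hO : IsOpen O) (hV : ContinuousOn V O)
    (hf : ContinuousOn f O) (i : Fin N) :
    (∀ z ∈ O, HasLineDerivAt ℝ V (lineDeriv ℝ V z (eX i)) z (eX i)) ∧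
      ContinuousOn (fun z => lineDeriv ℝ V z (eX i)) O := by
  have key : ∀ z₀ ∈ O, ∃ g : PSpace N → ℝ, Continuous g ∧ ∃ r > 0, ∀ z ∈ ball z₀ r,
      HasLineDerivAt ℝ V (g z) z (eX i) := by
    intro z₀ hz₀
    obtain ⟨R, hR, hRO⟩ := nhds_basis_closedBall.mem_iff.1 (hO.mem_nhds hz₀)
    have hr : 0 < R / 3 := by positivity
    have hsub : closedBall z₀ (3 * (R / 3)) ⊆ O := by
      rwa [show 3 * (R / 3) = R by ring]
    obtain ⟨K, K', θ, hP⟩ := exists_isParametrix N hr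
    set r := R / 3
    set B := closedBall z₀ (3 * r) with hB
    have hBc : IsCompact B := isCompact_closedBall _ _
    have hVB := hV.mono hsub
    have hfV : ContinuousOn (fun w => f w + V w) B := (hf.mono hsub).add hVB
    obtain ⟨C₁, hC₁⟩ := exists_abs_indicator_le hBc hfV
    obtain ⟨C₂, hC₂⟩ := exists_abs_indicator_le hBc hVB
    have m1 := measurable_indicator_of_continuousOn hBc hfV
    have m2 := measurable_indicator_of_continuousOn hBc hVB
    have hθi := (hP.test.dirDeriv (eX i)).integrable
    have hrep := fun z (hz : z ∈ ball z₀ (2 * r)) => h.eq_conv hO hV hf hP hr hsub hz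
    have w1 := weakDeriv_conv hP.int (hP.int' i) (hP.weak i) m1 hC₁
    have w2 := weakDeriv_conv hP.test.integrable hθi (weakDeriv_of_contDiff hP.test.smooth _) m2 hC₂
    have c1 := continuous_conv hP.int m1 hC₁
    have c2 := continuous_conv hP.test.integrable m2 hC₂
    have c3 := continuous_conv (hP.int' i) m1 hC₁
    have c4 := continuous_conv hθi m2 hC₂
    refine ⟨_, c3.sub c4, 2 * r, by positivity, fun z hz => ?_⟩
    have d1 := hasLineDerivAt_of_weakDeriv isOpen_univ c1.continuousOn c3.continuousOn w1
      (mem_univ z)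
    have d2 := hasLineDerivAt_of_weakDeriv isOpen_univ c2.continuousOn c4.continuousOn w2
      (mem_univ z)
    have d3 := HasDerivAt.sub d1 d2
    refine HasLineDerivAt.congr_of_eventuallyEq (f := fun z => conv K (B.indicator fun w =>
      f w + V w) z - conv θ (B.indicator V) z) d3 ?_
    filter_upwards [isOpen_ball.mem_nhds hz] with w hw using hrep w hw
  refine ⟨fun z hz => ?_, fun z hz => ContinuousAt.continuousWithinAt ?_⟩
  · obtain ⟨g, -, r, hr, hg⟩ := key z hz
    rw [(hg z (mem_ball_self hr)).lineDeriv]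
    exact hg z (mem_ball_self hr)
  · obtain ⟨g, hgc, r, hr, hg⟩ := key z hz
    refine hgc.continuousAt.congr ?_
    filter_upwards [ball_mem_nhds z hr] with w hw using (hg w hw).lineDeriv.symm

end WeakHeat

section Regularity

variable {N : ℕ} {O : Set (PSpace N)} {V f : PSpace N → ℝ}

theorem dirDeriv_dirDeriv {φ : PSpace N → ℝ} (hφ : ContDiff ℝ ∞ φ) (v w z : PSpace N) :
    dirDeriv v (dirDeriv w φ) z = fderiv ℝ (fderiv ℝ φ) z v w := by
  have h : DifferentiableAt ℝ (fderiv ℝ φ) z :=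
    (hφ.fderiv_right (m := ∞) (by simp)).differentiable (by simp) z
  have h2 := (h.hasFDerivAt.clm_apply (hasFDerivAt_const w z)).fderiv
  unfold dirDeriv
  rw [h2]
  simp

theorem dirDeriv_comm {φ : PSpace N → ℝ} (hφ : ContDiff ℝ ∞ φ) (v w : PSpace N) :
    dirDeriv v (dirDeriv w φ) = dirDeriv w (dirDeriv v φ) := by
  funext z
  rw [dirDeriv_dirDeriv hφ, dirDeriv_dirDeriv hφ]
  exact (hφ.contDiffAt.isSymmSndFDerivAt (by
    rw [minSmoothness_of_isRCLikeNormedField]; exact WithTop.coe_le_coe.2 le_top)) v w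

theorem heatAdj_dirDeriv {φ : PSpace N → ℝ} (hφ : ContDiff ℝ ∞ φ) (v : PSpace N) :
    heatAdj (dirDeriv v φ) = dirDeriv v (heatAdj φ) := by
  funext z
  have hd : ∀ {g : PSpace N → ℝ}, ContDiff ℝ ∞ g → HasFDerivAt g (fderiv ℝ g z) z :=
    fun hg => (hg.differentiable (by simp) z).hasFDerivAt
  have h : HasFDerivAt (heatAdj φ) _ z := ((hd (contDiff_dirDeriv hφ eT)).neg).sub
    (HasFDerivAt.fun_sum fun i (_ : i ∈ Finset.univ) =>
      hd (contDiff_dirDeriv (contDiff_dirDeriv hφ (eX i)) (eX i)))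
  have e : ∀ i : Fin N, dirDeriv (eX i) (dirDeriv (eX i) (dirDeriv v φ)) =
      dirDeriv v (dirDeriv (eX i) (dirDeriv (eX i) φ)) := fun i => by
    rw [dirDeriv_comm hφ, dirDeriv_comm (contDiff_dirDeriv hφ _)]
  rw [heatAdj, dirDeriv_comm hφ eT v]
  simp only [e]
  rw [dirDeriv, dirDeriv, h.fderiv]
  simp [dirDeriv]

theorem xDeriv_eq_lineDeriv (i : Fin N) (V : PSpace N → ℝ) :
    xDeriv i V = fun z => lineDeriv ℝ V z (eX i) := by
  funext z
  simp [xDeriv, lineDeriv, eX, Prod.add_def]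

theorem tDeriv_eq_lineDeriv (V : PSpace N → ℝ) :
    tDeriv V = fun z => lineDeriv ℝ V z eT := by
  funext z
  have := deriv_comp_const_add (fun s => V (z.1, s)) z.2 0
  simp only [add_zero] at this
  simp only [tDeriv, lineDeriv, eT, Prod.add_def, ← this]
  simp

theorem lineDifferentiableAt_eX_iff (i : Fin N) (V : PSpace N → ℝ) (z : PSpace N) :
    LineDifferentiableAt ℝ (fun y => V (y, z.2)) z.1 (EuclideanSpace.single i 1) ↔
      LineDifferentiableAt ℝ V z (eX i) := by
  simp [LineDifferentiableAt, eX, Prod.add_def]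

theorem lineDifferentiableAt_eT_iff (V : PSpace N → ℝ) (z : PSpace N) :
    DifferentiableAt ℝ (fun s => V (z.1, s)) z.2 ↔ LineDifferentiableAt ℝ V z eT := by
  have := differentiableAt_comp_add_left (𝕜 := ℝ) (f := fun s => V (z.1, s)) (x := 0) z.2
  simp only [add_zero] at this
  rw [← this]
  simp [LineDifferentiableAt, eT, Prod.add_def]

theorem WeakHeat.lineDeriv (h : WeakHeat O V f) (hO : IsOpen O) (hV : ContinuousOn V O)
    (hf : ContinuousOn f O) {f' : PSpace N → ℝ} {i : Fin N} (hf' : ContinuousOn f' O)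
    (hd : ∀ z ∈ O, HasLineDerivAt ℝ f (f' z) z (eX i)) :
    WeakHeat O (fun z => lineDeriv ℝ V z (eX i)) f' := by
  obtain ⟨h1, h2⟩ := h.hasLineDerivAt hO hV hf i
  intro φ hφ
  have e1 := weakDeriv_of_hasLineDerivAt hO hV h2 h1 _ hφ.heatAdj
  have e2 := weakDeriv_of_hasLineDerivAt hO hf hf' hd _ hφ
  have e3 := h _ (hφ.dirDeriv (eX i))
  rw [heatAdj_dirDeriv hφ.smooth] at e3
  linarith

/-- A continuous distributional solution of the semilinear equation is classical. -/
theorem WeakHeat.isC21 {q : ℝ} (hq : 1 < q) (hO : IsOpen O) (hV : ContinuousOn V O)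
    (h : WeakHeat O V fun z => -(V z) ^ q) :
    IsC21 O V ∧ ∀ z ∈ O, tDeriv V z - lapl V z + V z ^ q = 0 := by
  have hf : ContinuousOn (fun z => -(V z) ^ q) O :=
    (hV.rpow_const fun z _ => Or.inr (by linarith)).neg
  have hx := h.hasLineDerivAt hO hV hf
  have hf' : ∀ i, ContinuousOn
      (fun z => -(_root_.lineDeriv ℝ V z (eX i) * q * V z ^ (q - 1))) O := fun i =>
    (((hx i).2.mul continuousOn_const).mul
      (hV.rpow_const fun z _ => Or.inr (by linarith))).neg
  have hw := fun i => h.lineDeriv hO hV hf (hf' i) (i := i) fun z hz => by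
    have := (HasDerivAt.rpow_const ((hx i).1 z hz) (p := q) (Or.inr hq.le)).neg
    refine HasDerivAt.congr_deriv this ?_
    simp
  have hxx := fun j => (hw j).hasLineDerivAt hO (hx j).2 (hf' j)
  set g : PSpace N → ℝ := fun z => -(V z) ^ q +
    ∑ i, _root_.lineDeriv ℝ (fun z => _root_.lineDeriv ℝ V z (eX i)) z (eX i) with hg
  have hgc : ContinuousOn g O := hf.add (continuousOn_finsetSum _ fun i _ => (hxx i i).2)
  have ht : WeakDeriv O eT V g := by
    intro φ hφ
    have e1 := h φ hφ
    have i1 : Integrable fun z => -(V z * dirDeriv eT φ z) :=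
      ((hφ.dirDeriv _).integrable_mul hO hV).neg
    have i2 : ∀ i, Integrable fun z => V z * dirDeriv (eX i) (dirDeriv (eX i) φ) z :=
      fun i => ((hφ.dirDeriv _).dirDeriv _).integrable_mul hO hV
    have i3 := hφ.integrable_mul hO hf
    have i4 : ∀ i, Integrable fun z =>
        _root_.lineDeriv ℝ (fun z => _root_.lineDeriv ℝ V z (eX i)) z (eX i) * φ z :=
      fun i => hφ.integrable_mul hO (hxx i i).2
    have e2 : ∀ z, V z * heatAdj φ z = -(V z * dirDeriv eT φ z) -
        ∑ i, V z * dirDeriv (eX i) (dirDeriv (eX i) φ) z := fun z => by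
      rw [heatAdj, ← Finset.mul_sum]; ring
    have e3 : ∀ i, ∫ z, V z * dirDeriv (eX i) (dirDeriv (eX i) φ) z =
        ∫ z, _root_.lineDeriv ℝ (fun z => _root_.lineDeriv ℝ V z (eX i)) z (eX i) * φ z :=
      fun i => by
        rw [weakDeriv_of_hasLineDerivAt hO hV (hx i).2 (hx i).1 _ (hφ.dirDeriv _),
          weakDeriv_of_hasLineDerivAt hO (hx i).2 (hxx i i).2 (hxx i i).1 _ hφ, neg_neg]
    simp only [e2] at e1
    rw [integral_sub i1 (integrable_finsetSum _ fun i _ => i2 i), integral_neg,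
      integral_finsetSum _ fun i _ => i2 i] at e1
    simp only [e3] at e1
    simp only [hg, add_mul, Finset.sum_mul]
    rw [integral_add i3 (integrable_finsetSum _ fun i _ => i4 i),
      integral_finsetSum _ fun i _ => i4 i]
    linarith
  have htd := fun z (hz : z ∈ O) => hasLineDerivAt_of_weakDeriv hO hV hgc ht hz
  have exx : ∀ i j, xxDeriv i j V =
      fun z => _root_.lineDeriv ℝ (fun z => _root_.lineDeriv ℝ V z (eX j)) z (eX i) :=
    fun i j => by
      funext z
      rw [xxDeriv, xDeriv_eq_lineDeriv j, xDeriv_eq_lineDeriv i]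
  have hte : ∀ z ∈ O, tDeriv V z = g z := fun z hz => by
    rw [tDeriv_eq_lineDeriv]; exact (htd z hz).lineDeriv
  refine ⟨⟨hV, fun z hz => ?_, hgc.congr hte, fun i z hz => ?_, fun i => ?_, fun i j z hz => ?_,
    fun i j => ?_⟩, fun z hz => ?_⟩
  · exact (lineDifferentiableAt_eT_iff V z).2 (htd z hz).lineDifferentiableAt
  · exact (lineDifferentiableAt_eX_iff i V z).2 ((hx i).1 z hz).lineDifferentiableAt
  · rw [xDeriv_eq_lineDeriv]; exact (hx i).2
  · rw [lineDifferentiableAt_eX_iff i (xDeriv j V) z, xDeriv_eq_lineDeriv]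
    exact ((hxx j i).1 z hz).lineDifferentiableAt
  · rw [exx]; exact (hxx j i).2
  · rw [hte z hz, lapl, hg]
    simp only [exx]
    ring

end Regularity

section Mild

variable {N : ℕ}

theorem monotoneOn_mul_sub_rpow {p M l : ℝ} (hp : 1 < p) (hl : p * M ^ (p - 1) ≤ l) :
    MonotoneOn (fun s : ℝ => l * s - s ^ p) (Icc 0 M) := by
  have hd : ∀ x : ℝ, HasDerivAt (fun s : ℝ => l * s - s ^ p) (l * 1 - p * x ^ (p - 1)) x :=
    fun x => ((hasDerivAt_id x).const_mul l).sub (Real.hasDerivAt_rpow_const (Or.inr hp.le))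
  refine monotoneOn_of_deriv_nonneg (convex_Icc 0 M)
    (fun x _ => (hd x).continuousAt.continuousWithinAt)
    (fun x _ => (hd x).differentiableAt.differentiableWithinAt) fun x hx => ?_
  rw [interior_Icc] at hx
  rw [(hd x).deriv]
  have : x ^ (p - 1) ≤ M ^ (p - 1) := Real.rpow_le_rpow hx.1.le hx.2.le (by linarith)
  nlinarith

theorem conv_mono {H f g : PSpace N → ℝ} {C : ℝ} (hH : Integrable H) (hH0 : ∀ z, 0 ≤ H z)
    (hf : Measurable f) (hg : Measurable g) (hfC : ∀ y, |f y| ≤ C) (hgC : ∀ y, |g y| ≤ C)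
    (hfg : ∀ y, f y ≤ g y) (z : PSpace N) : conv H f z ≤ conv H g z :=
  integral_mono (integrable_conv_integrand hH hf hfC z) (integrable_conv_integrand hH hg hgC z)
    fun y => mul_le_mul_of_nonneg_left (hfg _) (hH0 y)

/-- The maximal mild solution of `∂_t V - ΔV + V ^ p = F` with `0 ≤ V ≤ M`. -/
theorem exists_mild_solution {p M : ℝ} (hp : 1 < p) (hM : 0 < M) {F : PSpace N → ℝ}
    (hFm : Measurable F) (hF0 : ∀ z, 0 ≤ F z) (hFM : ∀ z, F z ≤ M ^ p) :
    ∃ l > 0, ∃ V : PSpace N → ℝ, Continuous V ∧ (∀ z, V z ∈ Icc 0 M) ∧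
      (∀ z, V z = conv (dampedHeatK N l) (fun w => F w + (l * V w - V w ^ p)) z) ∧
      ∀ W : PSpace N → ℝ, Measurable W → (∀ z, W z ∈ Icc 0 M) →
        (∀ z, W z ≤ conv (dampedHeatK N l) (fun w => F w + (l * W w - W w ^ p)) z) →
        ∀ z, W z ≤ V z := by
  set l := p * M ^ (p - 1) with hl_def
  have hl : 0 < l := by positivity
  have hlM : l * M = p * M ^ p := by
    rw [hl_def, mul_assoc, ← Real.rpow_add_one hM.ne']; simp
  have hmono := monotoneOn_mul_sub_rpow (M := M) hp hl_def.ge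
  set H := dampedHeatK N l with hH
  have hHi : Integrable H := integrable_dampedHeatK hl
  have hH0 : ∀ z, 0 ≤ H z := fun z => dampedHeatK_nonneg l z
  set G : (PSpace N → ℝ) → PSpace N → ℝ := fun v w => F w + (l * v w - v w ^ p) with hG
  have hGm : ∀ v, Measurable v → Measurable (G v) := fun v hv =>
    hFm.add ((hv.const_mul l).sub (hv.pow_const p))
  have hG0 : ∀ v : PSpace N → ℝ, (∀ z, v z ∈ Icc 0 M) → ∀ z, 0 ≤ G v z := fun v hv z => by
    have := hmono (left_mem_Icc.2 hM.le) (hv z) (hv z).1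
    have h0 : (0 : ℝ) ^ p = 0 := Real.zero_rpow (by linarith)
    simp only [mul_zero, h0, sub_zero] at this
    exact add_nonneg (hF0 z) this
  have hGM : ∀ v : PSpace N → ℝ, (∀ z, v z ∈ Icc 0 M) → ∀ z, G v z ≤ l * M := fun v hv z => by
    have := hmono (hv z) (right_mem_Icc.2 hM.le) (hv z).2
    simp only at this
    simp only [hG]
    linarith [hFM z]
  have hGabs : ∀ v : PSpace N → ℝ, (∀ z, v z ∈ Icc 0 M) → ∀ z, |G v z| ≤ l * M :=
    fun v hv z => by rw [abs_of_nonneg (hG0 v hv z)]; exact hGM v hv z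
  have hTmem : ∀ v, Measurable v → (∀ z, v z ∈ Icc 0 M) → ∀ z, conv H (G v) z ∈ Icc 0 M := by
    refine fun v hv hvM z => ⟨integral_nonneg fun y => mul_nonneg (hH0 y) (hG0 v hvM _), ?_⟩
    have h1 : conv H (G v) z ≤ conv H (fun _ => l * M) z :=
      conv_mono hHi hH0 (hGm v hv) measurable_const (hGabs v hvM)
        (fun _ => (abs_of_nonneg (by positivity)).le) (hGM v hvM) z
    refine h1.trans_eq ?_
    simp only [conv]
    rw [integral_mul_const, integral_dampedHeatK hl]
    field_simp
  have hTmono : ∀ v w, Measurable v → Measurable w → (∀ z, v z ∈ Icc 0 M) →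
      (∀ z, w z ∈ Icc 0 M) → (∀ z, v z ≤ w z) → ∀ z, conv H (G v) z ≤ conv H (G w) z :=
    fun v w hv hw hvM hwM hvw z =>
      conv_mono hHi hH0 (hGm v hv) (hGm w hw) (hGabs v hvM) (hGabs w hwM)
        (fun y => add_le_add le_rfl (hmono (hvM y) (hwM y) (hvw y))) z
  set T : (PSpace N → ℝ) → PSpace N → ℝ := fun v => conv H (G v) with hT
  set v : ℕ → PSpace N → ℝ := fun n => T^[n] fun _ => M with hv
  have hv1 : ∀ n, v (n + 1) = T (v n) := fun n => Function.iterate_succ_apply' _ _ _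
  have hvm : ∀ n, Measurable (v n) ∧ ∀ z, v n z ∈ Icc 0 M := by
    intro n
    induction n with
    | zero => exact ⟨measurable_const, fun z => right_mem_Icc.2 hM.le⟩
    | succ n ih =>
      rw [hv1]
      exact ⟨(continuous_conv hHi (hGm _ ih.1) (hGabs _ ih.2)).measurable, hTmem _ ih.1 ih.2⟩
  have hvanti : ∀ n z, v (n + 1) z ≤ v n z := by
    intro n
    induction n with
    | zero => exact fun z => ((hvm 1).2 z).2
    | succ n ih =>
      intro z
      have h1 : v (n + 1 + 1) z = T (v (n + 1)) z := by rw [hv1]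
      have h2 : v (n + 1) z = T (v n) z := by rw [hv1]
      rw [h1, h2]
      exact hTmono _ _ (hvm _).1 (hvm _).1 (hvm _).2 (hvm _).2 ih z
  set V : PSpace N → ℝ := fun z => ⨅ n, v n z with hV
  have hbdd : ∀ z, BddBelow (range fun n => v n z) := fun z =>
    ⟨0, by rintro _ ⟨n, rfl⟩; exact ((hvm n).2 z).1⟩
  have hlim : ∀ z, Tendsto (fun n => v n z) atTop (𝓝 (V z)) := fun z =>
    tendsto_atTop_ciInf (antitone_nat_of_succ_le fun n => hvanti n z) (hbdd z)
  have hVm : Measurable V :=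
    measurable_of_tendsto_metrizable (fun n => (hvm n).1) (tendsto_pi_nhds.2 hlim)
  have hVM : ∀ z, V z ∈ Icc 0 M := fun z =>
    isClosed_Icc.mem_of_tendsto (hlim z) (Eventually.of_forall fun n => (hvm n).2 z)
  have hfix : ∀ z, V z = conv H (G V) z := by
    intro z
    refine tendsto_nhds_unique ((tendsto_add_atTop_iff_nat 1).2 (hlim z)) ?_
    simp only [hv1]
    refine tendsto_integral_of_dominated_convergence (fun y => H y * (l * M))
      (fun n => (integrable_conv_integrand hHi (hGm _ (hvm n).1)
        (hGabs _ (hvm n).2) z).aestronglyMeasurable)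
      (hHi.mul_const _) (fun n => ae_of_all _ fun y => ?_) (ae_of_all _ fun y => ?_)
    · rw [norm_mul, Real.norm_of_nonneg (hH0 y)]
      exact mul_le_mul_of_nonneg_left (hGabs _ (hvm n).2 _) (hH0 y)
    · have h1 := hlim (z - y)
      exact ((h1.const_mul l).sub (h1.rpow_const (Or.inr (by linarith)))).const_add _ |>.const_mul _
  refine ⟨l, hl, V, ?_, hVM, hfix, fun W hW hWM hWT z => ?_⟩
  · rw [show V = conv H (G V) from funext hfix]
    exact continuous_conv hHi (hGm _ hVm) (hGabs _ hVM)
  · refine ge_of_tendsto' (hlim z) fun n => ?_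
    revert z
    induction n with
    | zero => exact fun z => (hWM z).2
    | succ n ih =>
      intro z
      rw [hv1]
      exact (hWT z).trans (hTmono _ _ hW (hvm n).1 hWM (hvm n).2 ih z)

theorem corr_dampedHeatK_heatAdj {l : ℝ} (hl : 0 < l) {ρ : PSpace N → ℝ} (hρ : IsTest univ ρ)
    (w : PSpace N) : heatAdj (corr (dampedHeatK N l) ρ) w + l * corr (dampedHeatK N l) ρ w =
      ρ w := by
  have hH : Integrable (dampedHeatK N l) := integrable_dampedHeatK hl
  have hInt : ∀ φ : PSpace N → ℝ, IsTest univ φ →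
      Integrable fun y => dampedHeatK N l y * φ (w + y) := fun φ hφ => by
    obtain ⟨C, hC⟩ := hφ.bounded
    exact integrable_mul_bounded hH (hφ.comp_add w).smooth.continuous.aestronglyMeasurable
      fun y => hC (w + y)
  have h := integral_dampedHeatK_mul_heatAdj hl (hρ.comp_add w)
  rw [heatAdj_comp_add, add_zero] at h
  rw [heatAdj_corr hH hρ]
  simp only [corr]
  rw [← integral_const_mul, ← integral_add (hInt _ hρ.heatAdj) ((hInt _ hρ).const_mul l), ← h]
  congr 1
  ext y
  ring

theorem integral_conv_mul_heatAdj {l C : ℝ} (hl : 0 < l) {g φ : PSpace N → ℝ} (hg : Measurable g)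
    (hC : ∀ y, |g y| ≤ C) (hφ : IsTest univ φ) :
    ∫ z, conv (dampedHeatK N l) g z * (heatAdj φ z + l * φ z) = ∫ z, g z * φ z := by
  have ht : IsTest univ fun z => heatAdj φ z + l * φ z := by
    have h1 : tsupport (fun z => heatAdj φ z + l * φ z) ⊆ tsupport φ := by
      refine closure_minimal (fun z hz => ?_) (isClosed_tsupport _)
      by_contra hz'
      refine hz ?_
      simp [image_eq_zero_of_notMem_tsupport hz', image_eq_zero_of_notMem_tsupport
        fun h => hz' (tsupport_heatAdj_subset φ h)]
    exact ⟨hφ.heatAdj.smooth.add (contDiff_const.mul hφ.smooth),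
      hφ.compact.of_isClosed_subset (isClosed_tsupport _) h1, subset_univ _⟩
  have hH : Integrable (dampedHeatK N l) := integrable_dampedHeatK hl
  rw [integral_conv_mul hH hg hC ht.integrable]
  congr 1
  ext w
  congr 1
  have h := integral_dampedHeatK_mul_heatAdj hl (hφ.comp_add w)
  rwa [heatAdj_comp_add, add_zero] at h

theorem weakHeat_conv {l C : ℝ} (hl : 0 < l) {V g : PSpace N → ℝ} (hg : Measurable g)
    (hC : ∀ y, |g y| ≤ C) (hV : ∀ z, V z = conv (dampedHeatK N l) g z) :
    WeakHeat univ V fun z => g z - l * V z := by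
  intro φ hφ
  have hVe : V = conv (dampedHeatK N l) g := funext hV
  have hVc : Continuous V := by
    rw [hVe]
    exact continuous_conv (integrable_dampedHeatK hl) hg hC
  have h := integral_conv_mul_heatAdj hl hg hC hφ
  rw [← hVe] at h
  have i1 : Integrable fun z => V z * heatAdj φ z :=
    hφ.heatAdj.integrable_mul isOpen_univ hVc.continuousOn
  have i2 : Integrable fun z => l * (V z * φ z) :=
    (hφ.integrable_mul isOpen_univ hVc.continuousOn).const_mul l
  have i3 : Integrable fun z => g z * φ z := by
    obtain ⟨C', hC'⟩ := hφ.bounded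
    simpa only [mul_comm] using integrable_mul_bounded hφ.integrable hg.aestronglyMeasurable hC
  have e1 : ∀ z, V z * (heatAdj φ z + l * φ z) = V z * heatAdj φ z + l * (V z * φ z) :=
    fun z => by ring
  have e2 : ∀ z, (g z - l * V z) * φ z = g z * φ z - l * (V z * φ z) := fun z => by ring
  simp only [e1] at h
  rw [integral_add i1 i2] at h
  simp only [e2]
  rw [integral_sub i3 i2]
  linarith

theorem heatAdj_congr {φ ψ : PSpace N → ℝ} {U : Set (PSpace N)} (hU : IsOpen U)
    (h : EqOn φ ψ U) : EqOn (heatAdj φ) (heatAdj ψ) U := by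
  have hd : ∀ {φ ψ : PSpace N → ℝ} (v : PSpace N), EqOn φ ψ U →
      EqOn (dirDeriv v φ) (dirDeriv v ψ) U := fun v h z hz => by
    rw [dirDeriv, dirDeriv, (h.eventuallyEq_of_mem (hU.mem_nhds hz)).fderiv_eq]
  intro z hz
  simp only [heatAdj]
  rw [hd _ h hz, Finset.sum_congr rfl fun i _ => hd _ (hd _ h) hz]

theorem WeakHeat.eq_conv_dampedHeatK {l : ℝ} (hl : 0 < l) {W h : PSpace N → ℝ}
    (hW : Continuous W) (hWc : HasCompactSupport W) (hh : Continuous h)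
    (hhs : HasCompactSupport h) (H : WeakHeat univ W h) (z : PSpace N) :
    W z = conv (dampedHeatK N l) (fun w => h w + l * W w) z := by
  have hH : Integrable (dampedHeatK N l) := integrable_dampedHeatK hl
  have hgc : Continuous fun w => h w + l * W w := hh.add (continuous_const.mul hW)
  obtain ⟨C₁, hC₁⟩ := hWc.exists_bound_of_continuous hW
  obtain ⟨C₂, hC₂⟩ := hhs.exists_bound_of_continuous hh
  have hC : ∀ y, |h y + l * W y| ≤ C₂ + l * C₁ := fun y => by
    refine (abs_add_le _ _).trans (add_le_add (hC₂ y) ?_)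
    rw [abs_mul, abs_of_pos hl]
    exact mul_le_mul_of_nonneg_left (hC₁ y) hl.le
  have hcc := continuous_conv hH hgc.measurable hC
  obtain ⟨χ, hχ, -, U, hU, hKU, hχU⟩ := exists_isTest_one (hWc.isCompact.union hhs.isCompact)
    isOpen_univ (subset_univ _)
  suffices hz : ∀ z ∈ univ, W z - conv (dampedHeatK N l) (fun w => h w + l * W w) z = 0 by
    linarith [hz z (mem_univ z)]
  refine eqOn_zero_of_integral_eq_zero isOpen_univ (hW.sub hcc).continuousOn fun ρ hρ => ?_
  set φ := corr (dampedHeatK N l) ρ with hφ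
  have hφs : ContDiff ℝ ∞ φ := contDiff_corr hH hρ
  have hφχ : IsTest univ fun z => χ z * φ z := by
    simpa only [mul_comm] using hχ.smul_left hφs
  have hUe : EqOn (fun z => χ z * φ z) φ U := fun z hz => by simp [hχU z hz]
  have hW0 : ∀ z ∉ U, W z = 0 := fun z hz =>
    image_eq_zero_of_notMem_tsupport fun h' => hz (hKU (Or.inl h'))
  have hh0 : ∀ z ∉ U, h z = 0 := fun z hz =>
    image_eq_zero_of_notMem_tsupport fun h' => hz (hKU (Or.inr h'))
  have e1 : ∀ z, W z * heatAdj (fun z => χ z * φ z) z = W z * heatAdj φ z := fun z => by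
    by_cases hz : z ∈ U
    · rw [heatAdj_congr hU hUe hz]
    · rw [hW0 z hz, zero_mul, zero_mul]
  have e2 : ∀ z, h z * (χ z * φ z) = h z * φ z := fun z => by
    by_cases hz : z ∈ U
    · rw [hχU z hz, one_mul]
    · rw [hh0 z hz, zero_mul, zero_mul]
  have e3 : ∀ z, W z * ρ z = W z * heatAdj φ z + l * (W z * φ z) := fun z => by
    rw [← corr_dampedHeatK_heatAdj hl hρ]; ring
  have hw := H _ hφχ
  simp only [e1, e2] at hw
  have i1 : Integrable fun z => W z * φ z := by
    refine (hW.mul hφs.continuous).integrable_of_hasCompactSupport hWc.mul_right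
  have i2 : Integrable fun z => W z * heatAdj φ z := by
    have := hφχ.heatAdj.integrable_mul isOpen_univ hW.continuousOn
    simpa only [e1] using this
  have i3 : Integrable fun z => h z * φ z :=
    (hh.mul hφs.continuous).integrable_of_hasCompactSupport hhs.mul_right
  simp only [sub_mul]
  rw [integral_sub (hρ.integrable_mul isOpen_univ hW.continuousOn)
    (hρ.integrable_mul isOpen_univ hcc.continuousOn),
    integral_conv_mul hH hgc.measurable hC hρ.integrable]
  simp only [e3, add_mul, mul_assoc]
  rw [integral_add i2 (i1.const_mul l), integral_add i3 (i1.const_mul l), hw, sub_self]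

end Mild

section Subsolution

variable {N : ℕ} {O : Set (PSpace N)}

/-- `u` has continuous time derivative `ut`, spatial derivatives `ux i` and pure second spatial
derivatives `uxx i` in `O`. -/
structure HasC21 (O : Set (PSpace N)) (u ut : PSpace N → ℝ) (ux uxx : Fin N → PSpace N → ℝ) :
    Prop where
  cont : ContinuousOn u O
  cont_t : ContinuousOn ut O
  cont_x : ∀ i, ContinuousOn (ux i) O
  cont_xx : ∀ i, ContinuousOn (uxx i) O
  hasDeriv_t : ∀ z ∈ O, HasLineDerivAt ℝ u (ut z) z eT
  hasDeriv_x : ∀ i, ∀ z ∈ O, HasLineDerivAt ℝ u (ux i z) z (eX i)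
  hasDeriv_xx : ∀ i, ∀ z ∈ O, HasLineDerivAt ℝ (ux i) (uxx i z) z (eX i)

theorem IsC21.hasC21 {u : PSpace N → ℝ} (h : IsC21 O u) :
    HasC21 O u (tDeriv u) (fun i => xDeriv i u) (fun i => xxDeriv i i u) where
  cont := h.cont
  cont_t := h.cont_t
  cont_x := h.cont_x
  cont_xx i := h.cont_xx i i
  hasDeriv_t z hz := by
    rw [tDeriv_eq_lineDeriv]
    exact ((lineDifferentiableAt_eT_iff u z).1 (h.diff_t z hz)).hasLineDerivAt
  hasDeriv_x i z hz := by
    rw [xDeriv_eq_lineDeriv]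
    exact ((lineDifferentiableAt_eX_iff i u z).1 (h.diff_x i z hz)).hasLineDerivAt
  hasDeriv_xx i z hz := by
    have : xxDeriv i i u = fun z => lineDeriv ℝ (xDeriv i u) z (eX i) := by
      funext z
      rw [xxDeriv, xDeriv_eq_lineDeriv i (xDeriv i u)]
    rw [this]
    exact ((lineDifferentiableAt_eX_iff i (xDeriv i u) z).1 (h.diff_xx i i z hz)).hasLineDerivAt

variable {u ut : PSpace N → ℝ} {ux uxx : Fin N → PSpace N → ℝ}

theorem HasC21.comp (h : HasC21 O u ut ux uxx) {ψ ψ' ψ'' : ℝ → ℝ}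
    (h1 : ∀ s, HasDerivAt ψ (ψ' s) s) (h2 : ∀ s, HasDerivAt ψ' (ψ'' s) s) (h3 : Continuous ψ'') :
    HasC21 O (fun z => ψ (u z)) (fun z => ψ' (u z) * ut z) (fun i z => ψ' (u z) * ux i z)
      (fun i z => ψ'' (u z) * ux i z * ux i z + ψ' (u z) * uxx i z) := by
  have c1 : Continuous ψ := continuous_iff_continuousAt.2 fun s => (h1 s).continuousAt
  have c2 : Continuous ψ' := continuous_iff_continuousAt.2 fun s => (h2 s).continuousAt
  have key : ∀ {ψ ψ' : ℝ → ℝ} {z v : PSpace N} {d : ℝ}, (∀ s, HasDerivAt ψ (ψ' s) s) →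
      HasLineDerivAt ℝ u d z v → HasLineDerivAt ℝ (fun z => ψ (u z)) (ψ' (u z) * d) z v := by
    intro ψ ψ' z v d h hd
    exact HasDerivAt.congr_deriv (HasDerivAt.comp (0 : ℝ) (h (u (z + (0 : ℝ) • v))) hd) (by simp)
  refine ⟨c1.comp_continuousOn h.cont, (c2.comp_continuousOn h.cont).mul h.cont_t,
    fun i => (c2.comp_continuousOn h.cont).mul (h.cont_x i),
    fun i => (((h3.comp_continuousOn h.cont).mul (h.cont_x i)).mul (h.cont_x i)).add
      ((c2.comp_continuousOn h.cont).mul (h.cont_xx i)),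
    fun z hz => key h1 (h.hasDeriv_t z hz), fun i z hz => key h1 (h.hasDeriv_x i z hz),
    fun i z hz => ?_⟩
  have := HasDerivAt.mul (key h2 (h.hasDeriv_x i z hz)) (h.hasDeriv_xx i z hz)
  refine HasDerivAt.congr_deriv this ?_
  simp

theorem HasC21.smooth_mul (h : HasC21 O u ut ux uxx) {η : PSpace N → ℝ} (hη : ContDiff ℝ ∞ η) :
    HasC21 O (fun z => η z * u z) (fun z => dirDeriv eT η z * u z + η z * ut z)
      (fun i z => dirDeriv (eX i) η z * u z + η z * ux i z)
      (fun i z => dirDeriv (eX i) (dirDeriv (eX i) η) z * u z +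
        2 * (dirDeriv (eX i) η z * ux i z) + η z * uxx i z) := by
  have c : ∀ {g : PSpace N → ℝ}, ContDiff ℝ ∞ g → ContinuousOn g O :=
    fun hg => hg.continuous.continuousOn
  have key : ∀ {g f : PSpace N → ℝ} {z v : PSpace N} {d : ℝ}, ContDiff ℝ ∞ g →
      HasLineDerivAt ℝ f d z v →
      HasLineDerivAt ℝ (fun z => g z * f z) (dirDeriv v g z * f z + g z * d) z v := by
    intro g f z v d hg hd
    have := HasDerivAt.mul ((hg.differentiable (by simp) z).hasFDerivAt.hasLineDerivAt v) hd
    refine HasDerivAt.congr_deriv this ?_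
    simp [dirDeriv]
  have hη' := fun i => contDiff_dirDeriv hη (eX i)
  refine ⟨(c hη).mul h.cont, ((c (contDiff_dirDeriv hη _)).mul h.cont).add ((c hη).mul h.cont_t),
    fun i => ((c (hη' i)).mul h.cont).add ((c hη).mul (h.cont_x i)),
    fun i => (((c (contDiff_dirDeriv (hη' i) _)).mul h.cont).add
      (continuousOn_const.mul ((c (hη' i)).mul (h.cont_x i)))).add ((c hη).mul (h.cont_xx i)),
    fun z hz => key hη (h.hasDeriv_t z hz), fun i z hz => key hη (h.hasDeriv_x i z hz),
    fun i z hz => ?_⟩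
  refine HasDerivAt.congr_deriv
    (HasDerivAt.add (key (hη' i) (h.hasDeriv_x i z hz)) (key hη (h.hasDeriv_xx i z hz))) ?_
  ring

theorem HasC21.weakHeat (h : HasC21 O u ut ux uxx) (hO : IsOpen O) :
    WeakHeat O u fun z => ut z - ∑ i, uxx i z := by
  intro φ hφ
  have i1 : Integrable fun z => -(u z * dirDeriv eT φ z) :=
    ((hφ.dirDeriv _).integrable_mul hO h.cont).neg
  have i2 : ∀ i, Integrable fun z => u z * dirDeriv (eX i) (dirDeriv (eX i) φ) z :=
    fun i => ((hφ.dirDeriv _).dirDeriv _).integrable_mul hO h.cont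
  have i4 : ∀ i, Integrable fun z => uxx i z * φ z :=
    fun i => hφ.integrable_mul hO (h.cont_xx i)
  have e2 : ∀ z, u z * heatAdj φ z = -(u z * dirDeriv eT φ z) -
      ∑ i, u z * dirDeriv (eX i) (dirDeriv (eX i) φ) z := fun z => by
    rw [heatAdj, ← Finset.mul_sum]; ring
  have e3 : ∀ i, ∫ z, u z * dirDeriv (eX i) (dirDeriv (eX i) φ) z = ∫ z, uxx i z * φ z :=
    fun i => by
      rw [weakDeriv_of_hasLineDerivAt hO h.cont (h.cont_x i) (h.hasDeriv_x i) _ (hφ.dirDeriv _),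
        weakDeriv_of_hasLineDerivAt hO (h.cont_x i) (h.cont_xx i) (h.hasDeriv_xx i) _ hφ, neg_neg]
  have e4 := weakDeriv_of_hasLineDerivAt hO h.cont h.cont_t h.hasDeriv_t _ hφ
  simp only [e2, sub_mul, Finset.sum_mul]
  rw [integral_sub i1 (integrable_finsetSum _ fun i _ => i2 i), integral_neg,
    integral_finsetSum _ fun i _ => i2 i, integral_sub (hφ.integrable_mul hO h.cont_t)
      (integrable_finsetSum _ fun i _ => i4 i), integral_finsetSum _ fun i _ => i4 i, e4]
  simp only [e3, neg_neg]

theorem WeakHeat.univ_of_support {W h : PSpace N → ℝ} (H : WeakHeat O W h) (hO : IsOpen O)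
    {K : Set (PSpace N)} (hK : IsCompact K) (hKO : K ⊆ O) (hW : ∀ z ∉ K, W z = 0)
    (hh : ∀ z ∉ K, h z = 0) : WeakHeat univ W h := by
  obtain ⟨χ, hχ, -, U, hU, hKU, hχU⟩ := exists_isTest_one hK hO hKO
  intro φ hφ
  have hχφ : IsTest O fun z => χ z * φ z := by
    simpa only [mul_comm] using hχ.smul_left hφ.smooth
  have hUe : EqOn (fun z => χ z * φ z) φ U := fun z hz => by simp [hχU z hz]
  have e1 : ∀ z, W z * heatAdj (fun z => χ z * φ z) z = W z * heatAdj φ z := fun z => by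
    by_cases hz : z ∈ K
    · rw [heatAdj_congr hU hUe (hKU hz)]
    · rw [hW z hz, zero_mul, zero_mul]
  have e2 : ∀ z, h z * (χ z * φ z) = h z * φ z := fun z => by
    by_cases hz : z ∈ K
    · rw [hχU z (hKU hz), one_mul]
    · rw [hh z hz, zero_mul, zero_mul]
  simpa only [e1, e2] using H _ hχφ

theorem IsTest.continuous_mul {φ g : PSpace N → ℝ} (h : IsTest O φ) (hO : IsOpen O)
    (hg : ContinuousOn g O) : Continuous fun z => φ z * g z := by
  refine continuous_of_tsupport fun z hz => ?_
  have hz' : z ∈ O := h.sub (closure_mono (Function.support_mul_subset_left _ _) hz)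
  exact h.smooth.continuous.continuousAt.mul (hg.continuousAt (hO.mem_nhds hz'))

theorem hasDerivAt_comp_max {g g' : ℝ → ℝ} (hg : ∀ y, 1 ≤ y → HasDerivAt g (g' y) y)
    (h1 : g' 1 = 0) (s : ℝ) : HasDerivAt (fun s => g (max s 1)) (g' (max s 1)) s := by
  rcases lt_trichotomy s 1 with hs | rfl | hs
  · rw [max_eq_right hs.le, h1]
    refine (hasDerivAt_const s (g 1)).congr_of_eventuallyEq ?_
    filter_upwards [gt_mem_nhds hs] with t ht
    rw [max_eq_right ht.le]
  · have h := hg 1 le_rfl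
    rw [h1, hasDerivAt_iff_isLittleO] at h
    rw [max_self, h1, hasDerivAt_iff_isLittleO]
    simp only [smul_zero, sub_zero, max_self] at h ⊢
    have ht : Tendsto (fun s : ℝ => max s 1) (𝓝 1) (𝓝 1) := by
      have : Continuous fun s : ℝ => max s 1 := by fun_prop
      simpa using this.tendsto 1
    refine (h.comp_tendsto ht).trans_isBigO (Asymptotics.IsBigO.of_bound 1
      (Eventually.of_forall fun t => ?_))
    simp only [Function.comp_apply, Real.norm_eq_abs, one_mul]
    have := abs_max_sub_max_le_abs t 1 1
    rwa [max_self] at this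
  · rw [max_eq_left hs.le]
    refine (hg s hs.le).congr_of_eventuallyEq ?_
    filter_upwards [lt_mem_nhds hs] with t ht
    rw [max_eq_left ht.le]

theorem exists_subsolution {q q₁ : ℝ} (hq₁ : 1 < q₁) (hq : q₁ < q)
    {u : PSpace N → ℝ} (hu : IsC21 O u)
    (he : ∀ z ∈ O, tDeriv u z - lapl u z + u z ^ q = 0) :
    ∃ (w wt : PSpace N → ℝ) (wx wxx : Fin N → PSpace N → ℝ), HasC21 O w wt wx wxx ∧
      (∀ z, 0 ≤ w z) ∧ (∀ z, u z - 3 ≤ w z) ∧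
      ∀ z ∈ O, wt z - ∑ i, wxx i z ≤ -(w z) ^ q₁ := by
  set P : ℝ → ℝ := fun y => y - 3 + 3 * y⁻¹ - (y ^ 2)⁻¹ with hP
  set P' : ℝ → ℝ := fun y => 1 - 3 * (y ^ 2)⁻¹ + 2 * (y ^ 3)⁻¹ with hP'
  set P'' : ℝ → ℝ := fun y => 6 * (y ^ 3)⁻¹ - 6 * (y ^ 4)⁻¹ with hP''
  have dP : ∀ y, 1 ≤ y → HasDerivAt P (P' y) y := fun y hy => by
    have hy0 : y ≠ 0 := by positivity
    have := ((((hasDerivAt_id y).sub_const 3).add ((hasDerivAt_inv hy0).const_mul 3)).sub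
      ((hasDerivAt_pow 2 y).inv (pow_ne_zero 2 hy0)))
    refine HasDerivAt.congr_deriv this ?_
    simp only [hP']
    field_simp
    ring
  have dP' : ∀ y, 1 ≤ y → HasDerivAt P' (P'' y) y := fun y hy => by
    have hy0 : y ≠ 0 := by positivity
    have := (((hasDerivAt_pow 2 y).inv (pow_ne_zero 2 hy0)).const_mul 3).const_sub 1 |>.add
      (((hasDerivAt_pow 3 y).inv (pow_ne_zero 3 hy0)).const_mul 2)
    refine HasDerivAt.congr_deriv this ?_
    simp only [hP'']
    field_simp
    ring
  have cP'' : Continuous fun s : ℝ => P'' (max s 1) := by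
    have h0 : ∀ s : ℝ, max s 1 ≠ 0 := fun s => by positivity
    simp only [hP'']
    fun_prop (disch := simp [h0])
  have hC := hu.hasC21.comp (hasDerivAt_comp_max dP (by norm_num [hP']))
    (hasDerivAt_comp_max dP' (by norm_num [hP''])) cP''
  have ineq : ∀ y : ℝ, 1 ≤ y → 0 ≤ P y ∧ P y ≤ P' y * y ∧ 0 ≤ P' y ∧ P' y ≤ 1 ∧ 0 ≤ P'' y ∧
      y - 3 ≤ P y := fun y hy => by
    have hy0 : 0 < y := by linarith
    have hy1 : 0 ≤ y - 1 := by linarith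
    refine ⟨?_, ?_, ?_, ?_, ?_, ?_⟩
    · have : P y = (y - 1) ^ 3 / y ^ 2 := by simp only [hP]; field_simp; ring
      rw [this]; positivity
    · have : P' y * y - P y = (y - 1) ^ 2 * 3 / y ^ 2 := by simp only [hP, hP']; field_simp; ring
      have h2 : 0 ≤ (y - 1) ^ 2 * 3 / y ^ 2 := by positivity
      linarith
    · have : P' y = (y - 1) ^ 2 * (y + 2) / y ^ 3 := by simp only [hP']; field_simp; ring
      rw [this]; positivity
    · have : 1 - P' y = (3 * (y - 1) + 1) / y ^ 3 := by simp only [hP']; field_simp; ring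
      have h2 : 0 ≤ (3 * (y - 1) + 1) / y ^ 3 := by positivity
      linarith
    · have : P'' y = 6 * (y - 1) / y ^ 4 := by simp only [hP'']; field_simp
      rw [this]; positivity
    · have : P y - (y - 3) = (3 * (y - 1) + 2) / y ^ 2 := by simp only [hP]; field_simp; ring
      have h2 : 0 ≤ (3 * (y - 1) + 2) / y ^ 2 := by positivity
      linarith
  refine ⟨_, _, _, _, hC, fun z => (ineq _ (le_max_right _ _)).1, fun z => ?_, fun z hz => ?_⟩
  · exact (sub_le_sub_right (le_max_left _ _) 3).trans (ineq _ (le_max_right _ _)).2.2.2.2.2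
  · obtain ⟨a1, a2, a3, a4, a5, -⟩ := ineq (max (u z) 1) (le_max_right _ _)
    have e := he z hz
    rw [lapl] at e
    rw [Finset.sum_add_distrib, ← Finset.mul_sum]
    have h1 : 0 ≤ ∑ i, P'' (max (u z) 1) * xDeriv i u z * xDeriv i u z :=
      Finset.sum_nonneg fun i _ => by rw [mul_assoc]; exact mul_nonneg a5 (mul_self_nonneg _)
    have h2 : P (max (u z) 1) ^ q₁ ≤ P' (max (u z) 1) * u z ^ q := by
      rcases le_or_gt 1 (u z) with hs | hs
      · rw [max_eq_left hs] at a1 a2 a3 a4 ⊢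
        calc P (u z) ^ q₁ ≤ (P' (u z) * u z) ^ q₁ := Real.rpow_le_rpow a1 a2 (by linarith)
          _ = P' (u z) ^ q₁ * u z ^ q₁ := Real.mul_rpow a3 (by linarith)
          _ ≤ P' (u z) * u z ^ q := by
            refine mul_le_mul ?_ (Real.rpow_le_rpow_of_exponent_le hs hq.le) (by positivity) a3
            simpa using Real.rpow_le_rpow_of_exponent_ge' a3 a4 zero_le_one hq₁.le
      · rw [max_eq_right hs.le]
        have e1 : P 1 = 0 := by norm_num [hP]
        have e2 : P' 1 = 0 := by norm_num [hP']
        rw [e1, e2, Real.zero_rpow (by linarith), zero_mul]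
    have e3 : P' (max (u z) 1) * (tDeriv u z - ∑ i, xxDeriv i i u z + u z ^ q) = 0 := by
      rw [e, mul_zero]
    nlinarith

end Subsolution

section Approximation

variable {N : ℕ} {O : Set (PSpace N)} {w wt : PSpace N → ℝ} {wx wxx : Fin N → PSpace N → ℝ}

theorem HasC21.exists_weakHeat_cutoff (h : HasC21 O w wt wx wxx) (hO : IsOpen O)
    {η : PSpace N → ℝ} (hη : IsTest O η) :
    ∃ g : PSpace N → ℝ, Continuous g ∧ HasCompactSupport g ∧
      WeakHeat univ (fun z => η z * w z) g ∧
      ∀ U, IsOpen U → EqOn η 1 U → ∀ z ∈ U, g z = wt z - ∑ i, wxx i z := by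
  have hηx := fun i => hη.dirDeriv (eX i)
  have hηxx := fun i => (hηx i).dirDeriv (eX i)
  have hzero : ∀ z ∉ tsupport η, η z = 0 ∧ dirDeriv eT η z = 0 ∧
      (∀ i, dirDeriv (eX i) η z = 0) ∧ ∀ i, dirDeriv (eX i) (dirDeriv (eX i) η) z = 0 := by
    have hd : ∀ (g : PSpace N → ℝ) (v z : PSpace N), z ∉ tsupport g → dirDeriv v g z = 0 :=
      fun g v z hz => image_eq_zero_of_notMem_tsupport fun h =>
        hz (tsupport_dirDeriv_subset g v h)
    exact fun z hz => ⟨image_eq_zero_of_notMem_tsupport hz, hd _ _ _ hz, fun i => hd _ _ _ hz,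
      fun i => hd _ _ _ fun h => hz (tsupport_dirDeriv_subset η _ h)⟩
  have hW := (h.smooth_mul hη.smooth).weakHeat hO
  refine ⟨_, ?_, ?_, hW.univ_of_support hO hη.compact.isCompact hη.sub (fun z hz => ?_)
    fun z hz => ?_, fun U hU hηU z hz => ?_⟩
  · refine (((hη.dirDeriv eT).continuous_mul hO h.cont).add (hη.continuous_mul hO h.cont_t)).sub
      (continuous_finsetSum _ fun i _ => ?_)
    exact (((hηxx i).continuous_mul hO h.cont).add (continuous_const.mul
      ((hηx i).continuous_mul hO (h.cont_x i)))).add (hη.continuous_mul hO (h.cont_xx i))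
  · refine hη.compact.isCompact.of_isClosed_subset (isClosed_tsupport _)
      (closure_minimal (fun z hz => ?_) (isClosed_tsupport _))
    by_contra hz'
    obtain ⟨h1, h2, h3, h4⟩ := hzero z hz'
    exact hz (by simp [h1, h2, h3, h4])
  · rw [(hzero z hz).1, zero_mul]
  · obtain ⟨h1, h2, h3, h4⟩ := hzero z hz
    simp [h1, h2, h3, h4]
  · have hd : ∀ (g : PSpace N → ℝ) (c : ℝ) (v : PSpace N), (∀ z ∈ U, g z = c) →
        ∀ z ∈ U, dirDeriv v g z = 0 := fun g c v hg z hz => by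
      rw [dirDeriv, (Filter.EventuallyEq.fderiv_eq (f := fun _ => c) (𝕜 := ℝ)
        (eventuallyEq_of_mem (hU.mem_nhds hz) hg))]
      simp
    have h1 : ∀ v, ∀ z ∈ U, dirDeriv v η z = 0 := fun v => hd η 1 v fun z hz => hηU hz
    have h2 : ∀ v, ∀ z ∈ U, dirDeriv v (dirDeriv v η) z = 0 := fun v => hd _ 0 v (h1 v)
    have h3 : η z = 1 := hηU hz
    simp [h1 _ z hz, h2 _ z hz, h3]

/-- A subsolution in `O` lies below a solution in a neighbourhood of any compact subset. -/
theorem HasC21.exists_weakHeat_ge (h : HasC21 O w wt wx wxx) (hO : IsOpen O) {p : ℝ} (hp : 1 < p)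
    (hw0 : ∀ z, 0 ≤ w z) (hw : ∀ z ∈ O, wt z - ∑ i, wxx i z ≤ -(w z) ^ p)
    {K : Set (PSpace N)} (hK : IsCompact K) (hKO : K ⊆ O) :
    ∃ (U : Set (PSpace N)) (V : PSpace N → ℝ), IsOpen U ∧ K ⊆ U ∧ Continuous V ∧
      (∀ z, 0 ≤ V z) ∧ (∀ z ∈ U, w z ≤ V z) ∧ WeakHeat U V fun z => -(V z) ^ p := by
  obtain ⟨η, hη, hη01, U, hU, hKU, hηU⟩ := exists_isTest_one hK hO hKO
  have hUO : U ⊆ O := fun z hz => hη.sub (subset_tsupport _ (by simp [hηU z hz]))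
  obtain ⟨g, hg, hgc, hWg, hgU⟩ := h.exists_weakHeat_cutoff hO hη
  replace hgU := hgU U hU hηU
  set W : PSpace N → ℝ := fun z => η z * w z with hW
  have hWcont : Continuous W := hη.continuous_mul hO h.cont
  have hWc : HasCompactSupport W := hη.compact.mul_right
  have hW0 : ∀ z, 0 ≤ W z := fun z => mul_nonneg (hη01 z).1 (hw0 z)
  have hWU : ∀ z ∈ U, W z = w z := fun z hz => by simp [hW, hηU z hz]
  obtain ⟨C₁, hC₁⟩ := hWc.exists_bound_of_continuous hWcont
  obtain ⟨C₂, hC₂⟩ := hgc.exists_bound_of_continuous hg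
  set A : ℝ := |C₁| + 1 with hA
  have hWA : ∀ z, W z ≤ A := fun z => by
    have := (le_abs_self _).trans (hC₁ z)
    linarith [le_abs_self C₁]
  set M : ℝ := A + (|C₂| + A ^ p) ^ p⁻¹ with hM
  have hA0 : 0 < A := by positivity
  have hAM : A ≤ M := le_add_of_nonneg_right (by positivity)
  have hM0 : 0 < M := hA0.trans_le hAM
  have hMp : |C₂| + A ^ p ≤ M ^ p := by
    calc |C₂| + A ^ p = ((|C₂| + A ^ p) ^ p⁻¹) ^ p :=
          (Real.rpow_inv_rpow (by positivity) (by linarith)).symm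
      _ ≤ M ^ p := Real.rpow_le_rpow (by positivity) (le_add_of_nonneg_left hA0.le) (by linarith)
  set F : PSpace N → ℝ := Uᶜ.indicator fun _ => M ^ p with hF
  have hFm : Measurable F := measurable_const.indicator hU.measurableSet.compl
  have hF0 : ∀ z, 0 ≤ F z := fun z => indicator_nonneg (fun _ _ => by positivity) z
  have hFM : ∀ z, F z ≤ M ^ p := fun z =>
    indicator_le_self' (fun _ _ => by positivity) z
  have hFU : ∀ z ∈ U, F z = 0 := fun z hz => indicator_of_notMem (not_not.2 hz) _
  obtain ⟨l, hl, V, hV, hVM, hVfix, hVmax⟩ := exists_mild_solution hp hM0 hFm hF0 hFM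
  have hWp : ∀ z, W z ^ p ≤ A ^ p := fun z => Real.rpow_le_rpow (hW0 z) (hWA z) (by linarith)
  have hgF : ∀ z, g z ≤ F z - W z ^ p := fun z => by
    by_cases hz : z ∈ U
    · rw [hgU z hz, hFU z hz, hWU z hz, zero_sub]
      exact hw z (hUO hz)
    · have h1 : F z = M ^ p := indicator_of_mem hz _
      have h2 : g z ≤ |C₂| := (le_abs_self _).trans ((hC₂ z).trans (le_abs_self _))
      linarith [hWp z]
  have hGm : ∀ v : PSpace N → ℝ, Measurable v → Measurable fun z => F z + (l * v z - v z ^ p) :=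
    fun v hv => hFm.add ((hv.const_mul l).sub (hv.pow_const p))
  have hGb : ∀ v : PSpace N → ℝ, (∀ z, v z ∈ Icc 0 M) →
      ∀ z, |F z + (l * v z - v z ^ p)| ≤ M ^ p + (l * M + M ^ p) := fun v hv z => by
    have h1 : v z ^ p ≤ M ^ p := Real.rpow_le_rpow (hv z).1 (hv z).2 (by linarith)
    have h2 : 0 ≤ v z ^ p := Real.rpow_nonneg (hv z).1 p
    have h3 : l * v z ≤ l * M := mul_le_mul_of_nonneg_left (hv z).2 hl.le
    have h4 : 0 ≤ l * v z := mul_nonneg hl.le (hv z).1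
    rw [abs_le]
    constructor <;> linarith [hF0 z, hFM z]
  have hWM : ∀ z, W z ∈ Icc 0 M := fun z => ⟨hW0 z, (hWA z).trans hAM⟩
  have hWV : ∀ z, W z ≤ V z := by
    refine hVmax W hWcont.measurable hWM fun z => ?_
    rw [hWg.eq_conv_dampedHeatK hl hWcont hWc hg hgc z]
    have hb : ∀ y, |g y + l * W y| ≤ |C₂| + l * A := fun y => by
      refine (abs_add_le _ _).trans (add_le_add ((hC₂ y).trans (le_abs_self _)) ?_)
      rw [abs_of_nonneg (mul_nonneg hl.le (hW0 y))]
      exact mul_le_mul_of_nonneg_left (hWA y) hl.le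
    exact conv_mono (integrable_dampedHeatK hl) (dampedHeatK_nonneg l)
      (hg.measurable.add (hWcont.measurable.const_mul l)) (hGm W hWcont.measurable)
      (fun y => (hb y).trans (le_max_left _ _)) (fun y => (hGb W hWM y).trans (le_max_right _ _))
      (fun y => by simp only [Pi.add_apply]; linarith [hgF y]) z
  refine ⟨U, V, hU, hKU, hV, fun z => (hVM z).1, fun z hz => hWU z hz ▸ hWV z, fun φ hφ => ?_⟩
  rw [weakHeat_conv hl (hGm V hV.measurable) (hGb V hVM) hVfix φ (hφ.mono (subset_univ _))]
  congr 1
  ext z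
  by_cases hz : z ∈ U
  · simp only [hFU z hz]; ring
  · rw [image_eq_zero_of_notMem_tsupport fun h => hz (hφ.sub h), mul_zero, mul_zero]

end Approximation

section KellerOsserman

theorem IsLocalMax.deriv_deriv_nonpos {f f' : ℝ → ℝ} {f'' x : ℝ} (h : IsLocalMax f x)
    (hf : ∀ᶠ y in 𝓝 x, HasDerivAt f (f' y) y) (hf' : HasDerivAt f' f'' x) : f'' ≤ 0 := by
  by_contra! hpos
  have hd : deriv f =ᶠ[𝓝 x] f' := hf.mono fun y hy => hy.deriv
  have hdd : deriv (deriv f) x = f'' := hd.deriv_eq.trans hf'.deriv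
  have hmin := isLocalMin_of_deriv_deriv_pos (hdd ▸ hpos) h.deriv_eq_zero
    hf.self_of_nhds.continuousAt
  have hconst : f =ᶠ[𝓝 x] fun _ => f x := by
    filter_upwards [h, hmin] with y h1 h2 using le_antisymm h1 h2
  have hd0 : deriv f =ᶠ[𝓝 x] fun _ => 0 := by
    filter_upwards [hconst.eventuallyEq_nhds] with y hy
    rw [hy.deriv_eq, deriv_const]
  rw [hd0.deriv_eq, deriv_const] at hdd
  exact hpos.ne hdd

/-- The profile `s ↦ p - 2 b s - s ^ 2`, raised to a power. -/
theorem hasDerivAt_quadratic_rpow {p b a s : ℝ} (h : 0 < p - 2 * b * s - s ^ 2) :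
    HasDerivAt (fun s => (p - 2 * b * s - s ^ 2) ^ a)
      ((-2 * b - 2 * s) * a * (p - 2 * b * s - s ^ 2) ^ (a - 1)) s := by
  have h1 : HasDerivAt (fun s : ℝ => p - 2 * b * s - s ^ 2) (-2 * b - 2 * s) s := by
    have := (((hasDerivAt_id s).const_mul (2 * b)).const_sub p).sub ((hasDerivAt_id s).pow 2)
    exact this.congr_deriv (by simp)
  exact h1.rpow_const (Or.inl h.ne')

theorem isLocalMax_sub_quadratic_rpow {v : ℝ → ℝ} {p b a m : ℝ} (hp : 0 < p)
    (h0 : v 0 * p ^ a = m) (hm : ∀ᶠ s in 𝓝 0, v s * (p - 2 * b * s - s ^ 2) ^ a ≤ m) :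
    IsLocalMax (fun s => v s - m * (p - 2 * b * s - s ^ 2) ^ (-a)) 0 := by
  have hpos : ∀ᶠ s : ℝ in 𝓝 0, 0 < p - 2 * b * s - s ^ 2 :=
    ContinuousAt.eventually_lt continuousAt_const (by fun_prop) (by simpa)
  filter_upwards [hpos, hm] with s hs hms
  have h1 : v s ≤ m * (p - 2 * b * s - s ^ 2) ^ (-a) := by
    rwa [Real.rpow_neg hs.le, ← div_eq_mul_inv, le_div_iff₀ (Real.rpow_pos_of_pos hs a)]
  have h2 : v 0 - m * p ^ (-a) = 0 := by
    rw [Real.rpow_neg hp.le, ← h0, mul_assoc, mul_inv_cancel₀ (Real.rpow_pos_of_pos hp a).ne']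
    ring
  simpa [h2] using h1

theorem deriv_eq_of_mul_quadratic_rpow_le {v : ℝ → ℝ} {v' p b a m : ℝ} (hp : 0 < p)
    (h0 : v 0 * p ^ a = m) (hm : ∀ᶠ s in 𝓝 0, v s * (p - 2 * b * s - s ^ 2) ^ a ≤ m)
    (hv : HasDerivAt v v' 0) : v' = m * (2 * b * a * p ^ (-a - 1)) := by
  have hd := hv.sub ((hasDerivAt_quadratic_rpow (p := p) (b := b) (a := -a) (s := 0)
    (by simpa)).const_mul m)
  have := (isLocalMax_sub_quadratic_rpow hp h0 hm).hasDerivAt_eq_zero hd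
  simp only [mul_zero, sub_zero, ne_eq, OfNat.ofNat_ne_zero, not_false_eq_true, zero_pow] at this
  linarith

theorem deriv_deriv_le_of_mul_quadratic_rpow_le {v v' : ℝ → ℝ} {v'' p b a m : ℝ} (hp : 0 < p)
    (h0 : v 0 * p ^ a = m) (hm : ∀ᶠ s in 𝓝 0, v s * (p - 2 * b * s - s ^ 2) ^ a ≤ m)
    (hv : ∀ᶠ s in 𝓝 0, HasDerivAt v (v' s) s) (hv' : HasDerivAt v' v'' 0) :
    v'' ≤ m * (4 * b ^ 2 * (a * (a + 1)) * p ^ (-a - 2) + 2 * a * p ^ (-a - 1)) := by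
  have hpos : ∀ᶠ s : ℝ in 𝓝 0, 0 < p - 2 * b * s - s ^ 2 :=
    ContinuousAt.eventually_lt continuousAt_const (by fun_prop) (by simpa)
  have hd1 : ∀ᶠ s in 𝓝 0, HasDerivAt (fun s => v s - m * (p - 2 * b * s - s ^ 2) ^ (-a))
      (v' s - m * ((-2 * b - 2 * s) * -a * (p - 2 * b * s - s ^ 2) ^ (-a - 1))) s := by
    filter_upwards [hpos, hv] with s hs hvs
    exact hvs.sub ((hasDerivAt_quadratic_rpow hs).const_mul m)
  have hl : HasDerivAt (fun s : ℝ => (-2 * b - 2 * s) * -a) (2 * a) 0 := by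
    have := (((hasDerivAt_id (0 : ℝ)).const_mul 2).const_sub (-2 * b)).mul_const (-a)
    exact this.congr_deriv (by ring)
  have hd2 := hv'.sub ((hl.mul (hasDerivAt_quadratic_rpow (p := p) (b := b) (a := -a - 1)
    (s := 0) (by simpa))).const_mul m)
  have := (isLocalMax_sub_quadratic_rpow hp h0 hm).deriv_deriv_nonpos hd1 hd2
  simp only [mul_zero, sub_zero, ne_eq, OfNat.ofNat_ne_zero, not_false_eq_true, zero_pow] at this
  rw [show -a - 1 - 1 = -a - 2 by ring] at this
  linarith

variable {N : ℕ}

/-- `R ^ 2` minus the squared Euclidean distance of `z` to `z₀`. -/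
noncomputable def bump (R : ℝ) (z₀ z : PSpace N) : ℝ := R ^ 2 - ‖z.1 - z₀.1‖ ^ 2 - (z.2 - z₀.2) ^ 2

theorem continuous_bump (R : ℝ) (z₀ : PSpace N) : Continuous (bump R z₀) := by
  unfold bump; fun_prop

theorem bump_add_smul_eX (R : ℝ) (z₀ z : PSpace N) (i : Fin N) (s : ℝ) :
    bump R z₀ (z + s • eX i) = bump R z₀ z - 2 * (z.1 - z₀.1) i * s - s ^ 2 := by
  have h : (z + s • eX i).1 - z₀.1 = (z.1 - z₀.1) + s • EuclideanSpace.single i (1 : ℝ) := by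
    simp [eX]; abel
  rw [bump, h, norm_add_sq_real, real_inner_smul_right, norm_smul]
  simp [bump, eX, EuclideanSpace.inner_single_right]
  ring

theorem bump_add_smul_eT (R : ℝ) (z₀ z : PSpace N) (s : ℝ) :
    bump R z₀ (z + s • eT) = bump R z₀ z - 2 * (z.2 - z₀.2) * s - s ^ 2 := by
  simp [bump, eT]
  ring

theorem mem_closedBall_of_bump_nonneg {R : ℝ} (hR : 0 ≤ R) {z₀ z : PSpace N}
    (h : 0 ≤ bump R z₀ z) : z ∈ closedBall z₀ R := by
  unfold bump at h
  rw [mem_closedBall, Prod.dist_eq, max_le_iff, dist_eq_norm, Real.dist_eq]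
  constructor
  · exact abs_le_of_sq_le_sq' (by nlinarith [sq_nonneg (z.2 - z₀.2)]) hR |>.2
  · exact abs_le_of_sq_le_sq (by nlinarith [sq_nonneg ‖z.1 - z₀.1‖]) hR

theorem le_bump {R : ℝ} {z₀ z : PSpace N} (h : z ∈ closedBall z₀ (R / 2)) :
    R ^ 2 / 2 ≤ bump R z₀ z := by
  rw [mem_closedBall, Prod.dist_eq, max_le_iff, dist_eq_norm, Real.dist_eq] at h
  have h1 := pow_le_pow_left₀ (norm_nonneg _) h.1 2
  have h2 := pow_le_pow_left₀ (abs_nonneg _) h.2 2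
  rw [sq_abs] at h2
  unfold bump
  linarith

/-- Interior estimate of Keller–Osserman type, at a maximum of `V * bump ^ a`. -/
theorem HasC21.rpow_le_of_isMaxOn {p R m : ℝ} (hp : 1 < p) (hR : 0 < R)
    {U : Set (PSpace N)} {V vt : PSpace N → ℝ} {vx vxx : Fin N → PSpace N → ℝ}
    (h : HasC21 U V vt vx vxx) (hU : IsOpen U) {z₀ z : PSpace N} (hz : z ∈ U)
    (hP : 0 < bump R z₀ z) (hVz : vt z - ∑ i, vxx i z ≤ -(V z) ^ p) (hm : 0 < m)
    (hVm : V z * bump R z₀ z ^ (2 / (p - 1)) = m)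
    (hmax : ∀ᶠ y in 𝓝 z, V y * bump R z₀ y ^ (2 / (p - 1)) ≤ m) :
    m ^ (p - 1) ≤ 4 * R ^ 2 * (2 / (p - 1) * (2 / (p - 1) + 1)) +
      2 * (2 / (p - 1)) * R ^ 2 * N + 2 * (2 / (p - 1)) * R ^ 3 := by
  set a := 2 / (p - 1) with ha
  have ha0 : 0 < a := div_pos two_pos (by linarith)
  set P := bump R z₀ z with hPdef
  have hline : ∀ e : PSpace N, Tendsto (fun s : ℝ => z + s • e) (𝓝 0) (𝓝 z) := fun e => by
    have : Continuous fun s : ℝ => z + s • e := by fun_prop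
    simpa using this.tendsto 0
  have hderiv : ∀ (e : PSpace N) (g g' : PSpace N → ℝ),
      (∀ y ∈ U, HasLineDerivAt ℝ g (g' y) y e) →
      ∀ᶠ s in 𝓝 (0 : ℝ), HasDerivAt (fun s => g (z + s • e)) (g' (z + s • e)) s := by
    intro e g g' hg
    filter_upwards [(hline e).eventually (hU.mem_nhds hz)] with s hs
    have := hg _ hs
    unfold HasLineDerivAt at this
    have h2 := HasDerivAt.scomp (h := fun r : ℝ => r - s) s
      (by simpa using this) ((hasDerivAt_id s).sub_const s)
    simp only [one_smul] at h2
    refine h2.congr_of_eventuallyEq (Eventually.of_forall fun r => ?_)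
    simp only [Function.comp]
    congr 1
    rw [sub_smul]
    abel
  have hx : ∀ i, vxx i z ≤
      m * (4 * (z.1 - z₀.1) i ^ 2 * (a * (a + 1)) * P ^ (-a - 2) + 2 * a * P ^ (-a - 1)) := by
    intro i
    have hmi := (hline (eX i)).eventually hmax
    simp only [bump_add_smul_eX] at hmi
    have hd := (hderiv (eX i) (vx i) (vxx i) (h.hasDeriv_xx i)).self_of_nhds
    simp only [zero_smul, add_zero] at hd
    exact deriv_deriv_le_of_mul_quadratic_rpow_le hP (by simpa using hVm) hmi
      (hderiv (eX i) V (vx i) (h.hasDeriv_x i)) hd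
  have ht : vt z = m * (2 * (z.2 - z₀.2) * a * P ^ (-a - 1)) := by
    have hmt := (hline eT).eventually hmax
    simp only [bump_add_smul_eT] at hmt
    have hd := (hderiv eT V vt h.hasDeriv_t).self_of_nhds
    simp only [zero_smul, add_zero] at hd
    exact deriv_eq_of_mul_quadratic_rpow_le hP (by simpa using hVm) hmt hd
  have hsum : ∑ i, vxx i z ≤
      m * (4 * ‖z.1 - z₀.1‖ ^ 2 * (a * (a + 1)) * P ^ (-a - 2) + N * (2 * a * P ^ (-a - 1))) := by
    refine (Finset.sum_le_sum fun i _ => hx i).trans_eq ?_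
    rw [EuclideanSpace.real_norm_sq_eq, ← Finset.mul_sum, Finset.sum_add_distrib]
    simp [Finset.mul_sum, Finset.sum_mul]
  have hz' := mem_closedBall_of_bump_nonneg hR.le hP.le
  rw [mem_closedBall, Prod.dist_eq, max_le_iff, dist_eq_norm, Real.dist_eq] at hz'
  have hb := pow_le_pow_left₀ (norm_nonneg _) hz'.1 2
  have hPR : P ≤ R ^ 2 := by
    rw [hPdef, bump]
    linarith [sq_nonneg ‖z.1 - z₀.1‖, sq_nonneg (z.2 - z₀.2)]
  set Q := P ^ (-a - 2) with hQ
  have hQ0 : 0 < Q := Real.rpow_pos_of_pos hP _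
  have hPQ : P ^ (-a - 1) = P * Q := by
    rw [hQ, show -a - 1 = 1 + (-a - 2) by ring, Real.rpow_add hP, Real.rpow_one]
  have hVp : V z ^ p = m * m ^ (p - 1) * Q := by
    have hV : V z = m * P ^ (-a) := by
      rw [Real.rpow_neg hP.le, ← hVm, mul_assoc, mul_inv_cancel₀ (Real.rpow_pos_of_pos hP a).ne',
        mul_one]
    have hap : -a * p = -a - 2 := by
      rw [ha]; field_simp [show p - 1 ≠ 0 by linarith]; ring
    rw [hV, Real.mul_rpow hm.le (Real.rpow_nonneg hP.le _), ← Real.rpow_mul hP.le, hap]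
    congr 1
    nth_rewrite 2 [← Real.rpow_one m]
    rw [← Real.rpow_add hm]
    congr 1
    ring
  rw [hVp] at hVz
  rw [hPQ] at hsum ht
  have key : m * Q * m ^ (p - 1) ≤ m * Q * (4 * ‖z.1 - z₀.1‖ ^ 2 * (a * (a + 1)) +
      2 * a * P * N + 2 * a * (P * -(z.2 - z₀.2))) := by
    rw [ht] at hVz
    linarith
  refine (le_of_mul_le_mul_left key (by positivity)).trans ?_
  have hPt : P * -(z.2 - z₀.2) ≤ R ^ 3 := by
    calc P * -(z.2 - z₀.2) ≤ P * R :=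
          mul_le_mul_of_nonneg_left ((neg_le_abs _).trans hz'.2) hP.le
      _ ≤ R ^ 2 * R := mul_le_mul_of_nonneg_right hPR hR.le
      _ = R ^ 3 := by ring
  gcongr

/-- Keller–Osserman estimate. -/
theorem exists_forall_le_of_subsolution (N : ℕ) {p R : ℝ} (hp : 1 < p) (hR : 0 < R) :
    ∃ C : ℝ, ∀ (U : Set (PSpace N)) (V vt : PSpace N → ℝ) (vx vxx : Fin N → PSpace N → ℝ),
      IsOpen U → HasC21 U V vt vx vxx → (∀ z ∈ U, vt z - ∑ i, vxx i z ≤ -(V z) ^ p) →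
      ∀ z₀, closedBall z₀ R ⊆ U → ∀ z ∈ closedBall z₀ (R / 2), V z ≤ C := by
  set a := 2 / (p - 1) with ha
  have hp1 : 0 < p - 1 := by linarith
  have ha0 : 0 < a := div_pos two_pos hp1
  set c := 4 * R ^ 2 * (a * (a + 1)) + 2 * a * R ^ 2 * N + 2 * a * R ^ 3 with hc
  have hc0 : 0 ≤ c := by positivity
  refine ⟨c ^ (p - 1)⁻¹ / (R ^ 2 / 2) ^ a, fun U V vt vx vxx hU h hV z₀ hsub z hz => ?_⟩
  have hbz := le_bump hz
  have hR2 : 0 < R ^ 2 / 2 := by positivity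
  obtain hVz | hVz := le_or_gt (V z) 0
  · exact hVz.trans (by positivity)
  have hzR : z ∈ closedBall z₀ R := closedBall_subset_closedBall (by linarith) hz
  have hGcont : ContinuousOn (fun y => V y * max (bump R z₀ y) 0 ^ a) (closedBall z₀ R) :=
    (h.cont.mono hsub).mul (((continuous_bump R z₀).max continuous_const).rpow_const
      fun y => Or.inr ha0.le).continuousOn
  obtain ⟨y, hy, hmax⟩ := (isCompact_closedBall z₀ R).exists_isMaxOn ⟨z, hzR⟩ hGcont
  have hzy := hmax hzR
  simp only [mem_ofPred_eq] at hzy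
  set m := V y * max (bump R z₀ y) 0 ^ a with hm
  have hbpos : 0 < bump R z₀ z := hR2.trans_le hbz
  rw [max_eq_left hbpos.le] at hzy
  have hm0 : 0 < m := (mul_pos hVz (Real.rpow_pos_of_pos hbpos a)).trans_le hzy
  have hby : 0 < bump R z₀ y := by
    by_contra! hneg
    rw [hm, max_eq_right hneg, Real.zero_rpow ha0.ne', mul_zero] at hm0
    exact hm0.false
  have hmc := h.rpow_le_of_isMaxOn hp hR hU (hsub hy) hby (hV y (hsub hy)) hm0
    (by rw [hm, max_eq_left hby.le]) (by
      filter_upwards [(continuous_bump R z₀).continuousAt.eventually (lt_mem_nhds hby)] with x hx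
      have := hmax (mem_closedBall_of_bump_nonneg hR.le hx.le)
      simpa only [mem_ofPred_eq, max_eq_left hx.le] using this)
  have hmc' : m ≤ c ^ (p - 1)⁻¹ := (Real.le_rpow_inv_iff_of_pos hm0.le hc0 hp1).2 hmc
  rw [le_div_iff₀ (Real.rpow_pos_of_pos hR2 a)]
  calc V z * (R ^ 2 / 2) ^ a ≤ V z * bump R z₀ z ^ a :=
        mul_le_mul_of_nonneg_left (Real.rpow_le_rpow hR2.le hbz ha0.le) hVz.le
    _ ≤ _ := hzy.trans hmc'

end KellerOsserman

section Limit

variable {N : ℕ} {O : Set (PSpace N)} {ι : Type*} {l : Filter ι}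
  {F : ι → PSpace N → ℝ} {f : PSpace N → ℝ}

theorem TendstoLocallyUniformlyOn.continuous_comp (h : TendstoLocallyUniformlyOn F f l O)
    (hO : IsOpen O) (hf : ContinuousOn f O) {g : ℝ → ℝ} (hg : Continuous g) :
    TendstoLocallyUniformlyOn (fun k z => g (F k z)) (fun z => g (f z)) l O := by
  rw [hO.tendstoLocallyUniformlyOn_iff_forall_tendsto] at h ⊢
  intro z hz
  have h1 : Tendsto (fun y : ι × PSpace N => f y.2) (l ×ˢ 𝓝 z) (𝓝 (f z)) :=
    (hf.continuousAt (hO.mem_nhds hz)).tendsto.comp tendsto_snd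
  have h2 : Tendsto (fun y : ι × PSpace N => F y.1 y.2) (l ×ˢ 𝓝 z) (𝓝 (f z)) := by
    have := tendsto_uniformity_iff_dist_tendsto_zero.1 (h z hz)
    exact tendsto_of_tendsto_of_dist h1 this
  exact (((hg.tendsto _).comp h1).prodMk_nhds ((hg.tendsto _).comp h2)).mono_right
    (nhds_le_uniformity _)

theorem TendstoLocallyUniformlyOn.tendsto_integral_mul (h : TendstoLocallyUniformlyOn F f l O)
    (hO : IsOpen O) (hF : ∀ k, Continuous (F k)) (hf : ContinuousOn f O) {ψ : PSpace N → ℝ}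
    (hψ : IsTest O ψ) :
    Tendsto (fun k => ∫ z, F k z * ψ z) l (𝓝 (∫ z, f z * ψ z)) := by
  rw [Metric.tendsto_nhds]
  intro ε hε
  set I := ∫ z, |ψ z| with hI
  have hI0 : 0 ≤ I := integral_nonneg fun z => abs_nonneg _
  have hu := Metric.tendstoUniformlyOn_iff.1 ((tendstoLocallyUniformlyOn_iff_forall_isCompact hO).1
    h _ hψ.sub hψ.compact.isCompact) (ε / (I + 1)) (by positivity)
  filter_upwards [hu] with k hk
  have hInt : Integrable fun z => F k z * ψ z := hψ.integrable_mul hO (hF k).continuousOn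
  rw [Real.dist_eq, ← integral_sub hInt (hψ.integrable_mul hO hf)]
  calc |∫ z, (F k z * ψ z - f z * ψ z)| ≤ ∫ z, ε / (I + 1) * |ψ z| := by
        refine norm_integral_le_of_norm_le (f := fun z => F k z * ψ z - f z * ψ z) (hψ.integrable.abs.const_mul _)
          (Eventually.of_forall fun z => ?_)
        rw [← sub_mul, norm_mul, Real.norm_eq_abs, Real.norm_eq_abs]
        by_cases hz : z ∈ tsupport ψ
        · refine mul_le_mul_of_nonneg_right ?_ (abs_nonneg _)
          have := (hk z hz).le
          rwa [Real.dist_eq, abs_sub_comm] at this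
        · simp [image_eq_zero_of_notMem_tsupport hz]
    _ = ε * (I / (I + 1)) := by rw [integral_const_mul]; ring
    _ < ε := mul_lt_of_lt_one_right hε ((div_lt_one (by positivity)).2 (by linarith))

/-- Solutions bounded by a common constant on a ball have a common modulus of continuity on a
smaller ball. -/
theorem exists_modulus_of_weakHeat (N : ℕ) {p r : ℝ} (hp : 1 < p) (hr : 0 < r) (C : ℝ) :
    ∃ osc : PSpace N → ℝ, Tendsto osc (𝓝 0) (𝓝 0) ∧ ∀ (U : Set (PSpace N)) (V : PSpace N → ℝ),
      IsOpen U → Continuous V → (∀ z, 0 ≤ V z) → (WeakHeat U V fun z => -(V z) ^ p) →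
      ∀ z₀, closedBall z₀ (3 * r) ⊆ U → (∀ z ∈ closedBall z₀ (3 * r), V z ≤ C) →
      ∀ z ∈ ball z₀ (2 * r), ∀ z' ∈ ball z₀ (2 * r), |V z - V z'| ≤ osc (z - z') := by
  obtain ⟨K, K', θ, hP⟩ := exists_isParametrix N hr
  refine ⟨fun y => (C ^ p + C) * transModulus K y + C * transModulus θ y, ?_, ?_⟩
  · simpa using ((tendsto_transModulus hP.int).const_mul (C ^ p + C)).add
      ((tendsto_transModulus hP.test.integrable).const_mul C)
  intro U V hU hV hV0 hw z₀ hsub hC z hz z' hz'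
  have hB := isCompact_closedBall z₀ (3 * r)
  have hf : Continuous fun z => -(V z) ^ p :=
    (hV.rpow_const fun _ => Or.inr (by linarith)).neg
  have heq := fun {z} hz => hw.eq_conv (z := z) hU hV.continuousOn hf.continuousOn hP hr hsub hz
  have hC0 : 0 ≤ C := (hV0 z₀).trans (hC z₀ (mem_closedBall_self (by positivity)))
  have hCp : 0 ≤ C ^ p := Real.rpow_nonneg hC0 p
  have h1 : ∀ y, |(closedBall z₀ (3 * r)).indicator (fun w => -(V w) ^ p + V w) y| ≤ C ^ p + C := by
    intro y
    by_cases hy : y ∈ closedBall z₀ (3 * r)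
    · rw [indicator_of_mem hy, abs_le]
      have := Real.rpow_le_rpow (hV0 y) (hC y hy) (by linarith : 0 ≤ p)
      have := Real.rpow_nonneg (hV0 y) p
      constructor <;> linarith [hC y hy, hV0 y]
    · rw [indicator_of_notMem hy, abs_zero]
      positivity
  have h2 : ∀ y, |(closedBall z₀ (3 * r)).indicator V y| ≤ C := by
    intro y
    by_cases hy : y ∈ closedBall z₀ (3 * r)
    · rw [indicator_of_mem hy, abs_of_nonneg (hV0 y)]
      exact hC y hy
    · rwa [indicator_of_notMem hy, abs_zero]
  rw [heq hz, heq hz']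
  refine le_trans ?_ (add_le_add
    (abs_conv_sub_le hP.int (measurable_indicator_of_continuousOn hB (hf.add hV).continuousOn)
      h1 z z')
    (abs_conv_sub_le hP.test.integrable (measurable_indicator_of_continuousOn hB hV.continuousOn)
      h2 z z'))
  rw [sub_sub_sub_comm]
  exact abs_sub _ _

theorem exists_limit_weakHeat {p : ℝ} (hp : 1 < p) (hO : IsOpen O) {U : ℕ → Set (PSpace N)}
    {V : ℕ → PSpace N → ℝ} (hU : ∀ k, IsOpen (U k))
    (hUO : ∀ K, IsCompact K → K ⊆ O → ∀ᶠ k in atTop, K ⊆ U k)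
    (hV : ∀ k, Continuous (V k)) (hV0 : ∀ k z, 0 ≤ V k z)
    (hw : ∀ k, WeakHeat (U k) (V k) fun z => -(V k z) ^ p)
    (hb : ∀ z₀ ∈ O, ∃ r > 0, ∃ C, closedBall z₀ r ⊆ O ∧
      ∀ᶠ k in atTop, ∀ z ∈ closedBall z₀ r, V k z ≤ C) :
    ∃ V' : PSpace N → ℝ, ContinuousOn V' O ∧ (WeakHeat O V' fun z => -(V' z) ^ p) ∧
      ∀ z ∈ O, ∀ m, (∀ᶠ k in atTop, m ≤ V k z) → m ≤ V' z := by
  set l : Ultrafilter ℕ := hyperfilter ℕ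
  have hl : (l : Filter ℕ) ≤ atTop := Nat.hyperfilter_le_atTop
  have hlim : ∀ z, ∃ y, z ∈ O → Tendsto (fun k => V k z) l (𝓝 y) := by
    intro z
    by_cases hz : z ∈ O
    · obtain ⟨r, hr, C, -, hC⟩ := hb z hz
      obtain ⟨y, -, hy⟩ := (isCompact_Icc (a := 0) (b := C)).ultrafilter_le_nhds
        (l.map fun k => V k z) (le_principal_iff.2 (hl (hC.mono fun k hk =>
          ⟨hV0 k z, hk z (mem_closedBall_self hr.le)⟩)))
      exact ⟨y, fun _ => hy⟩
    · exact ⟨0, fun h => absurd h hz⟩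
  choose V' hV' using hlim
  have hunif : TendstoLocallyUniformlyOn V V' l O := by
    rw [Metric.tendstoLocallyUniformlyOn_iff]
    intro ε hε z₀ hz₀
    obtain ⟨r, hr, C, hrO, hC⟩ := hb z₀ hz₀
    obtain ⟨osc, hosc, hmod⟩ := exists_modulus_of_weakHeat N hp (r := r / 3) (by positivity) C
    have hnear : ∀ᶠ z in 𝓝 z₀, osc (z - z₀) < ε / 4 := by
      have : Tendsto (fun z => z - z₀) (𝓝 z₀) (𝓝 0) := by
        simpa using (continuous_id.sub continuous_const).tendsto z₀ (f := fun z => z - z₀)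
      exact (hosc.comp this).eventually (gt_mem_nhds (by positivity))
    have hball : ball z₀ (2 * (r / 3)) ∈ 𝓝 z₀ := ball_mem_nhds _ (by positivity)
    have hclose : ∀ᶠ k in (l : Filter ℕ), ∀ z ∈ {z | osc (z - z₀) < ε / 4} ∩ ball z₀ (2 * (r / 3)),
        |V k z - V k z₀| ≤ ε / 4 := by
      filter_upwards [hl hC, hl (hUO _ (isCompact_closedBall z₀ r) hrO)] with k hk hkU z hz
      rw [← mul_div_cancel₀ r (three_ne_zero' ℝ)] at hk hkU
      exact (hmod (U k) (V k) (hU k) (hV k) (hV0 k) (hw k) z₀ hkU hk z hz.2 z₀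
        (mem_ball_self (by positivity))).trans hz.1.le
    refine ⟨_, mem_nhdsWithin_of_mem_nhds (inter_mem (inter_mem hnear hball) (hO.mem_nhds hz₀)), ?_⟩
    have hpt := Metric.tendsto_nhds.1 (hV' z₀ hz₀) (ε / 4) (by positivity)
    filter_upwards [hclose, hpt] with k hk hkz z hz
    have hosc' : |V' z - V' z₀| ≤ ε / 4 :=
      le_of_tendsto ((hV' z hz.2).sub (hV' z₀ hz₀)).abs (hclose.mono fun k hk => hk z hz.1)
    have h1 := abs_le.1 (hk z hz.1)
    have h2 := abs_le.1 hosc'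
    rw [Real.dist_eq, abs_lt] at hkz ⊢
    constructor <;> linarith [h1.1, h1.2, h2.1, h2.2, hkz.1, hkz.2]
  have hcont : ContinuousOn V' O :=
    hunif.continuousOn (Eventually.of_forall fun k => (hV k).continuousOn).frequently
  have hpow : Continuous fun s : ℝ => -s ^ p :=
    (Real.continuous_rpow_const (by linarith)).neg
  refine ⟨V', hcont, fun φ hφ => ?_, fun z hz m hm => ge_of_tendsto (hV' z hz) (hl hm)⟩
  refine tendsto_nhds_unique (hunif.tendsto_integral_mul hO hV hcont hφ.heatAdj) ?_
  refine ((hunif.continuous_comp hO hcont hpow).tendsto_integral_mul hO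
    (fun k => hpow.comp (hV k)) (hpow.comp_continuousOn hcont) hφ).congr' ?_
  filter_upwards [hl (hUO _ hφ.compact.isCompact hφ.sub)] with k hk
  exact (hw k φ ⟨hφ.smooth, hφ.compact, hk⟩).symm

end Limit

section Existence

variable {N : ℕ} {O : Set (PSpace N)}

theorem exists_compact_exhaustion (hO : IsOpen O) (hOb : Bornology.IsBounded O) :
    ∃ K : ℕ → Set (PSpace N), (∀ k, IsCompact (K k) ∧ K k ⊆ O) ∧
      ∀ S, IsCompact S → S ⊆ O → ∀ᶠ k in atTop, S ⊆ K k := by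
  refine ⟨fun k => {z ∈ closure O | (k : ℝ≥0∞)⁻¹ ≤ infEDist z Oᶜ}, fun k => ⟨?_, fun z hz => ?_⟩,
    fun S hS hSO => ?_⟩
  · exact hOb.isCompact_closure.inter_right (isClosed_le continuous_const continuous_infEDist)
  · by_contra hzO
    exact (ENNReal.inv_pos.2 (ENNReal.natCast_ne_top k)).not_ge
      (hz.2.trans_eq (infEDist_zero_of_mem hzO))
  · obtain rfl | hne := S.eq_empty_or_nonempty
    · simp
    obtain ⟨z, hz, hmin⟩ := hS.exists_isMinOn hne
      (continuous_infEDist (s := Oᶜ)).continuousOn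
    have hpos : 0 < infEDist z Oᶜ :=
      infEDist_pos_iff_notMem_closure.2 (by simpa [hO.isClosed_compl.closure_eq] using hSO hz)
    filter_upwards [ENNReal.tendsto_inv_nat_nhds_zero.eventually (gt_mem_nhds hpos)] with k hk y hy
    exact ⟨subset_closure (hSO hy), hk.le.trans (hmin hy)⟩

theorem HasC21.exists_isC21_ge {w wt : PSpace N → ℝ} {wx wxx : Fin N → PSpace N → ℝ}
    (h : HasC21 O w wt wx wxx) (hO : IsOpen O) (hOb : Bornology.IsBounded O) {p : ℝ} (hp : 1 < p)
    (hw0 : ∀ z, 0 ≤ w z) (hw : ∀ z ∈ O, wt z - ∑ i, wxx i z ≤ -(w z) ^ p) :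
    ∃ V : PSpace N → ℝ, IsC21 O V ∧ (∀ z ∈ O, tDeriv V z - lapl V z + V z ^ p = 0) ∧
      ∀ z ∈ O, w z ≤ V z := by
  obtain ⟨K, hK, hKO⟩ := exists_compact_exhaustion hO hOb
  choose U V hU hKU hV hV0 hwV hweak using fun k =>
    h.exists_weakHeat_ge hO hp hw0 hw (hK k).1 (hK k).2
  have hUO : ∀ S, IsCompact S → S ⊆ O → ∀ᶠ k in atTop, S ⊆ U k := fun S hS hSO =>
    (hKO S hS hSO).mono fun k hk => hk.trans (hKU k)
  obtain ⟨V', hV', hweak', hge⟩ := exists_limit_weakHeat hp hO hU hUO hV hV0 hweak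
    fun z₀ hz₀ => by
      obtain ⟨R, hR, hRO⟩ := Metric.nhds_basis_closedBall.mem_iff.1 (hO.mem_nhds hz₀)
      obtain ⟨C, hC⟩ := exists_forall_le_of_subsolution N hp hR
      refine ⟨R / 2, by positivity, C,
        (closedBall_subset_closedBall (by linarith)).trans hRO, ?_⟩
      filter_upwards [hUO _ (isCompact_closedBall z₀ R) hRO] with k hk
      obtain ⟨hreg, heq⟩ := (hweak k).isC21 hp (hU k) (hV k).continuousOn
      refine hC (U k) (V k) _ _ _ (hU k) hreg.hasC21 (fun z hz => ?_) z₀ hk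
      have := heq z hz
      rw [lapl] at this
      linarith
  obtain ⟨hreg, heq⟩ := hweak'.isC21 hp hO hV'
  refine ⟨V', hreg, heq, fun z hz => hge z hz _ ?_⟩
  filter_upwards [hUO {z} isCompact_singleton (by simpa using hz)] with k hk
  exact hwV k z (hk rfl)

end Existence

end LargeSolutions

/-- **Remark 3.3.** If `∂_t u - Δu + u^q = 0` has a large solution in `O`, so does
`∂_t u - Δu + u^{q₁} = 0` for every `1 < q₁ < q`. -/
theorem large_solution_smaller_exponent
    (N : ℕ) (hN : 2 ≤ N) (q : ℝ) (hq : 1 < q)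
    (O : Set (PSpace N)) (hO : IsOpen O) (hOb : Bornology.IsBounded O)
    (hL : ∃ u : PSpace N → ℝ, IsLargeSolution O (fun s => s ^ q) u)
    (q₁ : ℝ) (hq₁ : 1 < q₁) (hq₁q : q₁ < q) :
    ∃ u : PSpace N → ℝ, IsLargeSolution O (fun s => s ^ q₁) u := by
  obtain ⟨u, hu, hequ, hblow⟩ := hL
  obtain ⟨w, wt, wx, wxx, hw, hw0, huw, hsub⟩ := exists_subsolution hq₁ hq₁q hu hequ
  obtain ⟨V, hV, heq, hwV⟩ := hw.exists_isC21_ge hO hOb hq₁ hw0 hsub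
  refine ⟨V, hV, heq, fun z hz M => ?_⟩
  obtain ⟨δ, hδ, h⟩ := hblow z hz (M + 3)
  exact ⟨δ, hδ, fun y hy => by linarith [h y hy, huw y, hwV y hy.1]⟩
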